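/- (Main theorem; Minkowski's conjecture in Davis's amendment) Let p_0 be the unique real number with 2.57 ≤ p_0 ≤ 2.58 satisfying Δ(p_0, σ_{p_0}) = Δ(p_0, 1). Then the critical determinant of D_p is given by: Δ(D_p) = Δ(p,1) if 1 < p ≤ 2 or p ≥ p_0, and Δ(D_p) = Δ(p,σ_p) if 2 ≤ p ≤ p_0. -/

import Mathlib

/-- `σ_p = (2^p - 1)^{1/p}`. -/
noncomputable def sigmaP (p : ℝ) : ℝ := (2 ^ p - 1) ^ (1 / p)

/-- `A = A(p,σ,τ) = (1 + τ^p)^{-1/p} - (1 + σ^p)^{-1/p}`. -/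
noncomputable def Acoef (p σ τ : ℝ) : ℝ := (1 + τ ^ p) ^ (-1 / p) - (1 + σ ^ p) ^ (-1 / p)

/-- `B = B(p,σ,τ) = σ (1 + σ^p)^{-1/p} + τ (1 + τ^p)^{-1/p}`. -/
noncomputable def Bcoef (p σ τ : ℝ) : ℝ :=
  σ * (1 + σ ^ p) ^ (-1 / p) + τ * (1 + τ ^ p) ^ (-1 / p)

/-- Given the branch `T : σ ↦ τ(p,σ)`, the Minkowski–Cohn function
`Δ(p,σ) = (τ(p,σ) + σ)(1 + τ(p,σ)^p)^{-1/p}(1 + σ^p)^{-1/p}`. -/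
noncomputable def DeltaFun (p : ℝ) (T : ℝ → ℝ) (σ : ℝ) : ℝ :=
  (T σ + σ) * (1 + T σ ^ p) ^ (-1 / p) * (1 + σ ^ p) ^ (-1 / p)

/-- The points of the full-rank lattice in `ℝ²` spanned by `(a, b)` and `(c, d)`. -/
def latticePts (a b c d : ℝ) : Set (ℝ × ℝ) :=
  {v | ∃ m n : ℤ, v = (m * a + n * c, m * b + n * d)}

/-- A lattice is admissible for `M` if it contains no point of `M` other than possibly
the origin. -/
def IsAdmissible (a b c d : ℝ) (M : Set (ℝ × ℝ)) : Prop :=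
  ∀ v ∈ latticePts a b c d, v ∈ M → v = 0

/-- The critical determinant of `M`: the infimum of the covolumes `|ad - bc|` over all
full-rank `M`-admissible lattices. -/
noncomputable def critDet (M : Set (ℝ × ℝ)) : ℝ :=
  sInf {δ : ℝ | ∃ a b c d : ℝ,
    a * d - b * c ≠ 0 ∧ IsAdmissible a b c d M ∧ δ = |a * d - b * c|}

/-- The region `D_p = {(x,y) : |x|^p + |y|^p < 1}`. -/
def Dset (p : ℝ) : Set (ℝ × ℝ) := {v | |v.1| ^ p + |v.2| ^ p < 1}

noncomputable section

/-- Forces the evaluation of a natural number before it is passed on. -/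
def forceNat {α : Type} (n : ℕ) (k : ℕ → α) : α :=
  Nat.rec (k 0) (fun m _ => k (m + 1)) n

/-- Forces the evaluation of an integer before it is passed on. -/
def forceInt {α : Type} (n : ℤ) (k : ℤ → α) : α :=
  Int.rec (fun a => forceNat a fun a => k (Int.ofNat a))
    (fun a => forceNat a fun a => k (Int.negSucc a)) n

/-- Forces the evaluation of a Boolean before it is passed on. -/
def forceBool {α : Type} (b : Bool) (k : Bool → α) : α :=
  Bool.rec (k false) (k true) b

theorem forceNat_eq {α : Type} (n : ℕ) (k : ℕ → α) : forceNat n k = k n := by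
  cases n <;> rfl

theorem forceInt_eq {α : Type} (n : ℤ) (k : ℤ → α) : forceInt n k = k n := by
  cases n <;> simp [forceInt, forceNat_eq]

theorem forceBool_eq {α : Type} (b : Bool) (k : Bool → α) : forceBool b k = k b := by
  cases b <;> rfl

/-- The fixed-point scale `2 ^ 40`. -/
abbrev fixScale : ℤ := 1099511627776

/-- An affine form `c + x u + y v + z w` with error bound `e`, in units of `2 ^ (-40)`; the flag
`ok` records that every operation leading to it was inside its range of validity. -/
structure AffForm where
  ok : Bool
  c : ℤ
  x : ℤ
  y : ℤ
  z : ℤ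
  e : ℕ

/-- Values of the three noise variables. -/
structure Noise where
  u : ℝ
  v : ℝ
  w : ℝ
  abs_u_le : |u| ≤ 1
  abs_v_le : |v| ≤ 1
  abs_w_le : |w| ≤ 1

namespace AffForm

/-- The form `a` encloses the real `f` at the noise values `t`. -/
def Encl (a : AffForm) (t : Noise) (f : ℝ) : Prop :=
  a.ok = true → |f * fixScale - (a.c + a.x * t.u + a.y * t.v + a.z * t.w)| ≤ a.e

/-- Forces the evaluation of an affine form before it is passed on. -/
def bind {α : Type} (a : AffForm) (k : AffForm → α) : α :=
  AffForm.rec (fun o c x y z e => k ⟨o, c, x, y, z, e⟩) a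

theorem bind_eq {α : Type} (a : AffForm) (k : AffForm → α) : a.bind k = k a := by
  cases a; rfl

/-- Builds an affine form from evaluated parts. -/
def mkForced (o : Bool) (c x y z : ℤ) (e : ℕ) : AffForm :=
  forceBool o fun o => forceInt c fun c => forceInt x fun x => forceInt y fun y =>
    forceInt z fun z => forceNat e fun e => ⟨o, c, x, y, z, e⟩

theorem mkForced_eq (o : Bool) (c x y z : ℤ) (e : ℕ) :
    mkForced o c x y z e = ⟨o, c, x, y, z, e⟩ := by
  simp [mkForced, forceBool_eq, forceInt_eq, forceNat_eq]

/-- The radius of an affine form about its centre. -/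
def rad (a : AffForm) : ℕ := a.x.natAbs + a.y.natAbs + a.z.natAbs + a.e

/-- The enclosure of a rational constant `n / d`. -/
def const (n : ℤ) (d : ℕ) : AffForm :=
  mkForced true (n * fixScale / (d : ℤ)) 0 0 0 1

/-- The sum of two affine forms. -/
def add (a b : AffForm) : AffForm :=
  mkForced (a.ok && b.ok) (a.c + b.c) (a.x + b.x) (a.y + b.y) (a.z + b.z) (a.e + b.e)

/-- The difference of two affine forms. -/
def sub (a b : AffForm) : AffForm :=
  mkForced (a.ok && b.ok) (a.c - b.c) (a.x - b.x) (a.y - b.y) (a.z - b.z) (a.e + b.e)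

/-- The product of two affine forms. -/
def mul (a b : AffForm) : AffForm :=
  mkForced (a.ok && b.ok) (a.c * b.c / fixScale) ((a.c * b.x + b.c * a.x) / fixScale)
    ((a.c * b.y + b.c * a.y) / fixScale) ((a.c * b.z + b.c * a.z) / fixScale)
    ((a.c.natAbs * b.e + b.c.natAbs * a.e + a.rad * b.rad) / 1099511627776 + 5)

/-- `1 - a`. -/
def oneSub (a : AffForm) : AffForm :=
  mkForced a.ok (fixScale - a.c) (-a.x) (-a.y) (-a.z) a.e

/-- Decides that the enclosed real is positive. -/
def pos (a : AffForm) : Bool := a.ok && decide ((a.rad : ℤ) < a.c)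

/-- Decides that the enclosed real is negative. -/
def neg (a : AffForm) : Bool := a.ok && decide ((a.rad : ℤ) < -a.c)

variable {a b : AffForm} {t : Noise} {f g : ℝ}

theorem Encl.abs_sub_center_le (h : a.Encl t f) (ho : a.ok = true) : |f * fixScale - a.c| ≤ a.rad := by
  have h := h ho
  have lin_le : ∀ (n : ℤ) (t : ℝ), |t| ≤ 1 → |(n : ℝ) * t| ≤ (n.natAbs : ℝ) := by
    intro n t ht
    rw [abs_mul, Nat.cast_natAbs, Int.cast_abs]
    exact mul_le_of_le_one_right (abs_nonneg _) ht
  have h1 := lin_le a.x t.u t.abs_u_le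
  have h2 := lin_le a.y t.v t.abs_v_le
  have h3 := lin_le a.z t.w t.abs_w_le
  simp only [rad]
  push_cast at h ⊢
  rw [abs_le] at *
  constructor <;> linarith [h.1, h.2, h1.1, h1.2, h2.1, h2.2, h3.1, h3.2]

theorem Encl.lt_of_pos (h : a.Encl t f)
    (hp : a.pos = true) : 0 < f := by
  simp only [pos, Bool.and_eq_true, decide_eq_true_eq] at hp
  have h1 := h.abs_sub_center_le hp.1
  have h2 : ((a.rad : ℤ) : ℝ) < (a.c : ℝ) := by exact_mod_cast hp.2
  push_cast at h2
  have := (abs_le.mp h1).1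
  have h3 : 0 < f * fixScale := by linarith
  have : (0 : ℝ) < (fixScale : ℝ) := by norm_num
  exact pos_of_mul_pos_left h3 this.le

theorem Encl.lt_of_neg (h : a.Encl t f)
    (hp : a.neg = true) : f < 0 := by
  simp only [neg, Bool.and_eq_true, decide_eq_true_eq] at hp
  have h1 := h.abs_sub_center_le hp.1
  have h2 : ((a.rad : ℤ) : ℝ) < ((-a.c : ℤ) : ℝ) := by exact_mod_cast hp.2
  push_cast at h2
  have := (abs_le.mp h1).2
  have h3 : 0 < (-f) * fixScale := by linarith
  have : (0 : ℝ) < (fixScale : ℝ) := by norm_num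
  linarith [pos_of_mul_pos_left h3 this.le]

/-- Rounding down an integer quotient costs less than one unit. -/
theorem abs_sub_ediv_le (n : ℤ) {d : ℤ} (hd : 0 < d) :
    |(n : ℝ) / d - ((n / d : ℤ) : ℝ)| ≤ 1 := by
  have hd' : (0 : ℝ) < d := by exact_mod_cast hd
  have h : (n : ℝ) = d * ((n / d : ℤ) : ℝ) + ((n % d : ℤ) : ℝ) := by
    exact_mod_cast (Int.mul_ediv_add_emod n d).symm
  have h1 : (0 : ℝ) ≤ ((n % d : ℤ) : ℝ) := by exact_mod_cast Int.emod_nonneg n hd.ne'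
  have h2 : ((n % d : ℤ) : ℝ) ≤ d := by exact_mod_cast (Int.emod_lt_of_pos n hd).le
  have h3 : (n : ℝ) / d - ((n / d : ℤ) : ℝ) = ((n % d : ℤ) : ℝ) / d := by
    rw [h]; field_simp; ring
  rw [h3, abs_of_nonneg (by positivity)]
  exact (div_le_one hd').mpr h2

theorem encl_const (n : ℤ) {d : ℕ} (hd : 0 < d) : (const n d).Encl t ((n : ℝ) / d) := by
  intro _
  have h := abs_sub_ediv_le (n * fixScale) (d := d) (by exact_mod_cast hd)
  simp only [const, mkForced_eq]
  push_cast at h ⊢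
  convert h using 2
  · ring

theorem Encl.add (ha : a.Encl t f) (hb : b.Encl t g) :
    (a.add b).Encl t (f + g) := by
  intro ho
  simp only [AffForm.add, mkForced_eq, Bool.and_eq_true] at ho ⊢
  have h1 := abs_le.mp (ha ho.1)
  have h2 := abs_le.mp (hb ho.2)
  push_cast at h1 h2 ⊢
  rw [abs_le]
  constructor <;> linarith [h1.1, h1.2, h2.1, h2.2]

theorem Encl.sub (ha : a.Encl t f) (hb : b.Encl t g) :
    (a.sub b).Encl t (f - g) := by
  intro ho
  simp only [AffForm.sub, mkForced_eq, Bool.and_eq_true] at ho ⊢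
  have h1 := abs_le.mp (ha ho.1)
  have h2 := abs_le.mp (hb ho.2)
  push_cast at h1 h2 ⊢
  rw [abs_le]
  constructor <;> linarith [h1.1, h1.2, h2.1, h2.2]

theorem Encl.oneSub (ha : a.Encl t f) : a.oneSub.Encl t (1 - f) := by
  intro ho
  simp only [AffForm.oneSub, mkForced_eq] at ho ⊢
  have h1 := abs_le.mp (ha ho)
  push_cast at h1 ⊢
  rw [abs_le]
  constructor <;> linarith [h1.1, h1.2]

/-- Rounding up a natural quotient. -/
theorem div_le_natDiv_add_one (n : ℕ) {d : ℕ} (hd : 0 < d) :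
    (n : ℝ) / d ≤ ((n / d : ℕ) : ℝ) + 1 := by
  have hd' : (0 : ℝ) < d := by exact_mod_cast hd
  rw [div_le_iff₀ hd']
  have := (Nat.lt_div_mul_add hd (a := n)).le
  have h : (n : ℝ) ≤ ((n / d : ℕ) : ℝ) * d + d := by exact_mod_cast this
  linarith

theorem Encl.mul (ha : a.Encl t f) (hb : b.Encl t g) : (a.mul b).Encl t (f * g) := by
  intro ho
  simp only [AffForm.mul, mkForced_eq, Bool.and_eq_true] at ho ⊢
  have hA := ha.abs_sub_center_le ho.1
  have hB := hb.abs_sub_center_le ho.2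
  have h1 := ha ho.1
  have h2 := hb ho.2
  set s : ℝ := ((fixScale : ℤ) : ℝ) with hs
  have hs0 : (0 : ℝ) < s := by rw [hs]; norm_num
  set F := f * s with hF
  set G := g * s with hG
  have r0 := abs_sub_ediv_le (a.c * b.c) (d := fixScale) (by norm_num)
  have rx := abs_sub_ediv_le (a.c * b.x + b.c * a.x) (d := fixScale) (by norm_num)
  have ry := abs_sub_ediv_le (a.c * b.y + b.c * a.y) (d := fixScale) (by norm_num)
  have rz := abs_sub_ediv_le (a.c * b.z + b.c * a.z) (d := fixScale) (by norm_num)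
  have re := div_le_natDiv_add_one
    (a.c.natAbs * b.e + b.c.natAbs * a.e + a.rad * b.rad) (d := 1099511627776) (by norm_num)
  have hsn : ((1099511627776 : ℕ) : ℝ) = s := by rw [hs]; norm_num
  rw [← hs] at r0 rx ry rz
  rw [hsn] at re
  push_cast at re r0 rx ry rz ⊢
  set Q0 := ((a.c * b.c / fixScale : ℤ) : ℝ)
  set Qx := (((a.c * b.x + b.c * a.x) / fixScale : ℤ) : ℝ)
  set Qy := (((a.c * b.y + b.c * a.y) / fixScale : ℤ) : ℝ)
  set Qz := (((a.c * b.z + b.c * a.z) / fixScale : ℤ) : ℝ)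
  have key : |F * G / s - ((a.c : ℝ) * b.c / s + ((a.c : ℝ) * b.x + b.c * a.x) / s * t.u
      + ((a.c : ℝ) * b.y + b.c * a.y) / s * t.v + ((a.c : ℝ) * b.z + b.c * a.z) / s * t.w)|
      ≤ ((a.c.natAbs : ℝ) * b.e + b.c.natAbs * a.e + a.rad * b.rad) / s := by
    have e1 : F * G / s - ((a.c : ℝ) * b.c / s + ((a.c : ℝ) * b.x + b.c * a.x) / s * t.u
      + ((a.c : ℝ) * b.y + b.c * a.y) / s * t.v + ((a.c : ℝ) * b.z + b.c * a.z) / s * t.w)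
      = ((a.c : ℝ) * (G - (b.c + b.x * t.u + b.y * t.v + b.z * t.w))
        + b.c * (F - (a.c + a.x * t.u + a.y * t.v + a.z * t.w)) + (F - a.c) * (G - b.c)) / s := by
      field_simp; ring
    rw [e1, abs_div, abs_of_pos hs0]
    gcongr
    refine (abs_add_le _ _).trans (add_le_add ((abs_add_le _ _).trans (add_le_add ?_ ?_)) ?_)
    · rw [abs_mul, Nat.cast_natAbs, Int.cast_abs]; gcongr
    · rw [abs_mul, Nat.cast_natAbs, Int.cast_abs]; gcongr
    · rw [abs_mul]; gcongr
  have mulabs : ∀ d t : ℝ, |d| ≤ 1 → |t| ≤ 1 → |d * t| ≤ 1 := by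
    intro d t hd ht
    rw [abs_mul]; exact mul_le_one₀ hd (abs_nonneg _) ht
  have kx := mulabs _ _ rx t.abs_u_le
  have ky := mulabs _ _ ry t.abs_v_le
  have kz := mulabs _ _ rz t.abs_w_le
  have hfg : f * g * s = F * G / s := by rw [hF, hG]; field_simp
  rw [hfg]
  rw [abs_le] at key kx ky kz r0 ⊢
  constructor <;>
    linarith [key.1, key.2, kx.1, kx.2, ky.1, ky.2, kz.1, kz.2, r0.1, r0.2, re]

end AffForm
end

noncomputable section

/-- A real enclosed by a centre and a radius, in units of `2 ^ (-40)`. -/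
structure FixBall where
  c : ℤ
  e : ℕ

namespace FixBall

/-- The ball `b` encloses the real `f`. -/
def Encl (b : FixBall) (f : ℝ) : Prop := |f * fixScale - b.c| ≤ b.e

/-- Builds a ball from evaluated parts. -/
def mkForced (c : ℤ) (e : ℕ) : FixBall := forceInt c fun c => forceNat e fun e => ⟨c, e⟩

theorem mkForced_eq (c : ℤ) (e : ℕ) : mkForced c e = ⟨c, e⟩ := by
  simp [mkForced, forceInt_eq, forceNat_eq]

/-- One Horner step `f ↦ 1 + x f / k` for `x = n / (128 * 2 ^ 40)`. -/
def expStep (n : ℤ) (k : ℕ) (b : FixBall) : FixBall :=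
  mkForced (fixScale + n * b.c / (140737488355328 * k))
    (n.natAbs * b.e / (140737488355328 * k) + 2)

/-- The square of a ball. -/
def sq (b : FixBall) : FixBall :=
  mkForced (b.c * b.c / fixScale) ((2 * b.c.natAbs * b.e + b.e * b.e) / 1099511627776 + 2)

/-- An enclosure of `exp (n / 2 ^ 40)`, valid for `|n| ≤ 8 * 2 ^ 40`. -/
def expPoint (n : ℤ) : FixBall :=
  let b := expStep n 1 (expStep n 2 (expStep n 3 (expStep n 4 (expStep n 5
    (expStep n 6 ⟨fixScale, 0⟩)))))
  sq (sq (sq (sq (sq (sq (sq (mkForced b.c (b.e + 1))))))))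

variable {b : FixBall} {f : ℝ}

theorem Encl.expStep (h : b.Encl f) (n : ℤ) {k : ℕ} (hk : 0 < k) :
    (expStep n k b).Encl (1 + (n / (128 * fixScale) : ℝ) * f / k) := by
  simp only [Encl, FixBall.expStep, mkForced_eq] at h ⊢
  have hk' : (0 : ℝ) < k := by exact_mod_cast hk
  have r1 := AffForm.abs_sub_ediv_le (n * b.c) (d := 140737488355328 * k) (by positivity)
  have r2 := AffForm.div_le_natDiv_add_one (n.natAbs * b.e) (d := 140737488355328 * k)
    (by positivity)
  push_cast at h r1 r2 ⊢
  have key : |(n : ℝ) * (f * 1099511627776 - b.c) / (140737488355328 * k)|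
      ≤ (n.natAbs : ℝ) * b.e / (140737488355328 * k) := by
    rw [abs_div, abs_mul, Nat.cast_natAbs, Int.cast_abs,
      abs_of_pos (by positivity : (0 : ℝ) < 140737488355328 * k)]
    gcongr
  have e1 : (1 + (n : ℝ) / (128 * 1099511627776) * f / k) * 1099511627776
      = 1099511627776 + (n : ℝ) * (f * 1099511627776 - b.c) / (140737488355328 * k)
        + (n : ℝ) * b.c / (140737488355328 * k) := by
    field_simp; ring
  rw [e1]
  rw [abs_le] at key r1 ⊢
  constructor <;> linarith [key.1, key.2, r1.1, r1.2]

theorem Encl.sq (h : b.Encl f) : b.sq.Encl (f ^ 2) := by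
  simp only [Encl, FixBall.sq, mkForced_eq] at h ⊢
  have r1 := AffForm.abs_sub_ediv_le (b.c * b.c) (d := fixScale) (by norm_num)
  have r2 := AffForm.div_le_natDiv_add_one (2 * b.c.natAbs * b.e + b.e * b.e)
    (d := 1099511627776) (by norm_num)
  push_cast at h r1 r2 ⊢
  have key : |(2 * (b.c : ℝ) * (f * 1099511627776 - b.c)
      + (f * 1099511627776 - b.c) * (f * 1099511627776 - b.c)) / 1099511627776|
      ≤ (2 * (b.c.natAbs : ℝ) * b.e + b.e * b.e) / 1099511627776 := by
    rw [abs_div, abs_of_pos (by norm_num : (0 : ℝ) < 1099511627776)]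
    gcongr
    refine (abs_add_le _ _).trans (add_le_add ?_ ?_)
    · rw [abs_mul, abs_mul, Nat.cast_natAbs, Int.cast_abs, abs_two]; gcongr
    · rw [abs_mul]; gcongr
  have e1 : f ^ 2 * 1099511627776 = (2 * (b.c : ℝ) * (f * 1099511627776 - b.c)
      + (f * 1099511627776 - b.c) * (f * 1099511627776 - b.c)) / 1099511627776
      + (b.c : ℝ) * b.c / 1099511627776 := by ring
  rw [e1]
  rw [abs_le] at key r1 ⊢
  constructor <;> linarith [key.1, key.2, r1.1, r1.2]

theorem encl_expPoint {n : ℤ} (hn : n.natAbs ≤ 8796093022208) :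
    (expPoint n).Encl (Real.exp (n / fixScale)) := by
  set x : ℝ := n / (128 * fixScale) with hx
  have hx1 : |x| ≤ 1 / 16 := by
    have : |(n : ℝ)| ≤ 8796093022208 := by
      rw [← Int.cast_abs, ← Nat.cast_natAbs]; exact_mod_cast hn
    rw [hx, abs_div]
    push_cast
    rw [abs_of_pos (by norm_num : (0 : ℝ) < 128 * 1099511627776), div_le_iff₀ (by norm_num)]
    linarith
  have base : (⟨fixScale, 0⟩ : FixBall).Encl 1 := by simp [Encl]
  have h6 := (((((base.expStep n (k := 6) (by norm_num)).expStep n (k := 5)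
    (by norm_num)).expStep n (k := 4) (by norm_num)).expStep n (k := 3)
    (by norm_num)).expStep n (k := 2) (by norm_num)).expStep n (k := 1) (by norm_num)
  rw [← hx] at h6
  have hb := Real.exp_bound (x := x) (by linarith) (n := 7) (by norm_num)
  have hpow : |x| ^ 7 ≤ (1 / 16) ^ 7 := by gcongr
  simp only [Finset.sum_range_succ, Finset.sum_range_zero, Nat.factorial] at hb
  norm_num at hb h6 hpow
  have hexp : (mkForced (expStep n 1 (expStep n 2 (expStep n 3 (expStep n 4 (expStep n 5
      (expStep n 6 ⟨fixScale, 0⟩)))))).c ((expStep n 1 (expStep n 2 (expStep n 3 (expStep n 4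
      (expStep n 5 (expStep n 6 ⟨fixScale, 0⟩)))))).e + 1)).Encl (Real.exp x) := by
    simp only [Encl, mkForced_eq] at h6 ⊢
    push_cast at h6 ⊢
    rw [abs_le] at h6 hb ⊢
    constructor <;> nlinarith [h6.1, h6.2, hb.1, hb.2]
  have h7 := hexp.sq.sq.sq.sq.sq.sq.sq
  have e2 : ((((((Real.exp x ^ 2) ^ 2) ^ 2) ^ 2) ^ 2) ^ 2) ^ 2 = Real.exp (n / fixScale) := by
    rw [← pow_mul, ← pow_mul, ← pow_mul, ← pow_mul, ← pow_mul, ← pow_mul, ← Real.exp_nat_mul]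
    congr 1
    rw [hx]
    push_cast
    field_simp
  rw [e2] at h7
  exact h7

/-- A candidate for `2 ^ 40 * log (m / 2 ^ 40)`, from the series of `artanh`. -/
def logGuess (m : ℕ) : ℤ :=
  forceNat m.log2 fun l => forceInt ((m * 1099511627776 / 2 ^ l : ℕ) : ℤ) fun k =>
  forceInt ((k - 1554944255988) * fixScale / (k + 1554944255988)) fun z =>
  forceInt (z * z / fixScale) fun s =>
  forceInt (fixScale / 11 + s * fixScale / 13 / fixScale) fun a =>
  forceInt (fixScale / 9 + s * a / fixScale) fun a =>
  forceInt (fixScale / 7 + s * a / fixScale) fun a =>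
  forceInt (fixScale / 5 + s * a / fixScale) fun a =>
  forceInt (fixScale / 3 + s * a / fixScale) fun a =>
  forceInt (fixScale + s * a / fixScale) fun a =>
  2 * (z * a / fixScale) + (2 * ((l : ℤ) - 40) + 1) * 762123384786 / 2

/-- The error of the candidate `L` for `2 ^ 40 * log (m / 2 ^ 40)`, measured by exponentiating. -/
def logErr (m : ℕ) (L : ℤ) : ℕ :=
  let b := expPoint (-L)
  2 * ((m * b.c / fixScale - fixScale).natAbs + m * b.e / 1099511627776 + 2)

theorem abs_log_sub_le {m : ℕ} {L : ℤ} (hm : 0 < m) (hL : L.natAbs ≤ 8796093022208)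
    (he : logErr m L ≤ 1099511627776) :
    |Real.log (m / fixScale) * fixScale - L| ≤ logErr m L := by
  have hb := encl_expPoint (n := -L) (by simpa using hL)
  set b := expPoint (-L) with hbdef
  have hm' : (0 : ℝ) < m := by exact_mod_cast hm
  set y : ℝ := (m : ℝ) / fixScale * Real.exp ((-L : ℤ) / fixScale) - 1 with hy
  have r1 := AffForm.abs_sub_ediv_le (m * b.c) (d := fixScale) (by norm_num)
  have r2 := AffForm.div_le_natDiv_add_one (m * b.e) (d := 1099511627776) (by norm_num)
  have hle : |y * fixScale| * 2 ≤ logErr m L := by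
    simp only [logErr, ← hbdef, Encl] at hb ⊢
    push_cast at hb r1 r2 ⊢
    have key : |(m : ℝ) * (Real.exp (-L / 1099511627776) * 1099511627776 - b.c) / 1099511627776|
        ≤ (m : ℝ) * b.e / 1099511627776 := by
      rw [abs_div, abs_mul, abs_of_pos hm', abs_of_pos (by norm_num : (0 : ℝ) < 1099511627776)]
      gcongr
    have e1 : y * 1099511627776 =
        (m : ℝ) * (Real.exp (-L / 1099511627776) * 1099511627776 - b.c) / 1099511627776
        + (m * b.c / 1099511627776 - (((m : ℤ) * b.c / fixScale : ℤ) : ℝ))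
        + ((((m : ℤ) * b.c / fixScale - fixScale : ℤ) : ℝ)) := by
      rw [hy]; push_cast; field_simp; ring
    rw [e1]
    have t3 : |((((m : ℤ) * b.c / fixScale - fixScale : ℤ) : ℝ))|
      = (((m : ℤ) * b.c / fixScale - fixScale).natAbs : ℝ) := by
      rw [Nat.cast_natAbs, Int.cast_abs]
    have t1 := abs_add_three
      ((m : ℝ) * (Real.exp (-L / 1099511627776) * 1099511627776 - b.c) / 1099511627776)
      (m * b.c / 1099511627776 - (((m : ℤ) * b.c / fixScale : ℤ) : ℝ))
      ((((m : ℤ) * b.c / fixScale - fixScale : ℤ) : ℝ))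
    linarith
  have hs : (0 : ℝ) < ((fixScale : ℤ) : ℝ) := by norm_num
  have hyb : |y| ≤ 1 / 2 := by
    have : (logErr m L : ℝ) ≤ 1099511627776 := by exact_mod_cast he
    rw [abs_mul, abs_of_pos hs] at hle
    push_cast at hle
    nlinarith
  have hlog : Real.log (m / fixScale) * fixScale - L = Real.log (1 + y) * fixScale := by
    have : 1 + y = (m : ℝ) / fixScale * Real.exp ((-L : ℤ) / fixScale) := by rw [hy]; ring
    rw [this, Real.log_mul (by positivity) (Real.exp_pos _).ne', Real.log_exp]
    push_cast
    field_simp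
    ring
  rw [hlog, abs_mul, abs_of_pos hs]
  have h1 : |Real.log (1 + y)| ≤ 2 * |y| := by
    have := Real.abs_log_sub_add_sum_range_le (x := -y) (by rw [abs_neg]; linarith) 0
    simp only [Finset.sum_range_zero, zero_add, sub_neg_eq_add, abs_neg, pow_one] at this
    refine this.trans ?_
    rw [div_le_iff₀ (by linarith)]
    nlinarith [abs_nonneg y]
  rw [abs_mul, abs_of_pos hs] at hle
  nlinarith

end FixBall

namespace AffForm

variable {a : AffForm} {t : Noise} {f : ℝ}

/-- The exponential of an affine form. -/
def exp (a : AffForm) : AffForm :=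
  forceNat a.rad fun ρ =>
  forceNat ((ρ * ρ / 2 + 2 * ρ * ρ * ρ / 9895604649984) / 2199023255552 + 2) fun h =>
  (AffForm.mk (a.ok && decide (ρ ≤ 1099511627776) && decide (a.c.natAbs ≤ 8796093022208))
    (fixScale + h) a.x a.y a.z (a.e + h)).bind fun s =>
  FixBall.rec (fun c e => s.mul ⟨true, c, 0, 0, 0, e⟩) (FixBall.expPoint a.c)

/-- The logarithm of an affine form. -/
def log (a : AffForm) : AffForm :=
  forceNat a.rad fun ρ => forceNat a.c.toNat fun m =>
  forceInt (FixBall.logGuess m) fun L => forceNat (FixBall.logErr m L) fun el =>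
  forceNat ((ρ * ρ * 1099511627776 / (2 * m * m)
    + 2 * ρ * ρ * ρ * 1099511627776 / (m * m * m)) / 2 + 2) fun h =>
  mkForced (a.ok && decide (2 * ρ ≤ m) && decide (0 < m) && decide (L.natAbs ≤ 8796093022208)
      && decide (el ≤ 1099511627776))
    (L - h) (a.x * fixScale / m) (a.y * fixScale / m) (a.z * fixScale / m)
    (a.e * 1099511627776 / m + el + h + 4)

theorem Encl.exp (h : a.Encl t f) : a.exp.Encl t (Real.exp f) := by
  simp only [AffForm.exp, forceNat_eq, bind_eq]
  set ρ := a.rad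
  set q := (ρ * ρ / 2 + 2 * ρ * ρ * ρ / 9895604649984) / 2199023255552 + 2 with hq
  by_cases hok : a.ok = true ∧ ρ ≤ 1099511627776 ∧ a.c.natAbs ≤ 8796093022208
  swap
  · intro ho
    exfalso
    simp only [AffForm.mul, mkForced_eq, Bool.and_eq_true, decide_eq_true_eq] at ho
    exact hok ⟨ho.1.1.1, ho.1.1.2, ho.1.2⟩
  obtain ⟨h1, h2, h3⟩ := hok
  have hc : (⟨true, (FixBall.expPoint a.c).c, 0, 0, 0, (FixBall.expPoint a.c).e⟩ :
      AffForm).Encl t (Real.exp (a.c / fixScale)) := by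
    intro _
    have := FixBall.encl_expPoint h3
    simpa [FixBall.Encl] using this
  have hs : (⟨a.ok && decide (ρ ≤ 1099511627776) && decide (a.c.natAbs ≤ 8796093022208),
      fixScale + q, a.x, a.y, a.z, a.e + q⟩ : AffForm).Encl t
      (Real.exp (f - a.c / fixScale)) := by
    intro _
    have hr := h.abs_sub_center_le h1
    have hl := h h1
    change |f * fixScale - a.c| ≤ ρ at hr
    have h2' : (ρ : ℝ) ≤ 1099511627776 := by exact_mod_cast h2
    set d := f - a.c / fixScale with hd
    have hdS : d * 1099511627776 = f * fixScale - a.c := by rw [hd]; push_cast; field_simp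
    rw [← hdS] at hr
    have hd1 : |d| ≤ ρ / 1099511627776 := by
      rw [abs_mul, abs_of_pos (by norm_num : (0 : ℝ) < 1099511627776)] at hr
      rw [le_div_iff₀ (by norm_num)]; exact hr
    have hd2 : |d| ≤ 1 := hd1.trans (by rw [div_le_one (by norm_num)]; exact h2')
    have hb := Real.exp_bound hd2 (n := 3) (by norm_num)
    simp only [Finset.sum_range_succ, Finset.sum_range_zero, Nat.factorial] at hb
    norm_num at hb
    have lo := Real.add_one_le_exp d
    have hi : Real.exp d ≤ 1 + d + d ^ 2 / 2 + |d| ^ 3 * (2 / 9) := by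
      linarith [(abs_le.mp hb).2]
    have q1 := AffForm.div_le_natDiv_add_one (ρ * ρ / 2 + 2 * ρ * ρ * ρ / 9895604649984)
      (d := 2199023255552) (by norm_num)
    have q2 := AffForm.div_le_natDiv_add_one (ρ * ρ) (d := 2) (by norm_num)
    have q3 := AffForm.div_le_natDiv_add_one (2 * ρ * ρ * ρ) (d := 9895604649984) (by norm_num)
    have hq' : (q : ℝ) = (((ρ * ρ / 2 + 2 * ρ * ρ * ρ / 9895604649984) / 2199023255552 : ℕ) : ℝ)
      + 2 := by rw [hq]; push_cast; ring
    have hd3 : d ^ 2 ≤ (ρ / 1099511627776 : ℝ) ^ 2 := by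
      rw [← sq_abs]; gcongr
    have hd4 : |d| ^ 3 ≤ (ρ / 1099511627776 : ℝ) ^ 3 := by gcongr
    have hquad : (d ^ 2 / 2 + |d| ^ 3 * (2 / 9)) * 1099511627776 ≤ 2 * q := by
      push_cast at q1 q2 q3 hq'
      have : (ρ / 1099511627776 : ℝ) ^ 2 / 2 + (ρ / 1099511627776 : ℝ) ^ 3 * (2 / 9)
        = ((ρ : ℝ) * ρ / 2 + 2 * ρ * ρ * ρ / 9895604649984) / 1099511627776 ^ 2 := by
        field_simp; ring
      nlinarith
    push_cast at hl ⊢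
    rw [abs_le] at hl ⊢
    constructor <;> nlinarith [hl.1, hl.2]
  have e1 : Real.exp f = Real.exp (f - a.c / fixScale) * Real.exp (a.c / fixScale) := by
    rw [← Real.exp_add]; congr 1; ring
  rw [e1]
  exact hs.mul hc

theorem Encl.pos_of_log_ok (h : a.Encl t f) (ho : a.log.ok = true) : 0 < f := by
  simp only [AffForm.log, forceNat_eq, forceInt_eq, mkForced_eq, Bool.and_eq_true,
    decide_eq_true_eq] at ho
  obtain ⟨⟨⟨⟨h1, h2⟩, h3⟩, -⟩, -⟩ := ho
  refine h.lt_of_pos ?_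
  simp only [pos, h1, Bool.true_and, decide_eq_true_eq]
  omega

set_option maxHeartbeats 1000000 in
theorem Encl.log (h : a.Encl t f) : a.log.Encl t (Real.log f) := by
  intro ho
  have hf := h.pos_of_log_ok ho
  simp only [AffForm.log, forceNat_eq, forceInt_eq, mkForced_eq, Bool.and_eq_true,
    decide_eq_true_eq] at ho ⊢
  obtain ⟨⟨⟨⟨h1, h2⟩, h3⟩, h4⟩, h5⟩ := ho
  set m := a.c.toNat with hm
  set ρ := a.rad with hρ
  set L := FixBall.logGuess m
  set el := FixBall.logErr m L
  have hL := FixBall.abs_log_sub_le h3 h4 h5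
  have hmc : (a.c : ℝ) = m := by
    have : a.c = (m : ℤ) := by omega
    exact_mod_cast congrArg (Int.cast : ℤ → ℝ) this
  have hr := h.abs_sub_center_le h1
  have hl := h h1
  rw [← hρ] at hr
  rw [hmc] at hr hl
  have hm0 : (0 : ℝ) < m := by exact_mod_cast h3
  set d := (f * fixScale - m) / m with hd
  have hdm : d * m = f * fixScale - m := by rw [hd]; field_simp
  have hd1 : |d| ≤ ρ / m := by rw [hd, abs_div, abs_of_pos hm0]; gcongr
  have h2' : (2 : ℝ) * ρ ≤ m := by exact_mod_cast h2
  have hd2 : |d| ≤ 1 / 2 := hd1.trans (by rw [div_le_iff₀ hm0]; linarith)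
  have hs : (0 : ℝ) < ((fixScale : ℤ) : ℝ) := by norm_num
  have hlogf : Real.log f = Real.log (m / fixScale) + Real.log (1 + d) := by
    have h1d : (0 : ℝ) < 1 + d := by linarith [(abs_le.mp hd2).1]
    rw [← Real.log_mul (by positivity) h1d.ne']
    congr 1
    rw [hd]; field_simp; ring
  have hb := Real.abs_log_sub_add_sum_range_le (x := -d) (by rw [abs_neg]; linarith) 2
  simp only [Finset.sum_range_succ, Finset.sum_range_zero, sub_neg_eq_add, abs_neg] at hb
  norm_num at hb
  have hb2 : |d| ^ 3 / (1 - |d|) ≤ 2 * |d| ^ 3 := by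
    rw [div_le_iff₀ (by linarith)]
    nlinarith [pow_nonneg (abs_nonneg d) 3]
  have hup : Real.log (1 + d) ≤ d := by
    have h1d : (0 : ℝ) < 1 + d := by linarith [(abs_le.mp hd2).1]
    linarith [Real.log_le_sub_one_of_pos h1d]
  have hlow : d - (d ^ 2 / 2 + 2 * |d| ^ 3) ≤ Real.log (1 + d) := by
    linarith [(abs_le.mp hb).1]
  set q := (ρ * ρ * 1099511627776 / (2 * m * m) + 2 * ρ * ρ * ρ * 1099511627776 / (m * m * m)) / 2
    + 2 with hq
  have q1 := AffForm.div_le_natDiv_add_one (ρ * ρ * 1099511627776 / (2 * m * m)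
    + 2 * ρ * ρ * ρ * 1099511627776 / (m * m * m)) (d := 2) (by norm_num)
  have q2 := AffForm.div_le_natDiv_add_one (ρ * ρ * 1099511627776) (d := 2 * m * m) (by positivity)
  have q3 := AffForm.div_le_natDiv_add_one (2 * ρ * ρ * ρ * 1099511627776) (d := m * m * m)
    (by positivity)
  have hq' : (q : ℝ) = (((ρ * ρ * 1099511627776 / (2 * m * m)
    + 2 * ρ * ρ * ρ * 1099511627776 / (m * m * m)) / 2 : ℕ) : ℝ) + 2 := by
    rw [hq]; push_cast; ring
  have hd3 : d ^ 2 ≤ (ρ / m : ℝ) ^ 2 := by rw [← sq_abs]; gcongr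
  have hd4 : |d| ^ 3 ≤ (ρ / m : ℝ) ^ 3 := by gcongr
  have hquad : (d ^ 2 / 2 + 2 * |d| ^ 3) * 1099511627776 ≤ 2 * q := by
    push_cast at q1 q2 q3 hq'
    have e3 : ((ρ / m : ℝ) ^ 2 / 2 + 2 * (ρ / m : ℝ) ^ 3) * 1099511627776
      = (ρ : ℝ) * ρ * 1099511627776 / (2 * m * m)
        + 2 * ρ * ρ * ρ * 1099511627776 / (m * m * m) := by
      field_simp
    linarith
  have rx := abs_sub_ediv_le (a.x * fixScale) (d := (m : ℤ)) (by exact_mod_cast h3)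
  have ry := abs_sub_ediv_le (a.y * fixScale) (d := (m : ℤ)) (by exact_mod_cast h3)
  have rz := abs_sub_ediv_le (a.z * fixScale) (d := (m : ℤ)) (by exact_mod_cast h3)
  have re := AffForm.div_le_natDiv_add_one (a.e * 1099511627776) (d := m) h3
  have mulabs : ∀ d t : ℝ, |d| ≤ 1 → |t| ≤ 1 → |d * t| ≤ 1 := by
    intro d t hd ht
    rw [abs_mul]; exact mul_le_one₀ hd (abs_nonneg _) ht
  have kx := mulabs _ _ rx t.abs_u_le
  have ky := mulabs _ _ ry t.abs_v_le
  have kz := mulabs _ _ rz t.abs_w_le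
  have key : |d * 1099511627776 - (a.x * t.u + a.y * t.v + a.z * t.w) * 1099511627776 / m|
      ≤ a.e * 1099511627776 / m := by
    have : d * 1099511627776 - (a.x * t.u + a.y * t.v + a.z * t.w) * 1099511627776 / m
      = (f * fixScale - (m + a.x * t.u + a.y * t.v + a.z * t.w)) * 1099511627776 / m := by
      rw [hd]; push_cast; field_simp; ring
    rw [this, abs_div, abs_mul, abs_of_pos hm0, abs_of_pos (by norm_num : (0 : ℝ) < 1099511627776)]
    gcongr
  rw [hlogf]
  push_cast at hL hl re rx ry rz kx ky kz ⊢
  have e4 : (a.x * t.u + a.y * t.v + a.z * t.w) * 1099511627776 / (m : ℝ)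
    = a.x * 1099511627776 / m * t.u + a.y * 1099511627776 / m * t.v
      + a.z * 1099511627776 / m * t.w := by ring
  rw [e4] at key
  rw [abs_le] at hL key kx ky kz ⊢
  constructor <;> linarith [hL.1, hL.2, key.1, key.2, kx.1, kx.2, ky.1, ky.2, kz.1, kz.2]

end AffForm
end

noncomputable section

open Real Set

/-- The function `φ_p(t) = (1 - (1 - t)^p) / (1 - t^p)`. -/
def phiF (p t : ℝ) : ℝ := (1 - (1 - t) ^ p) / (1 - t ^ p)

/-- The defect of the equation `φ_p(r) + φ_p(c) = 1`, cleared of denominators. -/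
def curveH (p r c : ℝ) : ℝ :=
  (1 - r ^ p) * ((1 - c) ^ p - c ^ p) - (1 - c ^ p) * (1 - (1 - r) ^ p)

/-- The logarithm of the `p`-th power of the determinant of the hexagon with parameters `r, c`. -/
def logDet (p r c : ℝ) : ℝ :=
  log (1 - r ^ p) + log (1 - c ^ p) + p * log (1 - r * c) - 2 * log (1 - r ^ p * c ^ p)

/-- One half of the expression that governs the derivative of `logDet` along the curve. -/
def slopeS (r c ρ γ : ℝ) : ℝ := (1 - ρ * γ) * (r - c * γ) + (1 - r * c) * (γ * (1 - ρ))

/-- The expression with the sign of the derivative of `logDet` along the curve, `q = p - 1`. -/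
def slopeE (q r c : ℝ) : ℝ :=
  (1 - r) ^ q * slopeS r c (r ^ q) (c ^ q) - (1 - c) ^ q * slopeS c r (c ^ q) (r ^ q)

variable {p r c t : ℝ}

theorem one_sub_rpow_pos (hp : 0 < p) (h0 : 0 ≤ t) (h1 : t < 1) : 0 < 1 - t ^ p :=
  sub_pos.2 (rpow_lt_one h0 h1 hp)

theorem rpow_eq_mul_rpow_sub_one (ht : 0 < t) (p : ℝ) : t ^ p = t * t ^ (p - 1) := by
  rw [rpow_sub_one ht.ne']; field_simp

theorem curveH_eq (hp : 0 < p) (hr0 : 0 ≤ r) (hr1 : r < 1) (hc0 : 0 ≤ c) (hc1 : c < 1) :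
    curveH p r c = (1 - r ^ p) * (1 - c ^ p) * (1 - phiF p r - phiF p c) := by
  have h1 := (one_sub_rpow_pos hp hr0 hr1).ne'
  have h2 := (one_sub_rpow_pos hp hc0 hc1).ne'
  unfold curveH phiF
  field_simp
  ring

theorem hasDerivAt_phiF (p : ℝ) (hp : 0 < p) (h0 : 0 < t) (h1 : t < 1) :
    HasDerivAt (phiF p) (p * ((1 - t) ^ (p - 1) + t ^ (p - 1) * phiF p t) / (1 - t ^ p)) t := by
  have hU := (one_sub_rpow_pos hp h0.le h1).ne'
  have d1 : HasDerivAt (fun t : ℝ => 1 - (1 - t) ^ p) (p * (1 - t) ^ (p - 1)) t := by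
    refine ((((hasDerivAt_id t).const_sub 1).rpow_const (p := p)
      (Or.inl (by simp only [id]; linarith))).const_sub 1).congr_deriv ?_
    simp only [id]; ring
  have d2 : HasDerivAt (fun t : ℝ => 1 - t ^ p) (-(p * t ^ (p - 1))) t := by
    refine (((hasDerivAt_id t).rpow_const (p := p) (Or.inl h0.ne')).const_sub 1).congr_deriv ?_
    simp only [id]; ring
  refine (d1.div d2 hU).congr_deriv ?_
  unfold phiF
  field_simp
  ring

theorem phiF_nonneg (hp : 0 < p) (h0 : 0 ≤ t) (h1 : t < 1) : 0 ≤ phiF p t :=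
  div_nonneg (sub_nonneg.2 (rpow_le_one (by linarith) (by linarith) hp.le))
    (one_sub_rpow_pos hp h0 h1).le

theorem continuousOn_phiF (hp : 0 < p) : ContinuousOn (phiF p) (Ico 0 1) := by
  unfold phiF
  refine ContinuousOn.div ?_ ?_ fun t ht => (one_sub_rpow_pos hp ht.1 ht.2).ne'
  · exact (continuous_const.sub ((continuous_const.sub continuous_id).rpow_const
      fun _ => Or.inr hp.le)).continuousOn
  · exact (continuous_const.sub (continuous_id.rpow_const fun _ => Or.inr hp.le)).continuousOn

theorem strictMonoOn_phiF (hp : 0 < p) : StrictMonoOn (phiF p) (Ico 0 1) := by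
  refine strictMonoOn_of_deriv_pos (convex_Ico 0 1) (continuousOn_phiF hp) fun t ht => ?_
  rw [interior_Ico] at ht
  rw [(hasDerivAt_phiF p hp ht.1 ht.2).deriv]
  have h1 := one_sub_rpow_pos hp ht.1.le ht.2
  have h2 : 0 < (1 - t) ^ (p - 1) := rpow_pos_of_pos (by linarith [ht.2]) _
  have h3 : 0 < t ^ (p - 1) := rpow_pos_of_pos ht.1 _
  have := phiF_nonneg hp ht.1.le ht.2
  positivity

theorem phiF_zero (hp : 0 < p) : phiF p 0 = 0 := by
  simp [phiF, zero_rpow hp.ne']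

theorem phiF_half (hp : 0 < p) : phiF p (1 / 2) = 1 := by
  have := (one_sub_rpow_pos hp (t := 1 / 2) (by norm_num) (by norm_num)).ne'
  unfold phiF
  rw [show (1 : ℝ) - 1 / 2 = 1 / 2 by norm_num]
  exact div_self this

theorem exists_phiF_eq (hp : 0 < p) {v : ℝ} (h0 : 0 ≤ v) (h1 : v ≤ 1) :
    ∃ t ∈ Icc (0 : ℝ) (1 / 2), phiF p t = v := by
  have hc : ContinuousOn (phiF p) (Icc 0 (1 / 2)) :=
    (continuousOn_phiF hp).mono fun t ht => ⟨ht.1, by linarith [ht.2]⟩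
  have := intermediate_value_Icc (by norm_num) hc
  rw [phiF_zero hp, phiF_half hp] at this
  exact this ⟨h0, h1⟩

open Classical in
/-- The inverse of `φ_p`, with values in `[0, 1/2]`. -/
def phiInv (p v : ℝ) : ℝ := if h : ∃ t ∈ Icc (0 : ℝ) (1 / 2), phiF p t = v then h.choose else 0

theorem phiInv_spec (hp : 0 < p) {v : ℝ} (h0 : 0 ≤ v) (h1 : v ≤ 1) :
    phiInv p v ∈ Icc (0 : ℝ) (1 / 2) ∧ phiF p (phiInv p v) = v := by
  have h := exists_phiF_eq hp h0 h1
  rw [phiInv, dif_pos h]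
  exact h.choose_spec

theorem strictMonoOn_phiF_half (hp : 0 < p) : StrictMonoOn (phiF p) (Icc 0 (1 / 2)) :=
  (strictMonoOn_phiF hp).mono fun t ht => ⟨ht.1, by linarith [ht.2]⟩

theorem phiF_mem (hp : 0 < p) (ht : t ∈ Icc (0 : ℝ) (1 / 2)) : phiF p t ∈ Icc (0 : ℝ) 1 := by
  have h := strictMonoOn_phiF_half hp
  refine ⟨phiF_nonneg hp ht.1 (by linarith [ht.2]), ?_⟩
  rw [← phiF_half hp]
  exact h.monotoneOn ht ⟨by norm_num, le_rfl⟩ ht.2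

theorem phiInv_phiF (hp : 0 < p) (ht : t ∈ Icc (0 : ℝ) (1 / 2)) : phiInv p (phiF p t) = t := by
  have h := phiF_mem hp ht
  have := phiInv_spec hp h.1 h.2
  exact (strictMonoOn_phiF_half hp).injOn this.1 ht this.2

theorem strictMonoOn_phiInv (hp : 0 < p) : StrictMonoOn (phiInv p) (Icc 0 1) := by
  intro a ha b hb hab
  have h1 := phiInv_spec hp ha.1 ha.2
  have h2 := phiInv_spec hp hb.1 hb.2
  rw [← (strictMonoOn_phiF_half hp).lt_iff_lt h1.1 h2.1, h1.2, h2.2]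
  exact hab

theorem continuousOn_phiInv (hp : 0 < p) : ContinuousOn (phiInv p) (Icc 0 1) := by
  have himg : image (phiInv p) (Icc 0 1) = Icc 0 (1 / 2) := by
    ext t
    constructor
    · rintro ⟨v, hv, rfl⟩
      exact (phiInv_spec hp hv.1 hv.2).1
    · intro ht
      exact ⟨phiF p t, phiF_mem hp ht, phiInv_phiF hp ht⟩
  let e := (strictMonoOn_phiInv hp).orderIso _ _
  rw [continuousOn_iff_continuous_domRestrict]
  have : OrdConnected (image (phiInv p) (Icc 0 1)) := by rw [himg]; infer_instance
  exact continuous_subtype_val.comp e.continuous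

theorem hasDerivAt_phiInv (hp : 0 < p) {v : ℝ} (h0 : 0 < v) (h1 : v < 1) :
    HasDerivAt (phiInv p) ((p * ((1 - phiInv p v) ^ (p - 1) + phiInv p v ^ (p - 1) * v)
      / (1 - phiInv p v ^ p))⁻¹) v := by
  obtain ⟨⟨ha, hb⟩, hv⟩ := phiInv_spec hp h0.le h1.le
  have hpos : 0 < phiInv p v := by
    rcases ha.eq_or_lt with h | h
    · rw [← h, phiF_zero hp] at hv; linarith
    · exact h
  have hd := hasDerivAt_phiF p hp hpos (by linarith)
  rw [hv] at hd
  have hU := one_sub_rpow_pos hp ha (by linarith : phiInv p v < 1)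
  have hC : 0 < (1 - phiInv p v) ^ (p - 1) := rpow_pos_of_pos (by linarith) _
  have hγ : 0 < phiInv p v ^ (p - 1) := rpow_pos_of_pos hpos _
  refine HasDerivAt.of_local_left_inverse
    ((continuousOn_phiInv hp).continuousAt (Icc_mem_nhds h0 h1)) hd (by positivity) ?_
  filter_upwards [Icc_mem_nhds h0 h1] with w hw
  exact (phiInv_spec hp hw.1 hw.2).2

/-- The curve `φ_p(r) + φ_p(c) = 1` as a graph over `r`. -/
def curveC (p r : ℝ) : ℝ := phiInv p (1 - phiF p r)

theorem curveC_mem (hp : 0 < p) (hr : r ∈ Icc (0 : ℝ) (1 / 2)) :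
    curveC p r ∈ Icc (0 : ℝ) (1 / 2) ∧ phiF p (curveC p r) = 1 - phiF p r := by
  have h := phiF_mem hp hr
  exact phiInv_spec hp (by linarith [h.2]) (by linarith [h.1])

theorem curveC_eq (hp : 0 < p) (hr : r ∈ Icc (0 : ℝ) (1 / 2)) (hc : c ∈ Icc (0 : ℝ) (1 / 2))
    (h : curveH p r c = 0) : curveC p r = c := by
  have hr1 : r < 1 := by linarith [hr.2]
  have hc1 : c < 1 := by linarith [hc.2]
  rw [curveH_eq hp hr.1 hr1 hc.1 hc1] at h
  have h1 := one_sub_rpow_pos hp hr.1 hr1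
  have h2 := one_sub_rpow_pos hp hc.1 hc1
  have : 1 - phiF p r - phiF p c = 0 := by
    rcases mul_eq_zero.1 h with h | h
    · exact absurd h (by positivity)
    · exact h
  have e : 1 - phiF p r = phiF p c := by linarith
  rw [curveC, e, phiInv_phiF hp hc]

theorem curveH_curveC (hp : 0 < p) (hr : r ∈ Icc (0 : ℝ) (1 / 2)) :
    curveH p r (curveC p r) = 0 := by
  have h := curveC_mem hp hr
  rw [curveH_eq hp hr.1 (by linarith [hr.2]) h.1.1 (by linarith [h.1.2]), h.2]
  ring

theorem strictAntiOn_curveC (hp : 0 < p) : StrictAntiOn (curveC p) (Icc 0 (1 / 2)) := by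
  intro a ha b hb hab
  have h1 := phiF_mem hp ha
  have h2 := phiF_mem hp hb
  exact strictMonoOn_phiInv hp ⟨by linarith [h2.2], by linarith [h2.1]⟩
    ⟨by linarith [h1.2], by linarith [h1.1]⟩ (by linarith [strictMonoOn_phiF_half hp ha hb hab])

theorem continuousOn_curveC (hp : 0 < p) : ContinuousOn (curveC p) (Icc 0 (1 / 2)) := by
  refine (continuousOn_phiInv hp).comp (continuousOn_const.sub
    ((continuousOn_phiF hp).mono fun t ht => ⟨ht.1, by linarith [ht.2]⟩)) fun t ht => ?_
  have h := phiF_mem hp ht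
  exact ⟨by linarith [h.2], by linarith [h.1]⟩

/-- The algebra behind the derivative of `logDet` along the curve. -/
theorem slope_identity (p r c ρ γ φ R C : ℝ) (hr : 1 - r ≠ 0) (hc : 1 - c ≠ 0)
    (hU : 1 - r * ρ ≠ 0) (hV : 1 - c * γ ≠ 0) (hZ : 1 - r * c ≠ 0)
    (hW : 1 - r * ρ * (c * γ) ≠ 0) (hR : (1 - r) * R = r * ρ + φ * (1 - r * ρ))
    (hC : (1 - c) * C = 1 - φ * (1 - c * γ)) (hD : C + γ * φ ≠ 0) :
    (-(p * ρ) / (1 - r * ρ) - p * c / (1 - r * c) + 2 * (p * ρ * (c * γ)) / (1 - r * ρ * (c * γ)))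
      + (-(p * γ) / (1 - c * γ) - p * r / (1 - r * c)
        + 2 * (p * γ * (r * ρ)) / (1 - r * ρ * (c * γ)))
        * -((R + ρ * (1 - φ)) * (1 - c * γ) / ((1 - r * ρ) * (C + γ * φ)))
    = p / ((1 - r * ρ) * (1 - r * c) * (C + γ * φ) * (1 - r * ρ * (c * γ)))
      * (R * slopeS r c ρ γ - C * slopeS c r γ ρ) := by
  have key : (C + γ * φ) * (-ρ * (1 - r * c) * (1 - r * ρ * (c * γ))
        - c * (1 - r * ρ) * (1 - r * ρ * (c * γ)) + 2 * ρ * (c * γ) * (1 - r * c) * (1 - r * ρ))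
      + (γ * (1 - r * c) * (1 - r * ρ * (c * γ)) + r * (1 - c * γ) * (1 - r * ρ * (c * γ))
        - 2 * γ * (r * ρ) * (1 - c * γ) * (1 - r * c)) * (R + ρ * (1 - φ))
      = R * slopeS r c ρ γ - C * slopeS c r γ ρ := by
    refine mul_left_cancel₀ (mul_ne_zero hr hc) ?_
    unfold slopeS
    linear_combination (γ * (1 - r * c) * (1 - r * ρ * (c * γ))
        + r * (1 - c * γ) * (1 - r * ρ * (c * γ)) - 2 * γ * (r * ρ) * (1 - c * γ) * (1 - r * c)
        - ((1 - ρ * γ) * (r - c * γ) + (1 - r * c) * (γ * (1 - ρ)))) * (1 - c) * hR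
      + (-ρ * (1 - r * c) * (1 - r * ρ * (c * γ))
        - c * (1 - r * ρ) * (1 - r * ρ * (c * γ)) + 2 * ρ * (c * γ) * (1 - r * c) * (1 - r * ρ)
        + ((1 - γ * ρ) * (c - r * ρ) + (1 - c * r) * (ρ * (1 - γ)))) * (1 - r) * hC
  rw [← key]
  generalize C + γ * φ = D at *
  generalize R + ρ * (1 - φ) = M
  generalize hU' : 1 - r * ρ = U at *
  generalize hV' : 1 - c * γ = V at *
  generalize hZ' : 1 - r * c = Z at *
  generalize hW' : 1 - r * ρ * (c * γ) = W at *
  field_simp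
  ring

theorem hasDerivAt_curveC (hp : 0 < p) (h0 : 0 < r) (h1 : r < 1 / 2) :
    HasDerivAt (curveC p) (-(((1 - r) ^ (p - 1) + r ^ (p - 1) * phiF p r)
      * (1 - curveC p r ^ p) / ((1 - r ^ p) * ((1 - curveC p r) ^ (p - 1)
        + curveC p r ^ (p - 1) * (1 - phiF p r))))) r := by
  have hm := strictMonoOn_phiF_half hp
  have ha := hm ⟨le_rfl, by norm_num⟩ ⟨h0.le, h1.le⟩ h0
  have hb := hm ⟨h0.le, h1.le⟩ ⟨by norm_num, le_rfl⟩ h1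
  rw [phiF_zero hp] at ha
  rw [phiF_half hp] at hb
  have d1 := hasDerivAt_phiInv hp (v := 1 - phiF p r) (by linarith) (by linarith)
  have d2 := (hasDerivAt_phiF p hp h0 (by linarith)).const_sub 1
  refine (d1.comp r d2).congr_deriv ?_
  change (p * ((1 - curveC p r) ^ (p - 1) + curveC p r ^ (p - 1) * (1 - phiF p r))
      / (1 - curveC p r ^ p))⁻¹ * _ = _
  have hU := (one_sub_rpow_pos hp h0.le (by linarith : r < 1)).ne'
  have hc := curveC_mem hp ⟨h0.le, h1.le⟩
  have hV := (one_sub_rpow_pos hp hc.1.1 (by linarith [hc.1.2] : curveC p r < 1)).ne'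
  have hC : 0 < (1 - curveC p r) ^ (p - 1) := rpow_pos_of_pos (by linarith [hc.1.2]) _
  have hg : 0 ≤ curveC p r ^ (p - 1) := rpow_nonneg hc.1.1 _
  have hD : (1 - curveC p r) ^ (p - 1) + curveC p r ^ (p - 1) * (1 - phiF p r) ≠ 0 := by
    have := mul_nonneg hg (by linarith : 0 ≤ 1 - phiF p r)
    positivity
  field_simp

theorem curveC_pos (hp : 0 < p) (h0 : 0 ≤ r) (h1 : r < 1 / 2) : 0 < curveC p r := by
  have hr : r ∈ Icc (0 : ℝ) (1 / 2) := ⟨h0, h1.le⟩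
  have h2 : (1 / 2 : ℝ) ∈ Icc (0 : ℝ) (1 / 2) := ⟨by norm_num, le_rfl⟩
  have := strictAntiOn_curveC hp hr h2 h1
  linarith [(curveC_mem hp h2).1.1]

theorem hasDerivAt_logDet_curveC (hp : 0 < p) (h0 : 0 < r) (h1 : r < 1 / 2) :
    ∃ K > 0, HasDerivAt (fun r => logDet p r (curveC p r))
      (K * slopeE (p - 1) r (curveC p r)) r := by
  have hr : r ∈ Icc (0 : ℝ) (1 / 2) := ⟨h0.le, h1.le⟩
  have hc := curveC_mem hp hr
  have hc0 := curveC_pos hp h0.le h1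
  have dc := hasDerivAt_curveC hp h0 h1
  have hcu : curveC p r ≤ 1 / 2 := hc.1.2
  have hφ := hc.2
  have hr1 : r < 1 := by linarith
  have hφr := phiF_mem hp hr
  generalize hcc : curveC p r = c at dc hc0 hcu hφ
  have hU := one_sub_rpow_pos hp h0.le hr1
  have hV := one_sub_rpow_pos hp hc0.le (by linarith : c < 1)
  have hZ : 0 < 1 - r * c := by nlinarith
  have ha : 0 < r ^ p := rpow_pos_of_pos h0 _
  have hb : 0 < c ^ p := rpow_pos_of_pos hc0 _
  have hW : 0 < 1 - r ^ p * c ^ p := by nlinarith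
  have er := rpow_eq_mul_rpow_sub_one h0 p
  have ec := rpow_eq_mul_rpow_sub_one hc0 p
  have er1 := rpow_eq_mul_rpow_sub_one (by linarith : 0 < 1 - r) p
  have ec1 := rpow_eq_mul_rpow_sub_one (by linarith : 0 < 1 - c) p
  set ρ := r ^ (p - 1) with hρ
  set γ := c ^ (p - 1) with hγ
  set R := (1 - r) ^ (p - 1) with hR
  set C := (1 - c) ^ (p - 1) with hC
  have hρ0 : 0 < ρ := rpow_pos_of_pos h0 _
  have hγ0 : 0 < γ := rpow_pos_of_pos hc0 _
  have hR0 : 0 < R := rpow_pos_of_pos (by linarith) _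
  have hC0 : 0 < C := rpow_pos_of_pos (by linarith) _
  have e1 : (1 - r) * R = r * ρ + (1 - phiF p r) * (1 - r * ρ) := by
    have : phiF p r * (1 - r ^ p) = 1 - (1 - r) ^ p := by
      unfold phiF; field_simp
    rw [er, er1] at this
    linarith
  have e2 : (1 - c) * C = 1 - (1 - phiF p r) * (1 - c * γ) := by
    have : phiF p c * (1 - c ^ p) = 1 - (1 - c) ^ p := by
      unfold phiF; field_simp
    rw [ec, ec1, hφ] at this
    linarith
  have hD : 0 < C + γ * (1 - phiF p r) := by
    have := mul_nonneg hγ0.le (by linarith [hφr.2] : 0 ≤ 1 - phiF p r)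
    linarith
  have da : HasDerivAt (fun r : ℝ => r ^ p) (p * ρ) r := hasDerivAt_rpow_const (Or.inl h0.ne')
  have key := slope_identity p r c ρ γ (1 - phiF p r) R C (by linarith) (by linarith)
    (by rw [← er]; exact hU.ne') (by rw [← ec]; exact hV.ne') hZ.ne'
    (by rw [← er, ← ec]; exact hW.ne') e1 e2 hD.ne'
  rw [sub_sub_cancel, ← er, ← ec] at key
  generalize -((R + ρ * phiF p r) * (1 - c ^ p) / ((1 - r ^ p) * (C + γ * (1 - phiF p r)))) = s
    at dc key
  have db : HasDerivAt (fun r : ℝ => curveC p r ^ p) (s * p * curveC p r ^ (p - 1)) r :=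
    dc.rpow_const (Or.inl (by rw [hcc]; exact hc0.ne'))
  refine ⟨p / ((1 - r ^ p) * (1 - r * c) * (C + γ * (1 - phiF p r)) * (1 - r ^ p * c ^ p)),
    by positivity, ?_⟩
  unfold logDet slopeE
  rw [← hρ, ← hγ, ← hR, ← hC, ← key]
  refine (((((da.const_sub 1).log (by positivity)).add ((db.const_sub 1).log ?_)).add
    ((((hasDerivAt_id r).mul dc).const_sub 1).log ?_ |>.const_mul p)).sub
    ((((da.mul db).const_sub 1).log ?_).const_mul 2)).congr_deriv ?_
  · rw [hcc]; positivity
  · simp only [id, Pi.mul_apply, hcc]; positivity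
  · simp only [Pi.mul_apply, hcc]; positivity
  · simp only [id, Pi.mul_apply, hcc, ← hγ]
    generalize hU' : 1 - r ^ p = U at *
    generalize hV' : 1 - c ^ p = V at *
    generalize hZ' : 1 - r * c = Z at *
    generalize hW' : 1 - r ^ p * c ^ p = W at *
    field_simp
    ring

theorem continuousOn_logDet_curveC (hp : 0 < p) :
    ContinuousOn (fun r => logDet p r (curveC p r)) (Icc 0 (1 / 2)) := by
  have hc := continuousOn_curveC hp
  have ha : ContinuousOn (fun r : ℝ => r ^ p) (Icc 0 (1 / 2)) :=
    (continuous_id.rpow_const fun _ => Or.inr hp.le).continuousOn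
  have hb : ContinuousOn (fun r : ℝ => curveC p r ^ p) (Icc 0 (1 / 2)) :=
    hc.rpow_const fun _ _ => Or.inr hp.le
  have hm := fun r (hr : r ∈ Icc (0 : ℝ) (1 / 2)) => (curveC_mem hp hr).1
  have hU := fun r (hr : r ∈ Icc (0 : ℝ) (1 / 2)) =>
    one_sub_rpow_pos hp hr.1 (by linarith [hr.2] : r < 1)
  have hV := fun r (hr : r ∈ Icc (0 : ℝ) (1 / 2)) =>
    one_sub_rpow_pos hp (hm r hr).1 (by linarith [(hm r hr).2] : curveC p r < 1)
  unfold logDet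
  refine (((ContinuousOn.log (continuousOn_const.sub ha) fun r hr => (hU r hr).ne').add
    (ContinuousOn.log (continuousOn_const.sub hb) fun r hr => (hV r hr).ne')).add
    (continuousOn_const.mul (ContinuousOn.log (continuousOn_const.sub (continuousOn_id.mul hc))
      fun r hr => ?_))).sub
    (continuousOn_const.mul (ContinuousOn.log (continuousOn_const.sub (ha.mul hb)) fun r hr => ?_))
  · have h1 := hm r hr
    have : r * curveC p r ≤ 1 / 2 * (1 / 2) := mul_le_mul hr.2 h1.2 h1.1 (by norm_num)
    exact (show 0 < 1 - r * curveC p r by linarith).ne'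
  · have h1 := hU r hr
    have h2 := hV r hr
    have h3 : 0 ≤ curveC p r ^ p := rpow_nonneg (hm r hr).1 _
    have h4 : 0 ≤ r ^ p := rpow_nonneg hr.1 _
    nlinarith

/-- `logDet` increases along a stretch of the curve on which `slopeE` is nonnegative. -/
theorem logDet_curveC_le (hp : 0 < p) {r₁ r₂ : ℝ} (h1 : 0 ≤ r₁) (h12 : r₁ ≤ r₂) (h2 : r₂ ≤ 1 / 2)
    (h : ∀ r, r₁ < r → r < r₂ → 0 ≤ slopeE (p - 1) r (curveC p r)) :
    logDet p r₁ (curveC p r₁) ≤ logDet p r₂ (curveC p r₂) := by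
  have hs : Icc r₁ r₂ ⊆ Icc 0 (1 / 2) := Icc_subset_Icc h1 h2
  have hm : MonotoneOn (fun r => logDet p r (curveC p r)) (Icc r₁ r₂) := by
    refine monotoneOn_of_deriv_nonneg (convex_Icc _ _)
      ((continuousOn_logDet_curveC hp).mono hs) ?_ ?_ <;> rw [interior_Icc] <;> intro r hr
    · obtain ⟨K, -, hd⟩ := hasDerivAt_logDet_curveC hp (by linarith [hr.1] : 0 < r)
        (by linarith [hr.2])
      exact hd.differentiableAt.differentiableWithinAt
    · obtain ⟨K, hK, hd⟩ := hasDerivAt_logDet_curveC hp (by linarith [hr.1] : 0 < r)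
        (by linarith [hr.2])
      rw [hd.deriv]
      exact mul_nonneg hK.le (h r hr.1 hr.2)
  exact hm ⟨le_rfl, h12⟩ ⟨h12, le_rfl⟩ h12

/-- `logDet` decreases along a stretch of the curve on which `slopeE` is nonpositive. -/
theorem le_logDet_curveC (hp : 0 < p) {r₁ r₂ : ℝ} (h1 : 0 ≤ r₁) (h12 : r₁ ≤ r₂) (h2 : r₂ ≤ 1 / 2)
    (h : ∀ r, r₁ < r → r < r₂ → slopeE (p - 1) r (curveC p r) ≤ 0) :
    logDet p r₂ (curveC p r₂) ≤ logDet p r₁ (curveC p r₁) := by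
  have hs : Icc r₁ r₂ ⊆ Icc 0 (1 / 2) := Icc_subset_Icc h1 h2
  have hm : AntitoneOn (fun r => logDet p r (curveC p r)) (Icc r₁ r₂) := by
    refine antitoneOn_of_deriv_nonpos (convex_Icc _ _)
      ((continuousOn_logDet_curveC hp).mono hs) ?_ ?_ <;> rw [interior_Icc] <;> intro r hr
    · obtain ⟨K, -, hd⟩ := hasDerivAt_logDet_curveC hp (by linarith [hr.1] : 0 < r)
        (by linarith [hr.2])
      exact hd.differentiableAt.differentiableWithinAt
    · obtain ⟨K, hK, hd⟩ := hasDerivAt_logDet_curveC hp (by linarith [hr.1] : 0 < r)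
        (by linarith [hr.2])
      rw [hd.deriv]
      exact mul_nonpos_of_nonneg_of_nonpos hK.le (h r hr.1 hr.2)
  exact hm ⟨le_rfl, h12⟩ ⟨h12, le_rfl⟩ h12

/-- The point where the curve meets the diagonal. -/
def curveTau (p : ℝ) : ℝ := phiInv p (1 / 2)

theorem curveTau_spec (hp : 0 < p) :
    curveTau p ∈ Icc (0 : ℝ) (1 / 2) ∧ phiF p (curveTau p) = 1 / 2 :=
  phiInv_spec hp (by norm_num) (by norm_num)

theorem curveC_curveTau (hp : 0 < p) : curveC p (curveTau p) = curveTau p := by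
  rw [curveC, (curveTau_spec hp).2, curveTau]
  norm_num

theorem curveC_zero (hp : 0 < p) : curveC p 0 = 1 / 2 := by
  have := phiInv_phiF hp (t := 1 / 2) ⟨by norm_num, le_rfl⟩
  rw [phiF_half hp] at this
  rw [curveC, phiF_zero hp, sub_zero, this]

theorem curveTau_pos (hp : 0 < p) : 0 < curveTau p := by
  have h := curveTau_spec hp
  rcases h.1.1.eq_or_lt with e | e
  · rw [← e, phiF_zero hp] at h; norm_num at h
  · exact e

theorem curveTau_lt_half (hp : 0 < p) : curveTau p < 1 / 2 := by
  have h := curveTau_spec hp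
  rcases h.1.2.eq_or_lt with e | e
  · rw [e, phiF_half hp] at h; norm_num at h
  · exact e

theorem lt_curveC_of_lt_curveTau (hp : 0 < p) (h0 : 0 ≤ r) (h : r < curveTau p) :
    r < curveC p r := by
  have h2 := curveTau_spec hp
  have := strictAntiOn_curveC hp ⟨h0, by linarith [h2.1.2]⟩ h2.1 h
  rw [curveC_curveTau hp] at this
  exact h.trans this

theorem le_curveTau_of_le_curveC (hp : 0 < p) (hr : r ∈ Icc (0 : ℝ) (1 / 2))
    (h : r ≤ curveC p r) : r ≤ curveTau p := by
  by_contra hlt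
  push Not at hlt
  have h2 := curveTau_spec hp
  have := strictAntiOn_curveC hp h2.1 hr hlt
  rw [curveC_curveTau hp] at this
  linarith

/-- The value of `logDet` at the end `(0, 1/2)` of the curve. -/
def logEnd (p : ℝ) : ℝ := logDet p 0 (1 / 2)

/-- The value of `logDet` on the diagonal. -/
def logDiag (p : ℝ) : ℝ := logDet p (curveTau p) (curveTau p)

theorem logEnd_le (hp : 0 < p) (hr : r ∈ Icc (0 : ℝ) (1 / 2))
    (h : ∀ s, 0 < s → s < r → 0 ≤ slopeE (p - 1) s (curveC p s)) :
    logEnd p ≤ logDet p r (curveC p r) := by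
  have := logDet_curveC_le hp le_rfl hr.1 hr.2 h
  rwa [curveC_zero hp] at this

theorem logDiag_le (hp : 0 < p) (h0 : 0 ≤ r) (hr : r ≤ curveTau p)
    (h : ∀ s, r < s → s < curveTau p → slopeE (p - 1) s (curveC p s) ≤ 0) :
    logDiag p ≤ logDet p r (curveC p r) := by
  have := le_logDet_curveC hp h0 hr (curveTau_spec hp).1.2 h
  rwa [curveC_curveTau hp] at this

end

noncomputable section

open Real Set

variable {p q r c : ℝ}

theorem slopeE_eq (q r c : ℝ) :
    slopeE q r c = (1 - c * c ^ q) * (r * (1 - r) ^ q - (1 - r) * r ^ q * (1 - c) ^ q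
        - r ^ q * c ^ q * (1 - r) ^ q)
      - (1 - r * r ^ q) * (c * (1 - c) ^ q - (1 - c) * c ^ q * (1 - r) ^ q
        - r ^ q * c ^ q * (1 - c) ^ q) := by
  unfold slopeE slopeS; ring

theorem one_sub_one_sub_rpow_le (hp : 1 ≤ p) (hr : r ≤ 1) : 1 - (1 - r) ^ p ≤ p * r := by
  have := one_add_mul_self_le_rpow_one_add (s := -r) (by linarith) hp
  rw [← sub_eq_add_neg] at this
  linarith

theorem mul_rpow_le_rpow_sub_rpow (hp : 1 ≤ p) (h0 : 0 < c) (h1 : c ≤ 1 / 2) :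
    p * c ^ (p - 1) * (1 - 2 * c) ≤ (1 - c) ^ p - c ^ p := by
  have hs : 0 ≤ (1 - 2 * c) / c := div_nonneg (by linarith) h0.le
  have h := one_add_mul_self_le_rpow_one_add (s := (1 - 2 * c) / c) (by linarith) hp
  have e : 1 + (1 - 2 * c) / c = (1 - c) / c := by field_simp; ring
  rw [e, div_rpow (by linarith) h0.le, le_div_iff₀ (rpow_pos_of_pos h0 p)] at h
  have h2 := rpow_eq_mul_rpow_sub_one h0 p
  have e2 : (1 + p * ((1 - 2 * c) / c)) * c ^ p = c ^ p + p * c ^ (p - 1) * (1 - 2 * c) := by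
    rw [h2]; field_simp
  linarith

theorem rpow_sub_rpow_le (hp0 : 0 ≤ p) (hp : p ≤ 1) (h0 : 0 < c) (h1 : c ≤ 1 / 2) :
    ((1 - c) ^ p - c ^ p) * c ≤ p * c ^ p * (1 - 2 * c) := by
  have hs : 0 ≤ (1 - 2 * c) / c := div_nonneg (by linarith) h0.le
  have h := rpow_one_add_le_one_add_mul_self (s := (1 - 2 * c) / c) (by linarith) hp0 hp
  have e : 1 + (1 - 2 * c) / c = (1 - c) / c := by field_simp; ring
  rw [e, div_rpow (by linarith) h0.le, div_le_iff₀ (rpow_pos_of_pos h0 p)] at h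
  have e2 : (1 + p * ((1 - 2 * c) / c)) * c ^ p * c = c ^ p * c + p * c ^ p * (1 - 2 * c) := by
    field_simp
  nlinarith

/-- On the curve `1 - 2 * c` is of the order of `r`. -/
theorem one_sub_two_mul_le (hp : 1 ≤ p) (hr0 : 0 ≤ r) (hr1 : r < 1) (hc0 : 0 < c) (hc1 : c ≤ 1 / 2)
    (h : curveH p r c = 0) : (1 - r ^ p) * (c ^ (p - 1) * (1 - 2 * c)) ≤ (1 - c ^ p) * r := by
  have hU := one_sub_rpow_pos (by linarith : 0 < p) hr0 hr1
  have hV := one_sub_rpow_pos (by linarith : 0 < p) hc0.le (by linarith : c < 1)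
  have h1 := mul_le_mul_of_nonneg_left (mul_rpow_le_rpow_sub_rpow hp hc0 hc1) hU.le
  have h2 := mul_le_mul_of_nonneg_left (one_sub_one_sub_rpow_le hp hr1.le) hV.le
  unfold curveH at h
  have : p * ((1 - r ^ p) * (c ^ (p - 1) * (1 - 2 * c))) ≤ p * ((1 - c ^ p) * r) := by linarith
  exact le_of_mul_le_mul_left this (by linarith)

/-- A lower bound for `slopeE` near the end `r = 0` of the curve. -/
theorem le_slopeE_of_small (hp2 : 2 ≤ p) (hp3 : p ≤ 3) (hr0 : 0 < r) (hr1 : r < 1) (hc0 : 0 < c)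
    (hc1 : c ≤ 1 / 2) (h : curveH p r c = 0) :
    r * ((1 - c * c ^ (p - 1)) * ((1 - r) ^ (p - 1) - r ^ (p - 1 - 1) * ((1 - r) * (1 - c) ^ (p - 1)
      + c ^ (p - 1) * (1 - r) ^ (p - 1)) - (1 - c) * (p - 1 - 1) * c⁻¹)
      - (1 - c) * (c ^ (p - 1) * (p - 1))) ≤ slopeE (p - 1) r c := by
  have hk := one_sub_two_mul_le (by linarith) hr0.le hr1 hc0 hc1 h
  have hb := rpow_sub_rpow_le (p := p - 1 - 1) (by linarith) (by linarith) hc0 hc1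
  have hR := one_sub_one_sub_rpow_le (p := p - 1) (by linarith) hr1.le
  have hU := one_sub_rpow_pos (by linarith : 0 < p) hr0.le hr1
  have hU1 : (1 - r ^ p) ≤ 1 := by linarith [rpow_nonneg hr0.le p]
  have hV := one_sub_rpow_pos (by linarith : 0 < p) hc0.le (by linarith : c < 1)
  rw [slopeE_eq, ← rpow_eq_mul_rpow_sub_one hc0, ← rpow_eq_mul_rpow_sub_one hr0]
  have e1 := rpow_eq_mul_rpow_sub_one hc0 (p - 1)
  have e2 := rpow_eq_mul_rpow_sub_one hr0 (p - 1)
  have e3 := rpow_eq_mul_rpow_sub_one (by linarith : 0 < 1 - c) (p - 1)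
  have g0 : 0 < c ^ (p - 1 - 1) := rpow_pos_of_pos hc0 _
  have r0 : 0 < r ^ (p - 1 - 1) := rpow_pos_of_pos hr0 _
  have C0 : 0 < (1 - c) ^ (p - 1 - 1) := rpow_pos_of_pos (by linarith) _
  rw [e1] at hk
  rw [e1, e2, e3]
  generalize c ^ (p - 1 - 1) = γ, r ^ (p - 1 - 1) = ζ, (1 - c) ^ (p - 1 - 1) = C at *
  generalize (1 - r) ^ (p - 1) = R, 1 - r ^ p = U, 1 - c ^ p = V at *
  -- the two estimates for the bracket with factor `U`
  have a1 : (1 - c) * (U * ((C - γ) * c)) ≤ (1 - c) * (p - 1 - 1) * c⁻¹ * (V * r) := by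
    have b1 : U * ((C - γ) * c) ≤ (p - 1 - 1) * (c⁻¹ * (V * r)) := by
      calc U * ((C - γ) * c) ≤ U * ((p - 1 - 1) * γ * (1 - 2 * c)) := by gcongr
        _ = (p - 1 - 1) * (c⁻¹ * (U * (c * γ * (1 - 2 * c)))) := by field_simp
        _ ≤ (p - 1 - 1) * (c⁻¹ * (V * r)) := by
          have : 0 ≤ p - 1 - 1 := by linarith
          gcongr
    have := mul_le_mul_of_nonneg_left b1 (by linarith : 0 ≤ 1 - c)
    linarith
  have a2 : (1 - c) * (U * (c * γ * (1 - R))) ≤ (1 - c) * (c * γ * ((p - 1) * r)) := by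
    have b1 : U * (c * γ * (1 - R)) ≤ 1 * (c * γ * ((p - 1) * r)) := by
      have : 0 ≤ c * γ * ((p - 1) * r) := by
        have : 0 ≤ p - 1 := by linarith
        positivity
      calc U * (c * γ * (1 - R)) ≤ U * (c * γ * ((p - 1) * r)) := by gcongr
        _ ≤ _ := by gcongr
    have := mul_le_mul_of_nonneg_left b1 (by linarith : 0 ≤ 1 - c)
    linarith
  have a3 : 0 ≤ U * (r * ζ * (c * γ) * ((1 - c) * C)) := by
    have : 0 < 1 - c := by linarith
    positivity
  nlinarith [a1, a2, a3]

end

noncomputable section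

open Real Set

namespace AffForm

instance : Add AffForm := ⟨fun a b => a.bind fun a => b.bind fun b => add a b⟩
instance : Sub AffForm := ⟨fun a b => a.bind fun a => b.bind fun b => sub a b⟩
instance : Mul AffForm := ⟨fun a b => a.bind fun a => b.bind fun b => mul a b⟩

/-- `1 - a`, evaluating the argument first. -/
def compl (a : AffForm) : AffForm := a.bind oneSub

/-- The power `a ^ q`. -/
def pow (q a : AffForm) : AffForm := (q * a.bind log).bind exp

/-- The power `a ^ q` for small `a`. -/
def powSmall (q a : AffForm) : AffForm :=
  ((q * a.bind log) * const 1 4).bind fun s => s.exp.bind fun s => (s * s).bind fun s => s * s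

/-- The common denominator `2 ^ 20` of the tabulated data. -/
abbrev gridScale : ℕ := 1048576

/-- The exact affine form with coefficients on the grid `2 ^ (-20) ℤ`. -/
def grid (c x y z : ℤ) : AffForm :=
  mkForced true (c * 1048576) (x * 1048576) (y * 1048576) (z * 1048576) 0

variable {a b : AffForm} {t : Noise} {f g : ℝ}

theorem Encl.hAdd (ha : a.Encl t f) (hb : b.Encl t g) : (a + b).Encl t (f + g) := by
  change (a.bind fun a => b.bind fun b => AffForm.add a b).Encl t _
  simp only [bind_eq]; exact ha.add hb

theorem Encl.hSub (ha : a.Encl t f) (hb : b.Encl t g) : (a - b).Encl t (f - g) := by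
  change (a.bind fun a => b.bind fun b => AffForm.sub a b).Encl t _
  simp only [bind_eq]; exact ha.sub hb

theorem Encl.hMul (ha : a.Encl t f) (hb : b.Encl t g) : (a * b).Encl t (f * g) := by
  change (a.bind fun a => b.bind fun b => AffForm.mul a b).Encl t _
  simp only [bind_eq]; exact ha.mul hb

theorem Encl.compl (ha : a.Encl t f) : a.compl.Encl t (1 - f) := by
  unfold AffForm.compl
  simp only [bind_eq]; exact ha.oneSub

theorem Encl.pow (ha : a.Encl t f) (hb : b.Encl t g) (hf : 0 < f) :
    (AffForm.pow b a).Encl t (f ^ g) := by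
  unfold AffForm.pow
  rw [rpow_def_of_pos hf, mul_comm]
  simp only [bind_eq]
  exact (hb.hMul ha.log).exp

theorem Encl.powSmall (ha : a.Encl t f) (hb : b.Encl t g) (hf : 0 < f) :
    (AffForm.powSmall b a).Encl t (f ^ g) := by
  unfold AffForm.powSmall
  have h : f ^ g = rexp (g * Real.log f * (1 / 4)) * rexp (g * Real.log f * (1 / 4))
      * (rexp (g * Real.log f * (1 / 4)) * rexp (g * Real.log f * (1 / 4))) := by
    rw [rpow_def_of_pos hf, ← Real.exp_add, ← Real.exp_add]
    congr 1; ring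
  rw [h]
  simp only [bind_eq]
  have h1 : (const 1 4).Encl t (1 / 4 : ℝ) := by
    have := encl_const (t := t) 1 (d := 4) (by norm_num)
    simpa using this
  have := ((hb.hMul ha.log).hMul h1).exp
  exact (this.hMul this).hMul (this.hMul this)

theorem encl_grid (c x y z : ℤ) :
    (grid c x y z).Encl t ((c + x * t.u + y * t.v + z * t.w) / gridScale) := by
  intro _
  simp only [grid, mkForced_eq]
  push_cast
  rw [abs_le]
  constructor <;> norm_num <;> linarith

theorem encl_const' (n : ℤ) {d : ℕ} (hd : 0 < d) {f : ℝ} (hf : f = n / d) : (const n d).Encl t f :=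
  hf ▸ encl_const n hd

/-- Enclosure of `curveH`, from enclosures of the powers with exponent `p - 1`. -/
def curveHF (r c ρ γ R C : AffForm) : AffForm :=
  (c * γ).bind fun b => (r * ρ).compl * (c.compl * C - b) - b.compl * (r.compl * R).compl

/-- Enclosure of `slopeS`; `D` and `Z` enclose `1 - ρ γ` and `1 - r c`. -/
def slopeSF (D Z r c ρ γ : AffForm) : AffForm := D * (r - c * γ) + Z * (γ * ρ.compl)

/-- Enclosure of `slopeE`, from enclosures of the powers. -/
def slopeEF (r c ρ γ R C : AffForm) : AffForm :=
  (ρ * γ).compl.bind fun D => (r * c).compl.bind fun Z =>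
    R * slopeSF D Z r c ρ γ - C * slopeSF D Z c r γ ρ

/-- Enclosure of `logDet`, from enclosures of the powers with exponent `p - 1`. -/
def logDetF (p r c ρ γ : AffForm) : AffForm :=
  (r * ρ).bind fun a => (c * γ).bind fun b =>
    (((a.compl).bind log + (b.compl).bind log) + p * (r * c).compl.bind log)
      - const 2 1 * (a * b).compl.bind log

variable {p q r c : ℝ} {fp fq fr fc fρ fγ fR fC : AffForm}

theorem Encl.curveHF (hr : fr.Encl t r) (hc : fc.Encl t c) (hρ : fρ.Encl t (r ^ (p - 1)))
    (hγ : fγ.Encl t (c ^ (p - 1))) (hR : fR.Encl t ((1 - r) ^ (p - 1)))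
    (hC : fC.Encl t ((1 - c) ^ (p - 1))) (r0 : 0 < r) (r1 : r < 1) (c0 : 0 < c) (c1 : c < 1) :
    (curveHF fr fc fρ fγ fR fC).Encl t (curveH p r c) := by
  unfold AffForm.curveHF curveH
  rw [rpow_eq_mul_rpow_sub_one r0, rpow_eq_mul_rpow_sub_one c0,
    rpow_eq_mul_rpow_sub_one (sub_pos.2 r1), rpow_eq_mul_rpow_sub_one (sub_pos.2 c1)]
  simp only [bind_eq]
  repeat' first | with_reducible assumption | with_reducible apply Encl.hMul | with_reducible apply Encl.hSub | with_reducible apply Encl.compl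

theorem Encl.slopeEF (hr : fr.Encl t r) (hc : fc.Encl t c) (hρ : fρ.Encl t (r ^ q))
    (hγ : fγ.Encl t (c ^ q)) (hR : fR.Encl t ((1 - r) ^ q)) (hC : fC.Encl t ((1 - c) ^ q)) :
    (slopeEF fr fc fρ fγ fR fC).Encl t (slopeE q r c) := by
  unfold AffForm.slopeEF slopeE slopeS slopeSF
  rw [mul_comm (c ^ q) (r ^ q), mul_comm c r]
  simp only [bind_eq]
  repeat' first | with_reducible assumption | with_reducible apply Encl.hMul | with_reducible apply Encl.hSub | with_reducible apply Encl.compl | with_reducible apply Encl.hAdd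

theorem Encl.logDetF (hp : fp.Encl t p) (hr : fr.Encl t r) (hc : fc.Encl t c)
    (hρ : fρ.Encl t (r ^ (p - 1))) (hγ : fγ.Encl t (c ^ (p - 1))) (r0 : 0 < r) (c0 : 0 < c) :
    (logDetF fp fr fc fρ fγ).Encl t (logDet p r c) := by
  unfold AffForm.logDetF logDet
  rw [rpow_eq_mul_rpow_sub_one r0, rpow_eq_mul_rpow_sub_one c0]
  simp only [bind_eq]
  have h2 : (const 2 1).Encl t 2 := encl_const' 2 one_pos (by norm_num)
  repeat' first | with_reducible assumption | with_reducible apply Encl.hMul | with_reducible apply Encl.hSub | with_reducible apply Encl.compl | with_reducible apply Encl.hAdd | with_reducible apply Encl.log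

/-- Decides that the enclosed function of `w` changes sign from plus to minus. -/
def straddles (a : AffForm) : Bool :=
  a.ok && decide (((a.c.natAbs + a.x.natAbs + a.y.natAbs + a.e : ℕ) : ℤ) < -a.z)

theorem Encl.sign_of_straddles (h : a.Encl t f) (hs : a.straddles = true) :
    (t.w = 1 → f < 0) ∧ (t.w = -1 → 0 < f) := by
  simp only [straddles, Bool.and_eq_true, decide_eq_true_eq] at hs
  have h1 := abs_le.mp (h hs.1)
  have h2 : (((a.c.natAbs + a.x.natAbs + a.y.natAbs + a.e : ℕ) : ℤ) : ℝ) < ((-a.z : ℤ) : ℝ) := by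
    exact_mod_cast hs.2
  have lin_le : ∀ (n : ℤ) (t : ℝ), |t| ≤ 1 → |(n : ℝ) * t| ≤ (n.natAbs : ℝ) := by
    intro n t ht
    rw [abs_mul, Nat.cast_natAbs, Int.cast_abs]
    exact mul_le_of_le_one_right (abs_nonneg _) ht
  have k0 := abs_le.mp (lin_le a.c 1 (by norm_num))
  have k1 := abs_le.mp (lin_le a.x t.u t.abs_u_le)
  have k2 := abs_le.mp (lin_le a.y t.v t.abs_v_le)
  simp only [Nat.cast_natAbs, Int.cast_abs] at k0 k1 k2
  push_cast at h1 h2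
  have hs : (0 : ℝ) < 1099511627776 := by norm_num
  constructor <;> intro hw <;> rw [hw] at h1
  · by_contra hf
    push Not at hf
    nlinarith [h1.1, h1.2, k0.1, k0.2, k1.1, k1.2, k2.1, k2.2]
  · by_contra hf
    push Not at hf
    nlinarith [h1.1, h1.2, k0.1, k0.2, k1.1, k1.2, k2.1, k2.2]

end AffForm

end

noncomputable section

open Real Set

namespace AffForm

/-- The interval `[0, s]`, for `s` enclosed by `a`, as an affine form without linear part. -/
def fromZero (a : AffForm) : AffForm :=
  forceNat (a.c + a.rad).toNat fun n => mkForced a.ok (n / 2 : ℕ) 0 0 0 (n / 2 + 1)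

theorem Encl.fromZero {a : AffForm} {t : Noise} {f g : ℝ} (h : a.Encl t g) (h0 : 0 ≤ f)
    (h1 : f ≤ g) : a.fromZero.Encl t f := by
  intro ho
  simp only [AffForm.fromZero, mkForced_eq, forceNat_eq] at ho ⊢
  have h2 := (abs_le.mp (h.abs_sub_center_le ho)).2
  set n := (a.c + a.rad).toNat with hn
  have h3 : ((a.c + a.rad : ℤ) : ℝ) ≤ n := by exact_mod_cast Int.self_le_toNat _
  have h4 : (n : ℝ) ≤ 2 * ((n / 2 : ℕ) : ℝ) + 1 := by exact_mod_cast (by omega : n ≤ 2 * (n / 2) + 1)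
  rw [Int.cast_natCast, Nat.cast_add]
  generalize ((n / 2 : ℕ) : ℝ) = m at *
  push_cast at h2 h3 ⊢
  rw [abs_le]
  constructor <;> linarith

end AffForm

open AffForm

/-- Tabulated data of a cell: its half width in `r`, and the coefficients of an affine form
containing the curve over the cell. -/
structure CurveCell where
  h : ℤ
  mid : ℤ
  al : ℤ
  be : ℤ
  mu : ℤ

namespace CurveCell

/-- The data describe a box inside the domain of `curveH`. -/
def inRange (corner : Bool) (rc : ℤ) (d : CurveCell) : Bool :=
  decide (0 ≤ d.h) && (corner || decide (d.h < rc)) && decide (2 * (rc + d.h) ≤ 1048576)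
    && decide (0 < d.mu) && decide (((d.al.natAbs + d.be.natAbs : ℕ) : ℤ) + d.mu < d.mid)
    && decide (d.mid + ((d.al.natAbs + d.be.natAbs : ℕ) : ℤ) + d.mu < 1048576)

/-- Runs a test on the affine forms of a cell, once the form for `c` is known to contain the
curve. -/
def check (corner : Bool) (pc hp rc : ℤ) (d : CurveCell)
    (test : AffForm → AffForm → AffForm → AffForm → AffForm → AffForm → AffForm → AffForm → Bool) :
    Bool :=
  inRange corner rc d &&
  (grid pc hp 0 0).bind fun p => (grid (pc - 1048576) hp 0 0).bind fun q =>
  (grid rc 0 d.h 0).bind fun r => (grid d.mid d.al d.be d.mu).bind fun c =>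
  (bif corner then fromZero (powSmall q (grid (rc + d.h) 0 0 0)) else powSmall q r).bind fun ρ =>
  (pow q c).bind fun γ => (pow q r.compl).bind fun R => (pow q c.compl).bind fun C =>
    (curveHF r c ρ γ R C).straddles && test p q r c ρ γ R C

end CurveCell

/-- The forms passed to a test enclose the quantities attached to the point of the curve over
`r`. -/
structure CurveEncl (t : Noise) (p r : ℝ) (fp fq fr fc fρ fγ fR fC : AffForm) : Prop where
  hp : fp.Encl t p
  hq : fq.Encl t (p - 1)
  hr : fr.Encl t r
  hc : fc.Encl t (curveC p r)
  hρ : fρ.Encl t (r ^ (p - 1))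
  hγ : fγ.Encl t (curveC p r ^ (p - 1))
  hR : fR.Encl t ((1 - r) ^ (p - 1))
  hC : fC.Encl t ((1 - curveC p r) ^ (p - 1))

theorem exists_noise_coord {c h : ℤ} {x : ℝ} (hh : |x * gridScale - c| ≤ h) :
    ∃ u : ℝ, |u| ≤ 1 ∧ x = (c + h * u) / gridScale := by
  have hG : (gridScale : ℝ) ≠ 0 := by norm_num
  have h0 : (0 : ℝ) ≤ h := (abs_nonneg _).trans hh
  rcases h0.eq_or_lt with h1 | h1
  · refine ⟨0, by norm_num, ?_⟩
    rw [← h1] at hh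
    have := abs_eq_zero.mp (le_antisymm hh (abs_nonneg _))
    field_simp
    linarith
  · refine ⟨(x * gridScale - c) / h, ?_, ?_⟩
    · rw [abs_div, abs_of_pos h1]
      exact (div_le_one h1).mpr hh
    · field_simp; ring

theorem abs_intCast_mul_le (n : ℤ) {t : ℝ} (ht : |t| ≤ 1) : |(n : ℝ) * t| ≤ (n.natAbs : ℝ) := by
  rw [abs_mul, Nat.cast_natAbs, Int.cast_abs]
  exact mul_le_of_le_one_right (abs_nonneg _) ht

/-- The sign of `curveH` locates the curve. -/
theorem curveC_lt_of_curveH_neg {p r c : ℝ} (hp : 0 < p) (hr : r ∈ Icc (0 : ℝ) (1 / 2))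
    (c0 : 0 ≤ c) (c1 : c < 1) (h : curveH p r c < 0) : curveC p r < c := by
  have hr1 : r < 1 := by linarith [hr.2]
  rw [curveH_eq hp hr.1 hr1 c0 c1] at h
  have hC := curveC_mem hp hr
  have := mul_pos (one_sub_rpow_pos hp hr.1 hr1) (one_sub_rpow_pos hp c0 c1)
  have h2 := neg_of_mul_neg_right h this.le
  rw [← (strictMonoOn_phiF hp).lt_iff_lt ⟨hC.1.1, by linarith [hC.1.2]⟩ ⟨c0, c1⟩, hC.2]
  linarith

theorem lt_curveC_of_curveH_pos {p r c : ℝ} (hp : 0 < p) (hr : r ∈ Icc (0 : ℝ) (1 / 2))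
    (c0 : 0 ≤ c) (c1 : c < 1) (h : 0 < curveH p r c) : c < curveC p r := by
  have hr1 : r < 1 := by linarith [hr.2]
  rw [curveH_eq hp hr.1 hr1 c0 c1] at h
  have hC := curveC_mem hp hr
  have := mul_pos (one_sub_rpow_pos hp hr.1 hr1) (one_sub_rpow_pos hp c0 c1)
  have h2 := pos_of_mul_pos_right h this.le
  rw [← (strictMonoOn_phiF hp).lt_iff_lt ⟨c0, c1⟩ ⟨hC.1.1, by linarith [hC.1.2]⟩, hC.2]
  linarith

namespace CurveCell

variable {test : AffForm → AffForm → AffForm → AffForm → AffForm → AffForm → AffForm → AffForm → Bool}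

theorem check_sound {corner : Bool} {pc hp rc : ℤ} {d : CurveCell}
    (h : check corner pc hp rc d test = true) {u p r : ℝ} (hu : |u| ≤ 1) (hp0 : 1 < p)
    (hpu : p = (pc + hp * u) / gridScale) (r0 : 0 < r) (hr : |r * gridScale - rc| ≤ d.h) :
    ∃ t : Noise, t.u = u ∧ ∃ fp fq fr fc fρ fγ fR fC,
      CurveEncl t p r fp fq fr fc fρ fγ fR fC ∧ test fp fq fr fc fρ fγ fR fC = true := by
  have hp1 : 0 < p := by linarith
  simp only [check, bind_eq, inRange, Bool.and_eq_true, decide_eq_true_eq, Bool.or_eq_true] at h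
  obtain ⟨⟨⟨⟨⟨⟨-, hc1⟩, hc2⟩, hc3⟩, hc4⟩, hc5⟩, hH, htest⟩ := h
  obtain ⟨v, hv, hrv⟩ := exists_noise_coord hr
  have hG : (gridScale : ℝ) = 1048576 := by norm_num
  have hr2 : r ≤ ((rc + d.h : ℤ) : ℝ) / gridScale := by
    rw [hG] at hr ⊢
    rw [le_div_iff₀ (by norm_num)]
    push_cast
    linarith [(abs_le.mp hr).2]
  have hrh : r ≤ 1 / 2 := by
    refine hr2.trans ?_
    rw [hG, div_le_iff₀ (by norm_num)]
    have : ((2 * (rc + d.h) : ℤ) : ℝ) ≤ ((1048576 : ℤ) : ℝ) := by exact_mod_cast hc2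
    push_cast at this ⊢
    linarith
  have hmem : r ∈ Icc (0 : ℝ) (1 / 2) := ⟨r0.le, hrh⟩
  have hal := abs_le.mp (abs_intCast_mul_le d.al hu)
  have hbe := abs_le.mp (abs_intCast_mul_le d.be hv)
  have hlo : ((((d.al.natAbs + d.be.natAbs : ℕ) : ℤ) + d.mu : ℤ) : ℝ) < (d.mid : ℝ) := by
    exact_mod_cast hc4
  have hhi : ((d.mid + ((d.al.natAbs + d.be.natAbs : ℕ) : ℤ) + d.mu : ℤ) : ℝ) < ((1048576 : ℤ) : ℝ) := by
    exact_mod_cast hc5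
  have hmu : (0 : ℝ) < (d.mu : ℝ) := by exact_mod_cast hc3
  simp only [Nat.cast_natAbs, Int.cast_abs] at hal hbe
  push_cast at hlo hhi
  set cw : ℝ → ℝ := fun w => (d.mid + d.al * u + d.be * v + d.mu * w) / gridScale with hcw
  have hcw0 : ∀ w, |w| ≤ 1 → 0 < cw w ∧ cw w < 1 := by
    intro w hw
    have := abs_le.mp hw
    simp only [hcw, hG]
    constructor
    · apply div_pos _ (by norm_num)
      nlinarith
    · rw [div_lt_one (by norm_num)]
      nlinarith
  have encl : ∀ t : Noise, t.u = u → t.v = v →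
      (grid pc hp 0 0).Encl t p ∧ (grid (pc - 1048576) hp 0 0).Encl t (p - 1) ∧
      (grid rc 0 d.h 0).Encl t r ∧ (grid d.mid d.al d.be d.mu).Encl t (cw t.w) ∧
      (bif corner then fromZero (powSmall (grid (pc - 1048576) hp 0 0) (grid (rc + d.h) 0 0 0))
        else powSmall (grid (pc - 1048576) hp 0 0) (grid rc 0 d.h 0)).Encl t (r ^ (p - 1)) := by
    intro t htu htv
    have e1 : (grid pc hp 0 0).Encl t p := by
      convert encl_grid pc hp 0 0 using 1; rw [hpu, htu]; push_cast; ring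
    have e2 : (grid (pc - 1048576) hp 0 0).Encl t (p - 1) := by
      convert encl_grid (pc - 1048576) hp 0 0 using 1; rw [hpu, htu]; push_cast; ring
    have e3 : (grid rc 0 d.h 0).Encl t r := by
      convert encl_grid rc 0 d.h 0 using 1; rw [hrv, htv]; push_cast; ring
    have e4 : (grid d.mid d.al d.be d.mu).Encl t (cw t.w) := by
      convert encl_grid d.mid d.al d.be d.mu using 1; rw [htu, htv]
    refine ⟨e1, e2, e3, e4, ?_⟩
    cases corner
    · exact e3.powSmall e2 r0
    · have e5 : (grid (rc + d.h) 0 0 0).Encl t (((rc + d.h : ℤ) : ℝ) / gridScale) := by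
        convert encl_grid (rc + d.h) 0 0 0 using 1; push_cast; ring
      exact (e5.powSmall e2 (r0.trans_le hr2)).fromZero (rpow_nonneg r0.le _)
        (rpow_le_rpow r0.le hr2 (by linarith))
  have sgn : ∀ t : Noise, t.u = u → t.v = v →
      (t.w = 1 → curveH p r (cw t.w) < 0) ∧ (t.w = -1 → 0 < curveH p r (cw t.w)) := by
    intro t htu htv
    obtain ⟨e1, e2, e3, e4, e5⟩ := encl t htu htv
    obtain ⟨c0, c1⟩ := hcw0 t.w t.abs_w_le
    exact (Encl.curveHF e3 e4 e5 (e4.pow e2 c0) (e3.compl.pow e2 (by linarith))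
      (e4.compl.pow e2 (by linarith)) r0 (by linarith) c0 c1).sign_of_straddles hH
  have s1 := (sgn ⟨u, v, 1, hu, hv, by norm_num⟩ rfl rfl).1 rfl
  have s2 := (sgn ⟨u, v, -1, hu, hv, by norm_num⟩ rfl rfl).2 rfl
  have b1 := curveC_lt_of_curveH_neg hp1 hmem (hcw0 1 (by norm_num)).1.le (hcw0 1 (by norm_num)).2 s1
  have b2 := lt_curveC_of_curveH_pos hp1 hmem (hcw0 (-1) (by norm_num)).1.le
    (hcw0 (-1) (by norm_num)).2 s2
  simp only [hcw, hG] at b1 b2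
  rw [lt_div_iff₀ (by norm_num)] at b1
  rw [div_lt_iff₀ (by norm_num)] at b2
  obtain ⟨w, hw, hww⟩ : ∃ w : ℝ, |w| ≤ 1 ∧ cw w = curveC p r := by
    refine ⟨(curveC p r * 1048576 - (d.mid + d.al * u + d.be * v)) / d.mu, ?_, ?_⟩
    · rw [abs_div, abs_of_pos hmu, div_le_one hmu, abs_le]
      constructor <;> linarith
    · simp only [hcw, hG]; field_simp; ring
  obtain ⟨e1, e2, e3, e4, e5⟩ := encl ⟨u, v, w, hu, hv, hw⟩ rfl rfl
  have hc := hcw0 w hw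
  have e4' : (grid d.mid d.al d.be d.mu).Encl ⟨u, v, w, hu, hv, hw⟩ (cw w) := e4
  rw [hww] at hc e4'
  exact ⟨⟨u, v, w, hu, hv, hw⟩, rfl, _, _, _, _, _, _, _, _,
    ⟨e1, e2, e3, e4', e5, e4'.pow e2 hc.1, e3.compl.pow e2 (by linarith),
      e4'.compl.pow e2 (by linarith)⟩, htest⟩

/-- Runs a test over consecutive cells starting at `r`, and passes on the right end. -/
def chain (pc hp : ℤ)
    (test : AffForm → AffForm → AffForm → AffForm → AffForm → AffForm → AffForm → AffForm → Bool) :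
    ℤ → List CurveCell → (ℤ → Bool) → Bool
  | r, [], k => k r
  | r, d :: ds, k => check false pc hp (r + d.h) d test &&
      forceInt (r + d.h + d.h) fun r => chain pc hp test r ds k

theorem chain_sound {pc hp : ℤ} {ds : List CurveCell} {k : ℤ → Bool} {Q : ℝ → Prop} {u p : ℝ}
    (hu : |u| ≤ 1) (hp0 : 1 < p) (hpu : p = (pc + hp * u) / gridScale)
    (hQ : ∀ (t : Noise) (r : ℝ) (fp fq fr fc fρ fγ fR fC), t.u = u → 0 < r → r ≤ 1 / 2 →
      CurveEncl t p r fp fq fr fc fρ fγ fR fC → test fp fq fr fc fρ fγ fR fC = true → Q r) :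
    ∀ {r : ℤ}, 0 < r → chain pc hp test r ds k = true →
      ∃ r' : ℤ, r ≤ r' ∧ k r' = true ∧ ∀ x : ℝ, (r : ℝ) < x * gridScale → x * gridScale ≤ r' → Q x := by
  induction ds with
  | nil => exact fun {r} _ h => ⟨r, le_rfl, h, fun x h1 h2 => absurd h2 (not_le.2 h1)⟩
  | cons d ds ih =>
    intro r hr h
    simp only [chain, Bool.and_eq_true, forceInt_eq] at h
    obtain ⟨h1, h2⟩ := h
    have hrange : 0 ≤ d.h ∧ 2 * (r + d.h + d.h) ≤ 1048576 := by
      have h3 := h1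
      simp only [check, Bool.and_eq_true, inRange, decide_eq_true_eq] at h3
      exact ⟨h3.1.1.1.1.1.1, h3.1.1.1.1.2⟩
    obtain ⟨r', hr', hk, hQ'⟩ := ih (by omega) h2
    refine ⟨r', by omega, hk, fun x hx1 hx2 => ?_⟩
    by_cases hx : x * gridScale ≤ ((r + d.h + d.h : ℤ) : ℝ)
    · have hr0 : (0 : ℝ) < r := by exact_mod_cast hr
      have hG : (gridScale : ℝ) = 1048576 := by norm_num
      rw [hG] at hx1 hx
      have hx0 : 0 < x := by nlinarith
      have hx3 : x ≤ 1 / 2 := by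
        have : ((2 * (r + d.h + d.h) : ℤ) : ℝ) ≤ ((1048576 : ℤ) : ℝ) := by exact_mod_cast hrange.2
        push_cast at this hx
        linarith
      obtain ⟨t, htu, fp, fq, fr, fc, fρ, fγ, fR, fC, he, ht⟩ :=
        check_sound h1 hu hp0 hpu hx0 (by
          rw [hG, abs_le]; push_cast at hx ⊢; constructor <;> linarith)
      exact hQ t x _ _ _ _ _ _ _ _ htu hx0 hx3 he ht
    · exact hQ' x (not_le.1 hx) hx2

end CurveCell

end

noncomputable section

open Real Set

/-- The derivative of `slopeE q (m - s) (m + s)` in `s`, in terms of `r = m - s`, `c = m + s` and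
the powers of `r`, `c`, `1 - r`, `1 - c` with exponent `q - 1`. -/
def slopeWAux (q r c ρ' γ' R' C' : ℝ) : ℝ :=
  q * R' * slopeS r c (r * ρ') (c * γ') + (1 - r) * R' *
    ((q * (ρ' * γ') * (c - r) * (r - c * (c * γ')) - (1 - r * ρ' * (c * γ')) *
      (1 + c * γ' + q * (c * γ'))) + (c - r) * (c * γ' * (1 - r * ρ')) +
      (1 - r * c) * (q * (γ' * (1 - r * ρ') + c * γ' * ρ')))
  + q * C' * slopeS c r (c * γ') (r * ρ') - (1 - c) * C' *
    ((q * (ρ' * γ') * (c - r) * (c - r * (r * ρ')) + (1 - r * ρ' * (c * γ')) *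
      (1 + r * ρ' + q * (r * ρ'))) + (c - r) * (r * ρ' * (1 - c * γ')) -
      (1 - r * c) * (q * (ρ' * (1 - c * γ') + r * ρ' * γ')))

/-- The derivative of `slopeE q (m - s) (m + s)` in `s`. -/
def slopeW (q r c : ℝ) : ℝ :=
  slopeWAux q r c (r ^ (q - 1)) (c ^ (q - 1)) ((1 - r) ^ (q - 1)) ((1 - c) ^ (q - 1))

theorem hasDerivAt_slopeE (q : ℝ) {m s : ℝ} (h0 : 0 < m - s) (h1 : m - s < 1) (h2 : 0 < m + s)
    (h3 : m + s < 1) :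
    HasDerivAt (fun s => slopeE q (m - s) (m + s)) (slopeW q (m - s) (m + s)) s := by
  have dr : HasDerivAt (fun s : ℝ => m - s) (-1) s := by
    simpa using (hasDerivAt_id s).const_sub m
  have dc : HasDerivAt (fun s : ℝ => m + s) 1 s := by
    simpa using (hasDerivAt_id s).const_add m
  have dρ := dr.rpow_const (p := q) (Or.inl h0.ne')
  have dγ := dc.rpow_const (p := q) (Or.inl h2.ne')
  have dR := (dr.const_sub 1).rpow_const (p := q) (Or.inl (by linarith))
  have dC := (dc.const_sub 1).rpow_const (p := q) (Or.inl (by linarith))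
  have dD := (dρ.mul dγ).const_sub 1
  have dZ := (dr.mul dc).const_sub 1
  have dS1 := (dD.mul (dr.sub (dc.mul dγ))).add (dZ.mul (dγ.mul (dρ.const_sub 1)))
  have dD' := (dγ.mul dρ).const_sub 1
  have dZ' := (dc.mul dr).const_sub 1
  have dS2 := (dD'.mul (dc.sub (dr.mul dρ))).add (dZ'.mul (dρ.mul (dγ.const_sub 1)))
  have key := (dR.mul dS1).sub (dC.mul dS2)
  refine key.congr_deriv ?_
  simp only [Pi.mul_apply, Pi.add_apply, Pi.sub_apply]
  rw [slopeW, slopeWAux, rpow_eq_mul_rpow_sub_one h0 q, rpow_eq_mul_rpow_sub_one h2 q,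
    rpow_eq_mul_rpow_sub_one (sub_pos.2 h1) q, rpow_eq_mul_rpow_sub_one (sub_pos.2 h3) q, slopeS,
    slopeS]
  generalize (m - s) ^ (q - 1) = ρ', (m + s) ^ (q - 1) = γ', (1 - (m - s)) ^ (q - 1) = R',
    (1 - (m + s)) ^ (q - 1) = C'
  ring

theorem slopeE_self (q r : ℝ) : slopeE q r r = 0 := sub_self _

/-- A function with positive derivative which vanishes at the left end is positive. -/
theorem pos_of_hasDerivAt_pos {f f' : ℝ → ℝ} {T : ℝ} (hT : 0 < T) (h0 : f 0 = 0)
    (hd : ∀ s ∈ Icc 0 T, HasDerivAt f (f' s) s) (hpos : ∀ s ∈ Icc 0 T, 0 < f' s) : 0 < f T := by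
  have : StrictMonoOn f (Icc 0 T) := by
    refine strictMonoOn_of_deriv_pos (convex_Icc _ _)
      (fun s hs => (hd s hs).continuousAt.continuousWithinAt) fun s hs => ?_
    have hs' := interior_subset hs
    rw [(hd s hs').deriv]
    exact hpos s hs'
  rw [← h0]
  exact this ⟨le_rfl, hT.le⟩ ⟨hT.le, le_rfl⟩ hT

open AffForm

/-- Enclosure of `slopeW`, from enclosures of the powers with exponent `q - 1`. -/
def AffForm.slopeWF (q r c ρ' γ' R' C' : AffForm) : AffForm :=
  (r * ρ').bind fun ρ => (c * γ').bind fun γ => (ρ * γ).compl.bind fun D =>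
  (r * c).compl.bind fun Z => (c - r).bind fun d => (q * (ρ' * γ') * d).bind fun P =>
    (q * R' * slopeSF D Z r c ρ γ + r.compl * R' *
      ((P * (r - c * γ) - D * (const 1 1 + γ + q * γ)) + d * (γ * ρ.compl)
        + Z * (q * (γ' * ρ.compl + γ * ρ')))
    + q * C' * slopeSF D Z c r γ ρ) - c.compl * C' *
      ((P * (c - r * ρ) + D * (const 1 1 + ρ + q * ρ)) + d * (ρ * γ.compl)
        - Z * (q * (ρ' * γ.compl + ρ * γ')))

theorem AffForm.Encl.slopeWF {t : Noise} {q r c ρ' γ' R' C' : ℝ}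
    {fq fr fc fρ fγ fR fC : AffForm} (hq : fq.Encl t q) (hr : fr.Encl t r) (hc : fc.Encl t c)
    (hρ : fρ.Encl t ρ') (hγ : fγ.Encl t γ') (hR : fR.Encl t R') (hC : fC.Encl t C') :
    (slopeWF fq fr fc fρ fγ fR fC).Encl t (slopeWAux q r c ρ' γ' R' C') := by
  unfold AffForm.slopeWF slopeWAux slopeS slopeSF
  rw [mul_comm (c * γ') (r * ρ'), mul_comm c r]
  simp only [bind_eq]
  have h1 : (const 1 1).Encl t 1 := encl_const' 1 one_pos (by norm_num)
  repeat' first | with_reducible assumption | with_reducible apply Encl.hMul | with_reducible apply Encl.hSub | with_reducible apply Encl.compl | with_reducible apply Encl.hAdd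

/-- Data of a cell about the diagonal: half the bound for `(c - r) / 2` and the coefficients of an
affine form for `(r + c) / 2`. -/
structure DiagCell where
  th : ℤ
  mid : ℤ
  al : ℤ
  mu : ℤ

namespace DiagCell

/-- The data describe a box inside the domain of `curveH`. -/
def inRange (d : DiagCell) : Bool :=
  decide (0 ≤ d.th) && decide (0 < d.mu) && decide (2 * d.th + (d.al.natAbs : ℤ) + d.mu < d.mid)
    && decide (d.mid + 2 * d.th + (d.al.natAbs : ℤ) + d.mu < 1048576)

/-- Runs a test on the affine forms of a diagonal cell, once these are known to contain the
curve. -/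
def check (pc hp : ℤ) (d : DiagCell)
    (test : AffForm → AffForm → AffForm → AffForm → AffForm → Bool) : Bool :=
  inRange d &&
  (grid pc hp 0 0).bind fun p => (grid (pc - 1048576) hp 0 0).bind fun q =>
  (grid (d.mid - d.th) d.al (-d.th) d.mu).bind fun r =>
  (grid (d.mid + d.th) d.al d.th d.mu).bind fun c => (grid d.mid d.al 0 d.mu).bind fun m =>
    (curveHF r c (powSmall q r) (powSmall q c) (pow q r.compl) (pow q c.compl)).straddles
      && test p q r c m

theorem check_sound {pc hp : ℤ} {d : DiagCell}
    {test : AffForm → AffForm → AffForm → AffForm → AffForm → Bool}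
    (h : check pc hp d test = true) {u p m T : ℝ} (hu : |u| ≤ 1) (hp0 : 1 < p)
    (hpu : p = (pc + hp * u) / gridScale) (hT0 : 0 ≤ T) (hT : T * gridScale ≤ 2 * d.th)
    (hr0 : 0 ≤ m - T) (hc1 : m + T < 1) (hm : phiF p (m - T) + phiF p (m + T) = 1) :
    ∃ fp fq fr fc fm, test fp fq fr fc fm = true ∧ ∀ s, 0 ≤ s → s ≤ T → 0 < m - s ∧ m + s < 1 ∧
      ∃ t : Noise, t.u = u ∧ fp.Encl t p ∧ fq.Encl t (p - 1) ∧ fr.Encl t (m - s) ∧ fc.Encl t (m + s)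
        ∧ fm.Encl t m := by
  have hp1 : 0 < p := by linarith
  simp only [check, bind_eq, inRange, Bool.and_eq_true, decide_eq_true_eq] at h
  obtain ⟨⟨⟨⟨hc1', hc2⟩, hc3⟩, hc4⟩, hH, htest⟩ := h
  have hG : (gridScale : ℝ) = 1048576 := by norm_num
  have hal := abs_le.mp (abs_intCast_mul_le d.al hu)
  have hth : (0 : ℝ) ≤ (d.th : ℝ) := by exact_mod_cast hc1'
  have hmu : (0 : ℝ) < (d.mu : ℝ) := by exact_mod_cast hc2
  have hlo : ((2 * d.th + (d.al.natAbs : ℤ) + d.mu : ℤ) : ℝ) < (d.mid : ℝ) := by exact_mod_cast hc3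
  have hhi : ((d.mid + 2 * d.th + (d.al.natAbs : ℤ) + d.mu : ℤ) : ℝ) < ((1048576 : ℤ) : ℝ) := by
    exact_mod_cast hc4
  simp only [Nat.cast_natAbs, Int.cast_abs] at hal
  push_cast at hlo hhi
  have coord : ∀ s, 0 ≤ s → s ≤ T → ∃ v : ℝ, |v| ≤ 1 ∧ s = (d.th + d.th * v) / gridScale := by
    intro s hs0 hsT
    refine exists_noise_coord ?_
    rw [hG] at hT ⊢
    rw [abs_le]
    constructor <;> nlinarith
  set mw : ℝ → ℝ := fun w => (d.mid + d.al * u + d.mu * w) / gridScale with hmw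
  have bounds : ∀ s w, 0 ≤ s → s ≤ T → |w| ≤ 1 → 0 < mw w - s ∧ mw w + s < 1 := by
    intro s w hs0 hsT hw
    have := abs_le.mp hw
    have hs : s * 1048576 ≤ 2 * d.th := by rw [hG] at hT; nlinarith
    simp only [hmw, hG]
    constructor
    · rw [sub_pos, lt_div_iff₀ (by norm_num)]
      nlinarith
    · rw [← lt_sub_iff_add_lt, div_lt_iff₀ (by norm_num)]
      nlinarith
  have encl : ∀ (t : Noise) (s : ℝ), t.u = u → s = (d.th + d.th * t.v) / gridScale →
      (grid pc hp 0 0).Encl t p ∧ (grid (pc - 1048576) hp 0 0).Encl t (p - 1) ∧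
      (grid (d.mid - d.th) d.al (-d.th) d.mu).Encl t (mw t.w - s) ∧
      (grid (d.mid + d.th) d.al d.th d.mu).Encl t (mw t.w + s) ∧
      (grid d.mid d.al 0 d.mu).Encl t (mw t.w) := by
    intro t s htu hs
    refine ⟨?_, ?_, ?_, ?_, ?_⟩
    · convert encl_grid pc hp 0 0 using 1; rw [hpu, htu]; push_cast; ring
    · convert encl_grid (pc - 1048576) hp 0 0 using 1; rw [hpu, htu]; push_cast; ring
    · convert encl_grid (d.mid - d.th) d.al (-d.th) d.mu using 1
      simp only [hmw]; rw [hs, htu]; push_cast; ring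
    · convert encl_grid (d.mid + d.th) d.al d.th d.mu using 1
      simp only [hmw]; rw [hs, htu]; push_cast; ring
    · convert encl_grid d.mid d.al 0 d.mu using 1
      simp only [hmw]; rw [htu]; push_cast; ring
  obtain ⟨v, hv, hTv⟩ := coord T hT0 le_rfl
  have sgn : ∀ t : Noise, t.u = u → t.v = v →
      (t.w = 1 → curveH p (mw t.w - T) (mw t.w + T) < 0) ∧
      (t.w = -1 → 0 < curveH p (mw t.w - T) (mw t.w + T)) := by
    intro t htu htv
    obtain ⟨e1, e2, e3, e4, e5⟩ := encl t T htu (by rw [htv]; exact hTv)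
    obtain ⟨c0, c1⟩ := bounds T t.w hT0 le_rfl t.abs_w_le
    exact (Encl.curveHF e3 e4 (e3.powSmall e2 c0) (e4.powSmall e2 (by linarith))
      (e3.compl.pow e2 (by linarith)) (e4.compl.pow e2 (by linarith)) c0 (by linarith)
      (by linarith) c1).sign_of_straddles hH
  have s1 := (sgn ⟨u, v, 1, hu, hv, by norm_num⟩ rfl rfl).1 rfl
  have s2 := (sgn ⟨u, v, -1, hu, hv, by norm_num⟩ rfl rfl).2 rfl
  obtain ⟨p1, p2⟩ := bounds T 1 hT0 le_rfl (by norm_num)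
  obtain ⟨n1, n2⟩ := bounds T (-1) hT0 le_rfl (by norm_num)
  have mono := (strictMonoOn_phiF hp1).monotoneOn
  simp only at s1 s2
  rw [curveH_eq hp1 p1.le (by linarith) (by linarith) p2] at s1
  rw [curveH_eq hp1 n1.le (by linarith) (by linarith) n2] at s2
  have s1' := neg_of_mul_neg_right s1 (mul_pos (one_sub_rpow_pos hp1 p1.le (by linarith))
    (one_sub_rpow_pos hp1 (by linarith) p2)).le
  have s2' := pos_of_mul_pos_right s2 (mul_pos (one_sub_rpow_pos hp1 n1.le (by linarith))
    (one_sub_rpow_pos hp1 (by linarith) n2)).le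
  have b1 : m < mw 1 := by
    by_contra hlt
    push Not at hlt
    have q1 := mono (a := mw 1 - T) (b := m - T) ⟨p1.le, by linarith⟩ ⟨hr0, by linarith⟩ (by linarith)
    have q2 := mono (a := mw 1 + T) (b := m + T) ⟨by linarith, p2⟩ ⟨by linarith, hc1⟩ (by linarith)
    linarith
  have b2 : mw (-1) < m := by
    by_contra hlt
    push Not at hlt
    have q1 := mono (a := m - T) (b := mw (-1) - T) ⟨hr0, by linarith⟩ ⟨n1.le, by linarith⟩
      (by linarith)
    have q2 := mono (a := m + T) (b := mw (-1) + T) ⟨by linarith, hc1⟩ ⟨by linarith, n2⟩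
      (by linarith)
    linarith
  simp only [hmw, hG] at b1 b2
  rw [lt_div_iff₀ (by norm_num)] at b1
  rw [div_lt_iff₀ (by norm_num)] at b2
  obtain ⟨w, hw, hww⟩ : ∃ w : ℝ, |w| ≤ 1 ∧ mw w = m := by
    refine ⟨(m * 1048576 - (d.mid + d.al * u)) / d.mu, ?_, ?_⟩
    · rw [abs_div, abs_of_pos hmu, div_le_one hmu, abs_le]
      constructor <;> linarith
    · simp only [hmw, hG]; field_simp; ring
  refine ⟨_, _, _, _, _, htest, fun s hs0 hsT => ?_⟩
  have hb := bounds s w hs0 hsT hw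
  obtain ⟨v', hv', hsv⟩ := coord s hs0 hsT
  have he := encl ⟨u, v', w, hu, hv', hw⟩ s rfl hsv
  simp only [hww] at hb he
  exact ⟨hb.1, hb.2, ⟨u, v', w, hu, hv', hw⟩, rfl, he⟩

end DiagCell

end

noncomputable section

open Real Set AffForm

/-- Enclosure of the lower bound for `slopeE p r c / r` near `r = 0`, valid for `r ≤ h`. -/
def AffForm.cornerF (h q r c γ R C : AffForm) : AffForm :=
  (q - const 1 1).bind fun q' => c.compl.bind fun c' =>
    (c * γ).compl * ((R - fromZero (powSmall q' h) * (r.compl * C + γ * R))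
      - c' * q' * pow (const (-1) 1) c) - c' * (γ * q)

theorem AffForm.Encl.cornerF {t : Noise} {p r c s : ℝ} {fs fq fr fc fγ fR fC : AffForm}
    (hs : fs.Encl t s) (hq : fq.Encl t (p - 1)) (hr : fr.Encl t r) (hc : fc.Encl t c)
    (hγ : fγ.Encl t (c ^ (p - 1)))
    (hR : fR.Encl t ((1 - r) ^ (p - 1))) (hC : fC.Encl t ((1 - c) ^ (p - 1)))
    (hp2 : 2 ≤ p) (hr0 : 0 < r) (hrs : r ≤ s) (hc0 : 0 < c) :
    (cornerF fs fq fr fc fγ fR fC).Encl t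
      ((1 - c * c ^ (p - 1)) * ((1 - r) ^ (p - 1) - r ^ (p - 1 - 1) * ((1 - r) * (1 - c) ^ (p - 1)
      + c ^ (p - 1) * (1 - r) ^ (p - 1)) - (1 - c) * (p - 1 - 1) * c⁻¹)
      - (1 - c) * (c ^ (p - 1) * (p - 1))) := by
  unfold AffForm.cornerF
  simp only [bind_eq]
  have h1 : (const 1 1).Encl t 1 := encl_const' 1 one_pos (by norm_num)
  have h2 : (const (-1) 1).Encl t (-1) := encl_const' (-1) one_pos (by norm_num)
  have h3 : (AffForm.pow (const (-1) 1) fc).Encl t c⁻¹ := by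
    rw [← rpow_neg_one]; exact hc.pow h2 hc0
  have h4 : (AffForm.fromZero (AffForm.powSmall (fq - const 1 1) fs)).Encl t (r ^ (p - 1 - 1)) :=
    (hs.powSmall (hq.hSub h1) (hr0.trans_le hrs)).fromZero (rpow_nonneg hr0.le _)
      (rpow_le_rpow hr0.le hrs (by linarith))
  repeat' first | with_reducible assumption | with_reducible apply Encl.hMul | with_reducible apply Encl.hSub | with_reducible apply Encl.compl | with_reducible apply Encl.hAdd

/-- Enclosure of `logEnd`. -/
def AffForm.logEndF (p : AffForm) : AffForm := (pow p (const 1 2)).compl.bind AffForm.log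

theorem logEnd_eq {p : ℝ} (hp : 0 < p) : logEnd p = Real.log (1 - (1 / 2) ^ p) := by
  simp [logEnd, logDet, zero_rpow hp.ne']

theorem AffForm.Encl.logEndF {t : Noise} {p : ℝ} {fp : AffForm} (h : fp.Encl t p) (hp : 0 < p) :
    fp.logEndF.Encl t (logEnd p) := by
  unfold AffForm.logEndF
  rw [logEnd_eq hp]
  simp only [bind_eq]
  have h2 : (const 1 2).Encl t (1 / 2) := encl_const' 1 two_pos (by norm_num)
  exact (h2.pow h (by norm_num)).compl.log

/-- Enclosure of `logDiag`, from enclosures of `p`, `p - 1` and the diagonal point. -/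
def AffForm.logDiagF (p q m : AffForm) : AffForm :=
  (powSmall q m).bind fun ρ => logDetF p m m ρ ρ

theorem AffForm.Encl.logDiagF {t : Noise} {p : ℝ} {fp fq fm : AffForm} (h : fp.Encl t p)
    (hq : fq.Encl t (p - 1)) (hm : fm.Encl t (curveTau p)) (hp : 0 < p) :
    (logDiagF fp fq fm).Encl t (logDiag p) := by
  unfold AffForm.logDiagF
  simp only [bind_eq]
  have h0 := curveTau_pos hp
  exact Encl.logDetF h hm hm (hm.powSmall hq h0) (hm.powSmall hq h0) h0 h0

namespace DiagCell

/-- A cell on the diagonal itself passes a test on `p`, `p - 1` and the diagonal point. -/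
theorem check_sound_tau {pc hp : ℤ} {d : DiagCell} {test : AffForm → AffForm → AffForm → Bool}
    (h : check pc hp d (fun p q _ _ m => test p q m) = true) {u p : ℝ} (hu : |u| ≤ 1) (hp0 : 1 < p)
    (hpu : p = (pc + hp * u) / gridScale) :
    ∃ t : Noise, t.u = u ∧ ∃ fp fq fm : AffForm, fp.Encl t p ∧ fq.Encl t (p - 1) ∧
      fm.Encl t (curveTau p) ∧ test fp fq fm = true := by
  have hp1 : 0 < p := by linarith
  have hτ := curveTau_spec hp1
  have hth : (0 : ℝ) ≤ (d.th : ℝ) := by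
    have h2 := h
    simp only [check, inRange, Bool.and_eq_true, decide_eq_true_eq] at h2
    exact_mod_cast h2.1.1.1.1
  obtain ⟨fp, fq, fr, fc, fm, ht, he⟩ := check_sound h hu hp0 hpu (m := curveTau p) (T := 0) le_rfl
    (by linarith) (by linarith [hτ.1.1]) (by linarith [hτ.1.2]) (by
      rw [sub_zero, add_zero, hτ.2]; norm_num)
  obtain ⟨-, -, t, htu, e1, e2, -, -, e5⟩ := he 0 le_rfl le_rfl
  exact ⟨t, htu, fp, fq, fm, e1, e2, e5, ht⟩

/-- Decides that `slopeW` is negative on the cell. -/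
def testW (_ q r c _ : AffForm) : Bool :=
  (q - const 1 1).bind fun q' =>
    (slopeWF q r c (powSmall q' r) (pow q' c) (pow q' r.compl) (pow q' c.compl)).neg

theorem slopeE_nonpos_of_check {pc hp : ℤ} {d : DiagCell} (h : check pc hp d testW = true)
    {u p r : ℝ} (hu : |u| ≤ 1) (hp0 : 1 < p) (hpu : p = (pc + hp * u) / gridScale) (hr0 : 0 < r)
    (hr : r < curveTau p) (hT : (curveC p r - r) * gridScale ≤ 4 * d.th) :
    slopeE (p - 1) r (curveC p r) ≤ 0 := by
  have hp1 : 0 < p := by linarith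
  have hτ := curveTau_spec hp1
  have hC := curveC_mem hp1 (r := r) ⟨hr0.le, by linarith [hτ.1.2]⟩
  have hlt := lt_curveC_of_lt_curveTau hp1 hr0.le hr
  set c := curveC p r
  have e1 : (r + c) / 2 - (c - r) / 2 = r := by ring
  have e2 : (r + c) / 2 + (c - r) / 2 = c := by ring
  obtain ⟨fp, fq, fr, fc, fm, ht, he⟩ := check_sound h hu hp0 hpu (m := (r + c) / 2)
    (T := (c - r) / 2) (by linarith)
    (by
      have hG : (gridScale : ℝ) = 1048576 := by norm_num
      rw [hG] at hT ⊢; linarith) (by rw [e1]; exact hr0.le)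
    (by rw [e2]; linarith [hC.1.2]) (by rw [e1, e2, hC.2]; ring)
  have key := pos_of_hasDerivAt_pos (f := fun s => -slopeE (p - 1) ((r + c) / 2 - s) ((r + c) / 2 + s))
    (f' := fun s => -slopeW (p - 1) ((r + c) / 2 - s) ((r + c) / 2 + s)) (T := (c - r) / 2)
    (by linarith) (by simp [slopeE_self])
    (fun s hs => by
      obtain ⟨h1, h2, -⟩ := he s hs.1 hs.2
      exact (hasDerivAt_slopeE (p - 1) h1 (by linarith [hs.1]) (by linarith [hs.1]) h2).neg)
    (fun s hs => by
      obtain ⟨h1, h2, t, -, -, k2, k3, k4, -⟩ := he s hs.1 hs.2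
      simp only [testW, bind_eq] at ht
      have c1 : (const 1 1).Encl t 1 := encl_const' 1 one_pos (by norm_num)
      have k5 := k2.hSub c1
      have := (Encl.slopeWF k2 k3 k4 (k3.powSmall k5 h1) (k4.pow k5 (by linarith [hs.1]))
        (k3.compl.pow k5 (by linarith [hs.1])) (k4.compl.pow k5 (by linarith))).lt_of_neg ht
      exact neg_pos.2 this)
  simp only [e1, e2] at key
  linarith

end DiagCell

/-- Decides that the point over `r` on the curve lies below `c`. -/
def curveBelow (pc hp r c : ℤ) : Bool :=
  decide (0 < r) && decide (2 * r ≤ 1048576) && decide (r ≤ c) && decide (c < 1048576) &&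
  (grid (pc - 1048576) hp 0 0).bind fun q => (grid r 0 0 0).bind fun r => (grid c 0 0 0).bind fun c =>
    (curveHF r c (powSmall q r) (pow q c) (pow q r.compl) (pow q c.compl)).neg

theorem curveBelow_sound {pc hp r c : ℤ} (h : curveBelow pc hp r c = true) {u p : ℝ}
    (hu : |u| ≤ 1) (hp0 : 1 < p) (hpu : p = (pc + hp * u) / gridScale) :
    0 < (r : ℝ) / gridScale ∧ (r : ℝ) / gridScale ≤ 1 / 2 ∧
      curveC p (r / gridScale) < c / gridScale := by
  simp only [curveBelow, bind_eq, Bool.and_eq_true, decide_eq_true_eq] at h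
  obtain ⟨⟨⟨⟨h1, h2⟩, h3⟩, h4⟩, h5⟩ := h
  have g1 : (0 : ℝ) < r := by exact_mod_cast h1
  have g2 : ((2 * r : ℤ) : ℝ) ≤ ((1048576 : ℤ) : ℝ) := by exact_mod_cast h2
  have g3 : (r : ℝ) ≤ c := by exact_mod_cast h3
  have g4 : (c : ℝ) < ((1048576 : ℤ) : ℝ) := by exact_mod_cast h4
  push_cast at g2 g4
  have hG : (gridScale : ℝ) = 1048576 := by norm_num
  have k1 : 0 < (r : ℝ) / gridScale := by rw [hG]; positivity
  have k2 : (r : ℝ) / gridScale ≤ 1 / 2 := by rw [hG, div_le_iff₀ (by norm_num)]; linarith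
  have k3 : 0 < (c : ℝ) / gridScale := by rw [hG]; apply div_pos <;> linarith
  have k4 : (c : ℝ) / gridScale < 1 := by rw [hG, div_lt_one (by norm_num)]; exact g4
  refine ⟨k1, k2, ?_⟩
  refine curveC_lt_of_curveH_neg (by linarith) ⟨k1.le, k2⟩ k3.le k4 ?_
  let t : Noise := ⟨u, 0, 0, hu, by norm_num, by norm_num⟩
  have e2 : (grid (pc - 1048576) hp 0 0).Encl t (p - 1) := by
    convert encl_grid (pc - 1048576) hp 0 0 using 1; rw [hpu]; simp only [t]; push_cast; ring
  have e3 : (grid r 0 0 0).Encl t ((r : ℝ) / gridScale) := by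
    convert encl_grid r 0 0 0 using 1; push_cast; ring
  have e4 : (grid c 0 0 0).Encl t ((c : ℝ) / gridScale) := by
    convert encl_grid c 0 0 0 using 1; push_cast; ring
  exact (Encl.curveHF e3 e4 (e3.powSmall e2 k1) (e4.pow e2 k3) (e3.compl.pow e2 (by linarith))
      (e4.compl.pow e2 (by linarith)) k1 (by linarith) k3 k4).lt_of_neg h5

/-- Tabulated data for the values `p` in an interval of half width `hp`: an affine function
`l0 + l1 u` above `logEnd` or `logDiag`, a cell at the end `r = 0`, cells on which `logDet`
increases, cells on which it is larger than the affine function, cells on which it decreases, and a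
cell about the diagonal. -/
structure CurveSlab where
  hp : ℤ
  l0 : ℤ
  l1 : ℤ
  tau : DiagCell
  useDiag : Bool
  increasing : Bool
  corner : CurveCell
  incr : List CurveCell
  large : List CurveCell
  decr : List CurveCell
  diag : DiagCell

namespace CurveSlab

/-- Decides that `slopeE` is positive. -/
def testIncr (_ _ r c ρ γ R C : AffForm) : Bool := (slopeEF r c ρ γ R C).pos

/-- Decides that `slopeE` is negative. -/
def testDecr (_ _ r c ρ γ R C : AffForm) : Bool := (slopeEF r c ρ γ R C).neg

/-- Decides that `logDet` is larger than `l0 + l1 u`. -/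
def testLarge (l0 l1 : ℤ) (p _ r c ρ γ _ _ : AffForm) : Bool :=
  (logDetF p r c ρ γ - grid l0 l1 0 0).pos

/-- Decides that `slopeE` is positive for `0 < r ≤ h`. -/
def testCorner (h : ℤ) (_ q r c _ γ R C : AffForm) : Bool :=
  (cornerF (grid h 0 0 0) q r c γ R C).pos

/-- Decides that `l0 + l1 u` is larger than `logEnd` or `logDiag`. -/
def testLevel (l0 l1 : ℤ) (useDiag : Bool) (p q m : AffForm) : Bool :=
  bif useDiag then (grid l0 l1 0 0 - logDiagF p q m).pos else (grid l0 l1 0 0 - logEndF p).pos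

/-- Verifies the cells of a slab with centre `pc` to the right of `r`. -/
def checkFrom (pc : ℤ) (s : CurveSlab) (r : ℤ) : Bool :=
  CurveCell.chain pc s.hp (testLarge s.l0 s.l1) r s.large fun r =>
  CurveCell.chain pc s.hp testDecr r s.decr fun r =>
    curveBelow pc s.hp r (r + 4 * s.diag.th) &&
      (decide (s.diag.th = 0) || s.diag.check pc s.hp DiagCell.testW)

/-- Verifies the data of a slab with centre `pc`. -/
def check (pc : ℤ) (s : CurveSlab) : Bool :=
  s.tau.check pc s.hp (fun p q _ _ m => testLevel s.l0 s.l1 s.useDiag p q m) &&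
  decide (0 < s.corner.h) && decide (0 ≤ s.hp) &&
  bif s.increasing then decide (pc + s.hp ≤ 3145728) && decide (2097152 ≤ pc - s.hp) &&
      s.corner.check true pc s.hp s.corner.h (testCorner (s.corner.h + s.corner.h)) &&
      CurveCell.chain pc s.hp testIncr (s.corner.h + s.corner.h) s.incr (checkFrom pc s)
    else s.corner.check true pc s.hp s.corner.h (testLarge s.l0 s.l1) &&
      checkFrom pc s (s.corner.h + s.corner.h)

end CurveSlab

end

noncomputable section

open Real Set AffForm

namespace CurveSlab

theorem testLevel_sound {l0 l1 : ℤ} {useDiag : Bool} {fp fq fm : AffForm} {t : Noise} {p : ℝ}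
    (h : testLevel l0 l1 useDiag fp fq fm = true) (hp : 0 < p) (h1 : fp.Encl t p)
    (h2 : fq.Encl t (p - 1)) (h3 : fm.Encl t (curveTau p)) :
    logEnd p < (l0 + l1 * t.u) / gridScale ∨ logDiag p < (l0 + l1 * t.u) / gridScale := by
  have e : (grid l0 l1 0 0).Encl t ((l0 + l1 * t.u) / gridScale) := by
    convert encl_grid l0 l1 0 0 using 1; push_cast; ring
  cases useDiag
  · left
    have := (e.hSub (h1.logEndF hp)).lt_of_pos h
    linarith
  · right
    have := (e.hSub (Encl.logDiagF h1 h2 h3 hp)).lt_of_pos h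
    linarith

variable {t : Noise} {p r : ℝ} {fp fq fr fc fρ fγ fR fC : AffForm}

theorem testLarge_sound {l0 l1 : ℤ} (hp : 0 < p) (hr0 : 0 < r) (hr : r < 1 / 2)
    (he : CurveEncl t p r fp fq fr fc fρ fγ fR fC)
    (h : testLarge l0 l1 fp fq fr fc fρ fγ fR fC = true) :
    (l0 + l1 * t.u) / gridScale < logDet p r (curveC p r) := by
  have e : (grid l0 l1 0 0).Encl t ((l0 + l1 * t.u) / gridScale) := by
    convert encl_grid l0 l1 0 0 using 1; push_cast; ring
  have := ((Encl.logDetF he.hp he.hr he.hc he.hρ he.hγ hr0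
    (curveC_pos hp hr0.le hr)).hSub e).lt_of_pos h
  linarith

theorem testCorner_sound {h : ℤ} (hp2 : 2 ≤ p) (hp3 : p ≤ 3) (hr0 : 0 < r) (hr : r < 1 / 2)
    (hrh : r ≤ h / gridScale) (he : CurveEncl t p r fp fq fr fc fρ fγ fR fC)
    (ht : testCorner h fp fq fr fc fρ fγ fR fC = true) :
    0 ≤ slopeE (p - 1) r (curveC p r) := by
  have hp : 0 < p := by linarith
  have e : (grid h 0 0 0).Encl t (h / gridScale) := by
    convert encl_grid h 0 0 0 using 1; push_cast; ring
  have hc := curveC_pos hp hr0.le hr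
  have hm : r ∈ Icc (0 : ℝ) (1 / 2) := ⟨hr0.le, hr.le⟩
  have h1 := (Encl.cornerF e he.hq he.hr he.hc he.hγ he.hR he.hC hp2 hr0 hrh hc).lt_of_pos ht
  exact (mul_pos hr0 h1).le.trans (le_slopeE_of_small hp2 hp3 hr0 (by linarith) hc
    (curveC_mem hp hm).1.2 (curveH_curveC hp hm))

/-- On a verified slab the smaller of the two end values is the minimum along the curve. -/
theorem check_sound {pc : ℤ} {s : CurveSlab} (h : s.check pc = true) {u : ℝ} (hu : |u| ≤ 1)
    (hp0 : 1 < p) (hpu : p = (pc + s.hp * u) / gridScale) (hr0 : 0 ≤ r) (hr : r ≤ curveTau p) :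
    logEnd p ≤ logDet p r (curveC p r) ∨ logDiag p ≤ logDet p r (curveC p r) := by
  have hp : 0 < p := by linarith
  have hG : (gridScale : ℝ) = 1048576 := by norm_num
  have hτ := curveTau_lt_half hp
  simp only [check, Bool.and_eq_true, decide_eq_true_eq] at h
  obtain ⟨⟨⟨htau, hh⟩, hhp⟩, hcorner⟩ := h
  obtain ⟨t, rfl, fp, fq, fm, e1, e2, e3, htest⟩ := DiagCell.check_sound_tau htau hu hp0 hpu
  have hlevel := testLevel_sound htest hp e1 e2 e3
  set L : ℝ := (s.l0 + s.l1 * t.u) / gridScale with hL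
  have goalOf : L < logDet p r (curveC p r) →
      logEnd p ≤ logDet p r (curveC p r) ∨ logDiag p ≤ logDet p r (curveC p r) := fun hl =>
    hlevel.imp (fun h => (h.trans hl).le) fun h => (h.trans hl).le
  rcases hr0.eq_or_lt with rfl | hr0
  · left; rw [curveC_zero hp]; exact le_rfl
  have cornerMem : ∀ x : ℝ, 0 < x → x * gridScale ≤ ((s.corner.h + s.corner.h : ℤ) : ℝ) →
      |x * gridScale - (s.corner.h : ℤ)| ≤ (s.corner.h : ℝ) := by
    intro x hx0 hx
    rw [hG] at hx ⊢
    push_cast at hx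
    rw [abs_le]; constructor <;> linarith
  obtain ⟨r1, hr1, hchain, hfirst⟩ : ∃ r1 : ℤ, s.corner.h + s.corner.h ≤ r1 ∧
      checkFrom pc s r1 = true ∧ (r * gridScale ≤ r1 →
      logEnd p ≤ logDet p r (curveC p r) ∨ logDiag p ≤ logDet p r (curveC p r)) := by
    rw [Bool.cond_eq_ite] at hcorner
    split_ifs at hcorner with hi
    · simp only [Bool.and_eq_true, decide_eq_true_eq] at hcorner
      obtain ⟨⟨⟨hc1, hc2⟩, hc3⟩, hchain⟩ := hcorner
      obtain ⟨r1, hr1, hchain, hincr⟩ := CurveCell.chain_sound hu hp0 hpu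
        (Q := fun r => r < 1 / 2 → 0 ≤ slopeE (p - 1) r (curveC p r))
        (fun t r fp fq fr fc fρ fγ fR fC _ _ _ he ht _ =>
          ((Encl.slopeEF he.hr he.hc he.hρ he.hγ he.hR he.hC).lt_of_pos ht).le) (by omega) hchain
      refine ⟨r1, hr1, hchain, fun hA => Or.inl ?_⟩
      have hu'' := abs_le.mp hu
      have g1 : (pc : ℝ) + s.hp ≤ 3145728 := by exact_mod_cast hc1
      have g2 : (2097152 : ℝ) ≤ pc - s.hp := by exact_mod_cast hc2
      have g3 : (0 : ℝ) ≤ s.hp := by exact_mod_cast hhp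
      have hp2 : 2 ≤ p := by rw [hpu, hG, le_div_iff₀ (by norm_num)]; nlinarith
      have hp3 : p ≤ 3 := by rw [hpu, hG, div_le_iff₀ (by norm_num)]; nlinarith
      refine logEnd_le hp ⟨hr0.le, by linarith⟩ fun x hx0 hxr => ?_
      by_cases hx : x * gridScale ≤ ((s.corner.h + s.corner.h : ℤ) : ℝ)
      · obtain ⟨t', -, gp, gq, gr, gc, gρ, gγ, gR, gC, he, ht⟩ :=
          CurveCell.check_sound hc3 hu hp0 hpu hx0 (cornerMem x hx0 hx)
        refine testCorner_sound hp2 hp3 hx0 (by linarith) ?_ he ht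
        rw [hG] at hx ⊢
        rw [le_div_iff₀ (by norm_num)]
        exact hx
      · refine hincr x (not_le.1 hx) ?_ (by linarith)
        rw [hG] at hA ⊢
        linarith
    · simp only [Bool.and_eq_true] at hcorner
      refine ⟨_, le_rfl, hcorner.2, fun hA => ?_⟩
      obtain ⟨t', htu, gp, gq, gr, gc, gρ, gγ, gR, gC, he, ht⟩ :=
        CurveCell.check_sound hcorner.1 hu hp0 hpu hr0 (cornerMem r hr0 hA)
      refine goalOf ?_
      rw [hL, ← htu]
      exact testLarge_sound hp hr0 (by linarith) he ht
  simp only [checkFrom] at hchain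
  obtain ⟨r2, hr2, hchain, hlarge⟩ := CurveCell.chain_sound hu hp0 hpu
    (Q := fun r => r < 1 / 2 → L < logDet p r (curveC p r))
    (fun t' r fp fq fr fc fρ fγ fR fC htu h0 _ he ht hr' => by
      rw [hL, ← htu]
      exact testLarge_sound hp h0 hr' he ht) (by omega) hchain
  obtain ⟨r3, hr3, hlast, hdecr⟩ := CurveCell.chain_sound hu hp0 hpu
    (Q := fun r => r < 1 / 2 → slopeE (p - 1) r (curveC p r) ≤ 0)
    (fun t r fp fq fr fc fρ fγ fR fC _ _ _ he ht _ =>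
      ((Encl.slopeEF he.hr he.hc he.hρ he.hγ he.hR he.hC).lt_of_neg ht).le) (by omega) hchain
  by_cases hA : r * gridScale ≤ r1
  · exact hfirst hA
  by_cases hB : r * gridScale ≤ r2
  · exact goalOf (hlarge r (not_le.1 hA) hB (by linarith))
  right
  simp only [Bool.and_eq_true, Bool.or_eq_true, decide_eq_true_eq] at hlast
  obtain ⟨hb, hd⟩ := hlast
  obtain ⟨b1, b2, b3⟩ := curveBelow_sound hb hu hp0 hpu
  refine logDiag_le hp hr0.le hr fun x hx1 hx2 => ?_
  have hx0 : 0 < x := hr0.trans hx1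
  by_cases hC : x * gridScale ≤ r3
  · refine hdecr x ?_ hC (by linarith)
    rw [hG] at hB ⊢
    linarith
  · have hlt : (r3 : ℝ) / gridScale < x := by
      rw [hG] at hC ⊢
      rw [div_lt_iff₀ (by norm_num)]
      exact not_le.1 hC
    rcases hd with hd | hd
    · have := lt_curveC_of_lt_curveTau hp b1.le (hlt.trans hx2)
      rw [hd, mul_zero, add_zero] at b3
      linarith
    · refine DiagCell.slopeE_nonpos_of_check hd hu hp0 hpu hx0 hx2 ?_
      have := strictAntiOn_curveC hp ⟨b1.le, b2⟩ ⟨hx0.le, by linarith⟩ hlt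
      rw [hG] at b3 hlt this ⊢
      rw [lt_div_iff₀ (by norm_num)] at b3
      rw [div_lt_iff₀ (by norm_num)] at hlt
      push_cast at b3
      linarith

/-- Verifies consecutive slabs covering `[a, b]`. -/
def checkAll : ℤ → List CurveSlab → ℤ → Bool
  | a, [], b => decide (b ≤ a)
  | a, s :: l, b => check (a + s.hp) s && forceInt (a + s.hp + s.hp) fun a => checkAll a l b

theorem checkAll_sound {l : List CurveSlab} {b : ℤ} (hp0 : 1 < p) (hr0 : 0 ≤ r)
    (hr : r ≤ curveTau p) : ∀ {a : ℤ}, checkAll a l b = true → a ≤ p * gridScale →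
    p * gridScale < b → logEnd p ≤ logDet p r (curveC p r) ∨ logDiag p ≤ logDet p r (curveC p r) := by
  induction l with
  | nil =>
    intro a h h1 h2
    simp only [checkAll, decide_eq_true_eq] at h
    have : (b : ℝ) ≤ a := by exact_mod_cast h
    exact absurd (h1.trans_lt h2) (not_lt.2 this)
  | cons s l ih =>
    intro a h h1 h2
    simp only [checkAll, Bool.and_eq_true, forceInt_eq] at h
    by_cases hx : p * gridScale ≤ ((a + s.hp + s.hp : ℤ) : ℝ)
    · obtain ⟨u, hu, hpu⟩ := exists_noise_coord (c := a + s.hp) (h := s.hp) (x := p) (by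
        have hG : (gridScale : ℝ) = 1048576 := by norm_num
        rw [hG] at hx h1 ⊢
        push_cast at hx ⊢
        rw [abs_le]; constructor <;> linarith)
      exact check_sound h.1 hu hp0 hpu hr0 hr
    · exact ih h.2 (not_le.1 hx).le h2

end CurveSlab

end

section

open Real Set AffForm

set_option maxRecDepth 100000 in
/-- Slabs covering the exponents from `5 / 2` to `5`. -/
def curveSlabs : List CurveSlab :=
  [⟨5243, -203195, 777, ⟨0, 245197, -339, 3⟩, false, true, ⟨10486, 511921, -52, -12367, 1094⟩,
    [⟨6872, 491359, -138, -8195, 378⟩, ⟨9101, 472251, -215, -10913, 669⟩, ⟨8878, 450679, -299,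
    -10660, 629⟩, ⟨8796, 429494, -376, -10525, 819⟩, ⟨8796, 408527, -446, -10443, 745⟩, ⟨8796,
    387761, -507, -10320, 709⟩, ⟨7037, 369296, -555, -8145, 396⟩, ⟨7037, 353116, -591, -8031,
    396⟩, ⟨6319, 337980, -620, -7105, 333⟩, ⟨5470, 324812, -641, -6064, 265⟩, ⟨4736, 313567, -655,
    -5183, 216⟩, ⟨4101, 303949, -665, -4436, 182⟩, ⟨3550, 295713, -672, -3801, 153⟩, ⟨3842,
    287839, -677, -4072, 161⟩, ⟨3198, 280412, -680, -3356, 129⟩, ⟨2661, 274286, -682, -2770, 76⟩,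
    ⟨2215, 269227, -683, -2290, 73⟩, ⟨1843, 265043, -683, -1895, 45⟩, ⟨1534, 261579, -683, -1569,
    37⟩, ⟨1595, 258385, -682, -1625, 45⟩, ⟨1261, 255481, -682, -1279, 37⟩], [⟨4752, 249415, -680,
    -4780, 200⟩], [], ⟨0, 0, 0, 0⟩⟩,
    ⟨6029, -201532, 886, ⟨0, 244469, -389, 3⟩, false, true, ⟨7340, 515573, -42, -8715, 465⟩,
    [⟨6013, 499652, -118, -7207, 388⟩, ⟨7001, 484001, -192, -8443, 441⟩, ⟨8537, 465224, -279,
    -10333, 709⟩, ⟨9694, 443167, -375, -11724, 765⟩, ⟨8796, 420867, -465, -10576, 639⟩, ⟨7037,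
    401906, -535, -8386, 477⟩, ⟨7037, 385222, -590, -8298, 441⟩, ⟨7037, 368731, -639, -8192, 427⟩,
    ⟨5629, 354073, -676, -6467, 314⟩, ⟨5199, 341707, -704, -5899, 282⟩, ⟨4640, 330606, -725,
    -5202, 237⟩, ⟨4142, 320814, -741, -4591, 207⟩, ⟨3697, 312167, -754, -4056, 179⟩, ⟨3300,
    304526, -763, -3586, 153⟩, ⟨2946, 297767, -769, -3173, 91⟩, ⟨2630, 291783, -774, -2811, 90⟩,
    ⟨2347, 286482, -778, -2491, 76⟩, ⟨1676, 282224, -780, -1768, 45⟩, ⟨1532, 278847, -781, -1609,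
    45⟩, ⟨1401, 275773, -782, -1465, 37⟩, ⟨1280, 272974, -783, -1333, 37⟩, ⟨1170, 270427, -783,
    -1214, 37⟩, ⟨1070, 268105, -784, -1107, 25⟩], [⟨7287, 259532, -783, -7447, 497⟩, ⟨4099,
    247979, -780, -4120, 179⟩], [], ⟨0, 0, 0, 0⟩⟩,
    ⟨6933, -199638, 1008, ⟨0, 243634, -446, 6⟩, false, true, ⟨7340, 515483, -49, -8805, 524⟩,
    [⟨6013, 499396, -137, -7281, 441⟩, ⟨7001, 483586, -223, -8529, 497⟩, ⟨8537, 464624, -323,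
    -10433, 819⟩, ⟨7755, 444721, -423, -9469, 505⟩, ⟨7037, 426699, -508, -8554, 602⟩, ⟨7037,
    409654, -582, -8491, 564⟩, ⟨5629, 394432, -643, -6732, 304⟩, ⟨5629, 381033, -692, -6667, 396⟩,
    ⟨4504, 369084, -732, -5282, 216⟩, ⟨3603, 359612, -760, -4189, 168⟩, ⟨3578, 351298, -784,
    -4126, 161⟩, ⟨3332, 343361, -804, -3810, 142⟩, ⟨2482, 336733, -819, -2818, 108⟩, ⟨2346,
    331268, -831, -2647, 104⟩, ⟨1774, 326631, -840, -1991, 63⟩, ⟨1695, 322747, -847, -1893, 63⟩,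
    ⟨1297, 319411, -853, -1443, 51⟩, ⟨1251, 316582, -858, -1387, 51⟩], [⟨5756, 308869, -869,
    -6318, 314⟩, ⟨5988, 296088, -884, -6462, 314⟩, ⟨5915, 283353, -894, -6271, 291⟩, ⟨5455,
    271397, -899, -5685, 252⟩, ⟨5731, 259839, -899, -5872, 256⟩, ⟨5463, 248466, -895, -5503,
    256⟩], [], ⟨0, 0, 0, 0⟩⟩,
    ⟨7974, -197484, 1145, ⟨0, 242677, -511, 6⟩, false, true, ⟨7340, 515377, -57, -8911, 602⟩,
    [⟨4810, 500577, -150, -5890, 291⟩, ⟨6370, 486846, -236, -7842, 524⟩, ⟨7768, 469408, -342,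
    -9596, 613⟩, ⟨7057, 451095, -450, -8717, 536⟩, ⟨7037, 433717, -546, -8661, 505⟩, ⟨5629,
    418168, -626, -6888, 396⟩, ⟨4504, 405805, -686, -5476, 304⟩, ⟨4504, 394892, -736, -5438, 291⟩,
    ⟨3603, 385135, -777, -4319, 158⟩, ⟨2882, 377384, -808, -3433, 129⟩, ⟨2306, 371219, -832,
    -2732, 104⟩, ⟨1476, 366745, -848, -1742, 53⟩, ⟨1181, 363614, -859, -1389, 45⟩], [⟨4504,
    356961, -881, -5263, 223⟩, ⟨3486, 347664, -910, -4034, 168⟩, ⟨4058, 338980, -934, -4650, 237⟩,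
    ⟨3710, 330122, -956, -4207, 216⟩, ⟨4239, 321159, -975, -4754, 237⟩, ⟨3784, 312210, -992,
    -4195, 200⟩, ⟨4222, 303390, -1005, -4625, 216⟩, ⟨4569, 293825, -1017, -4938, 227⟩, ⟨3802,
    284833, -1024, -4056, 179⟩, ⟨3955, 276607, -1029, -4168, 179⟩, ⟨3907, 268372, -1031, -4067,
    161⟩, ⟨4505, 259677, -1031, -4627, 200⟩, ⟨4156, 250843, -1027, -4210, 182⟩, ⟨2338, 244293,
    -1023, -2344, 90⟩], [], ⟨0, 0, 0, 0⟩⟩,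
    ⟨9170, -195038, 1299, ⟨0, 241581, -585, 6⟩, false, true, ⟨5243, 517846, -47, -6442, 360⟩,
    [⟨4295, 506089, -133, -5315, 216⟩, ⟨5001, 494552, -216, -6222, 345⟩, ⟨6098, 480712, -314,
    -7618, 409⟩, ⟨5540, 466161, -415, -6934, 368⟩, ⟨5621, 452196, -508, -7031, 360⟩, ⟨4370,
    439712, -589, -5453, 276⟩, ⟨4504, 428659, -657, -5600, 269⟩, ⟨2882, 419490, -711, -3569, 127⟩,
    ⟨2882, 412364, -751, -3556, 172⟩, ⟨1845, 406539, -783, -2269, 84⟩, ⟨1476, 402460, -805, -1810,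
    70⟩], [⟨2882, 397128, -833, -3522, 161⟩, ⟨2882, 390102, -868, -3504, 158⟩, ⟨2882, 383114,
    -901, -3484, 147⟩, ⟨2882, 376167, -932, -3463, 142⟩, ⟨2882, 369263, -962, -3441, 133⟩, ⟨2848,
    362445, -989, -3377, 127⟩, ⟨2691, 355898, -1014, -3169, 114⟩, ⟨2543, 349754, -1036, -2975,
    147⟩, ⟨2404, 343986, -1055, -2794, 100⟩, ⟨2271, 338570, -1072, -2622, 127⟩, ⟨2147, 333484,
    -1086, -2464, 114⟩, ⟨2029, 328707, -1099, -2314, 108⟩, ⟨2396, 323677, -1112, -2715, 114⟩,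
    ⟨2232, 318451, -1124, -2512, 104⟩, ⟨2078, 313616, -1134, -2323, 91⟩, ⟨1935, 309144, -1142,
    -2150, 90⟩, ⟨1802, 305004, -1150, -1990, 76⟩, ⟨1679, 301169, -1156, -1844, 76⟩, ⟨1954, 297191,
    -1161, -2134, 76⟩, ⟨1786, 293118, -1166, -1939, 76⟩, ⟨1633, 289417, -1170, -1763, 73⟩, ⟨1493,
    286051, -1173, -1603, 73⟩, ⟨1364, 282989, -1176, -1458, 64⟩, ⟨1559, 279873, -1178, -1658, 64⟩,
    ⟨1392, 276741, -1179, -1474, 64⟩, ⟨1553, 273631, -1181, -1636, 64⟩, ⟨1344, 270586, -1181,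
    -1409, 64⟩, ⟨1164, 267962, -1182, -1215, 53⟩, ⟨1259, 265437, -1182, -1309, 45⟩], [⟨1310,
    262772, -1182, -1356, 64⟩, ⟨1035, 260349, -1181, -1067, 45⟩, ⟨1023, 258230, -1181, -1051, 45⟩,
    ⟨944, 256212, -1180, -967, 45⟩, ⟨793, 254435, -1179, -810, 37⟩, ⟨585, 253029, -1179, -596,
    37⟩, ⟨557, 251866, -1178, -567, 25⟩], ⟨5243, 241604, -585, 182⟩⟩,
    ⟨10545, -192326, 1278, ⟨0, 240326, -670, 11⟩, true, true, ⟨5243, 517744, -55, -6543, 416⟩,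
    [⟨3436, 506884, -145, -4317, 203⟩, ⟨4550, 496825, -229, -5743, 262⟩, ⟨4439, 485459, -322,
    -5623, 252⟩, ⟨4743, 473815, -416, -6021, 373⟩, ⟨3850, 462904, -501, -4890, 216⟩, ⟨3609,
    453435, -574, -4580, 196⟩, ⟨2627, 445525, -633, -3329, 147⟩, ⟨1829, 439882, -674, -2314, 76⟩,
    ⟨1476, 435703, -704, -1865, 63⟩], [⟨1181, 432347, -727, -1491, 53⟩, ⟨1181, 429367, -748,
    -1489, 51⟩, ⟨1476, 426020, -771, -1858, 63⟩, ⟨1181, 422678, -794, -1484, 51⟩, ⟨1181, 419711,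
    -814, -1482, 51⟩, ⟨1476, 416380, -835, -1849, 84⟩, ⟨1476, 412685, -859, -1845, 80⟩, ⟨1476,
    408999, -883, -1841, 80⟩, ⟨1476, 405321, -905, -1837, 80⟩, ⟨1476, 401653, -928, -1832, 76⟩,
    ⟨1476, 397993, -949, -1827, 76⟩, ⟨1476, 394344, -971, -1822, 76⟩, ⟨1476, 390705, -991, -1817,
    73⟩, ⟨1845, 386624, -1014, -2263, 84⟩, ⟨1845, 382106, -1038, -2255, 84⟩, ⟨1476, 378055, -1059,
    -1797, 70⟩, ⟨1476, 374467, -1077, -1791, 70⟩, ⟨1476, 370892, -1095, -1785, 91⟩, ⟨1476, 367329,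
    -1112, -1778, 64⟩, ⟨1463, 363795, -1128, -1756, 63⟩, ⟨1422, 360339, -1143, -1700, 63⟩, ⟨1382,
    356992, -1158, -1646, 80⟩, ⟨1074, 354071, -1170, -1275, 51⟩, ⟨1313, 351241, -1181, -1554,
    76⟩], [⟨3894, 345112, -1205, -4575, 223⟩, ⟨4449, 335374, -1239, -5164, 314⟩, ⟨3971, 325661,
    -1269, -4550, 256⟩, ⟨4431, 316100, -1293, -5009, 282⟩, ⟨3836, 306812, -1314, -4278, 216⟩,
    ⟨4152, 297963, -1329, -4569, 227⟩, ⟨3455, 289641, -1340, -3753, 182⟩, ⟨3595, 282029, -1347,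
    -3858, 182⟩, ⟨2841, 275157, -1352, -3015, 147⟩, ⟨2806, 269194, -1354, -2948, 129⟩, ⟨2588,
    263552, -1354, -2694, 127⟩, ⟨1740, 259063, -1353, -1797, 73⟩, ⟨1462, 255765, -1352, -1502,
    73⟩, ⟨1349, 252885, -1350, -1379, 73⟩, ⟨759, 250733, -1349, -773, 45⟩], ⟨5243, 240351, -670,
    196⟩⟩,
    ⟨12127, -189614, 1427, ⟨0, 238891, -765, 11⟩, true, true, ⟨3670, 519631, -45, -4657, 245⟩,
    [⟨1924, 512521, -113, -2453, 100⟩, ⟨2933, 506316, -172, -3752, 144⟩, ⟨2861, 498893, -243,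
    -3672, 139⟩, ⟨3057, 491286, -315, -3934, 207⟩, ⟨2482, 484152, -381, -3200, 122⟩, ⟨2326,
    477950, -439, -3002, 114⟩, ⟨2117, 472214, -491, -2734, 104⟩, ⟨1504, 467537, -533, -1943, 79⟩],
    [⟨2515, 462347, -580, -3248, 119⟩, ⟨2792, 455496, -640, -3603, 179⟩, ⟨3099, 447900, -705,
    -3993, 191⟩, ⟨3439, 439486, -776, -4421, 207⟩, ⟨2882, 431371, -842, -3693, 172⟩, ⟨2882,
    423997, -900, -3681, 167⟩, ⟨2882, 416651, -955, -3666, 161⟩, ⟨2882, 409337, -1009, -3649,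
    216⟩, ⟨2882, 402058, -1060, -3630, 210⟩, ⟨2882, 394819, -1109, -3609, 200⟩, ⟨2882, 387622,
    -1155, -3587, 196⟩, ⟨2882, 380471, -1199, -3563, 182⟩, ⟨2846, 373414, -1240, -3494, 172⟩,
    ⟨2690, 366641, -1277, -3279, 158⟩, ⟨2542, 360285, -1310, -3077, 142⟩, ⟨2402, 354322, -1339,
    -2887, 129⟩, ⟨2270, 348726, -1364, -2709, 119⟩, ⟨1716, 343981, -1385, -2036, 91⟩, ⟨2051,
    339526, -1403, -2419, 104⟩, ⟨1551, 335288, -1419, -1819, 80⟩, ⟨1482, 331740, -1432, -1730,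
    76⟩, ⟨1417, 328364, -1444, -1646, 73⟩, ⟨1355, 325152, -1454, -1567, 73⟩, ⟨1295, 322094, -1464,
    -1491, 91⟩], [⟨5905, 313881, -1487, -6715, 427⟩, ⟨5833, 300667, -1517, -6498, 396⟩, ⟨5380,
    288297, -1536, -5873, 448⟩, ⟨4522, 277579, -1546, -4847, 333⟩, ⟨3337, 269210, -1550, -3525,
    161⟩, ⟨3180, 262366, -1550, -3319, 153⟩], ⟨10486, 238995, -765, 709⟩⟩,
    ⟨13946, -186581, 1587, ⟨0, 237251, -874, 17⟩, true, false, ⟨3670, 519534, -52, -4754, 202⟩,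
    [], [⟨4698, 508654, -172, -6125, 360⟩, ⟨4387, 496780, -301, -5749, 333⟩, ⟨4280, 485404, -423,
    -5627, 324⟩, ⟨4573, 473756, -547, -6021, 336⟩, ⟨4640, 461628, -671, -6107, 333⟩, ⟨4509,
    449599, -791, -5922, 314⟩, ⟨4227, 438146, -901, -5531, 284⟩, ⟨4504, 426752, -1006, -5863,
    402⟩, ⟨4504, 415067, -1108, -5822, 382⟩, ⟨3603, 404621, -1194, -4623, 296⟩, ⟨3603, 395410,
    -1266, -4588, 282⟩, ⟨3603, 386272, -1333, -4550, 265⟩, ⟨3603, 377214, -1395, -4508, 249⟩,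
    ⟨3462, 368416, -1451, -4290, 223⟩, ⟨3225, 360168, -1500, -3958, 276⟩, ⟨3003, 352560, -1542,
    -3650, 242⟩, ⟨2797, 345542, -1577, -3369, 216⟩, ⟨2604, 339065, -1608, -3108, 188⟩, ⟨2425,
    333088, -1633, -2870, 168⟩, ⟨2259, 327566, -1655, -2652, 147⟩, ⟨1683, 322953, -1672, -1962,
    114⟩, ⟨1590, 319149, -1685, -1843, 108⟩, ⟨1503, 315574, -1696, -1732, 104⟩, ⟨1420, 312215,
    -1706, -1628, 91⟩, ⟨1342, 309057, -1715, -1530, 90⟩], [⟨7560, 299029, -1739, -8477, 629⟩,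
    ⟨6354, 283621, -1763, -6936, 619⟩, ⟨4689, 271683, -1772, -5008, 360⟩, ⟨3575, 262923, -1773,
    -3757, 256⟩, ⟨894, 258241, -1771, -931, 73⟩], ⟨10486, 237362, -874, 752⟩⟩,
    ⟨16038, -183229, 1755, ⟨0, 235379, -997, 17⟩, true, false, ⟨5243, 517325, -88, -6963, 465⟩,
    [], [⟨5369, 503179, -265, -7182, 472⟩, ⟨5564, 488518, -447, -7478, 484⟩, ⟨5428, 473732, -626,
    -7308, 458⟩, ⟨5799, 458626, -804, -7797, 668⟩, ⟨5885, 442950, -980, -7878, 643⟩, ⟨5629,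
    427590, -1143, -7481, 584⟩, ⟨5629, 412699, -1291, -7409, 536⟩, ⟨5629, 397970, -1426, -7320,
    496⟩, ⟨4504, 384868, -1536, -5783, 368⟩, ⟨4135, 373840, -1621, -5245, 429⟩, ⟨3780, 363859,
    -1692, -4737, 373⟩, ⟨3455, 354843, -1750, -4279, 314⟩, ⟨3158, 346697, -1798, -3868, 265⟩,
    ⟨2887, 339332, -1837, -3498, 227⟩, ⟨2639, 332669, -1870, -3165, 200⟩, ⟨2412, 326638, -1897,
    -2866, 168⟩, ⟨2205, 321176, -1919, -2597, 147⟩, ⟨2016, 316224, -1937, -2355, 182⟩, ⟨1843,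
    311733, -1952, -2137, 161⟩, ⟨1684, 307658, -1965, -1939, 153⟩, ⟨1540, 303959, -1975, -1761,
    129⟩, ⟨1126, 300917, -1983, -1281, 108⟩], [⟨7812, 290885, -2004, -8725, 679⟩, ⟨5957, 275705,
    -2023, -6464, 574⟩, ⟨1489, 267667, -2026, -1591, 108⟩], ⟨15728, 235646, -997, 1760⟩⟩,
    ⟨18444, -179522, 1929, ⟨0, 233247, -1135, 24⟩, true, false, ⟨7340, 514257, -144, -10030,
    1050⟩, [], [⟨6013, 495946, -407, -8281, 613⟩, ⟨7001, 477996, -658, -9669, 976⟩, ⟨6830, 458909,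
    -916, -9416, 916⟩, ⟨7297, 439499, -1165, -9993, 916⟩, ⟨7037, 419980, -1396, -9526, 805⟩,
    ⟨5629, 402939, -1581, -7515, 592⟩, ⟨5629, 388019, -1728, -7404, 749⟩, ⟨5268, 373800, -1854,
    -6816, 629⟩, ⟨4702, 361002, -1955, -5983, 497⟩, ⟨4197, 349765, -2034, -5255, 402⟩, ⟨3747,
    339888, -2096, -4622, 319⟩, ⟨3344, 331200, -2144, -4067, 360⟩, ⟨2985, 323550, -2181, -3584,
    304⟩, ⟨2665, 316804, -2210, -3162, 252⟩, ⟨2379, 310849, -2233, -2793, 207⟩, ⟨2123, 305589,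
    -2250, -2468, 179⟩, ⟨1895, 300937, -2264, -2184, 153⟩, ⟨1353, 297205, -2274, -1548, 127⟩,
    ⟨1237, 294249, -2281, -1407, 127⟩, ⟨1131, 291562, -2287, -1280, 108⟩], [⟨7703, 281703, -2303,
    -8548, 952⟩, ⟨4332, 268496, -2313, -4678, 373⟩], ⟨15728, 233532, -1135, 1348⟩⟩,
    ⟨21210, -175467, 2107, ⟨0, 230820, -1290, 25⟩, true, false, ⟨7340, 513943, -170, -10344, 879⟩,
    [], [⟨7516, 492923, -514, -10674, 1246⟩, ⟨7789, 471172, -860, -11075, 1256⟩, ⟨7598, 449349,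
    -1190, -10746, 1151⟩, ⟨8118, 427258, -1500, -11344, 1127⟩, ⟨7037, 406248, -1767, -9666, 872⟩,
    ⟨5401, 389293, -1960, -7289, 599⟩, ⟨6026, 374025, -2115, -7980, 825⟩, ⟨5218, 359277, -2247,
    -6769, 619⟩, ⟨4517, 346762, -2344, -5747, 468⟩, ⟨3911, 336127, -2416, -4889, 505⟩, ⟨3386,
    327073, -2470, -4166, 396⟩, ⟨3665, 318470, -2513, -4439, 360⟩, ⟨3050, 310395, -2549, -3637,
    282⟩, ⟨2030, 304366, -2571, -2392, 182⟩, ⟨1758, 299921, -2585, -2053, 216⟩, ⟨1903, 295664,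
    -2597, -2204, 227⟩, ⟨1583, 291643, -2607, -1818, 147⟩, ⟨1318, 288322, -2615, -1503, 129⟩,
    ⟨1097, 285576, -2620, -1244, 127⟩], [⟨5439, 278247, -2630, -6069, 599⟩], ⟨20971, 231366,
    -1290, 2550⟩⟩,
    ⟨24392, -171027, 2283, ⟨0, 228066, -1463, 45⟩, true, false, ⟨7340, 513570, -202, -10716,
    1040⟩, [], [⟨9395, 489037, -660, -13816, 1823⟩, ⟨8774, 462341, -1139, -12876, 1627⟩, ⟨8559,
    437043, -1562, -12419, 1452⟩, ⟨7037, 414587, -1902, -10036, 1073⟩, ⟨7037, 394722, -2170,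
    -9829, 1313⟩, ⟨6215, 376414, -2387, -8480, 1005⟩, ⟨6726, 358993, -2566, -8942, 916⟩, ⟨4478,
    344244, -2693, -5809, 517⟩, ⟨4846, 332284, -2781, -6152, 669⟩, ⟨4033, 321122, -2849, -5012,
    468⟩, ⟨3357, 312016, -2896, -4096, 340⟩, ⟨2794, 304566, -2927, -3356, 360⟩, ⟨2325, 298454,
    -2949, -2756, 291⟩, ⟨1935, 293429, -2964, -2269, 252⟩, ⟨1610, 289290, -2975, -1870, 216⟩,
    ⟨1340, 285875, -2982, -1545, 207⟩, ⟨1115, 283054, -2987, -1277, 182⟩, ⟨1160, 280456, -2991,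
    -1321, 147⟩], [⟨4372, 274218, -2998, -4905, 477⟩], ⟨20971, 228656, -1463, 2755⟩⟩,
    ⟨28050, -166260, 2453, ⟨0, 224946, -1655, 51⟩, true, false, ⟨10486, 508320, -343, -15966,
    2446⟩, [], [⟨10738, 475936, -1027, -16414, 2426⟩, ⟨8902, 446047, -1617, -13470, 1849⟩, ⟨8087,
    420569, -2071, -12007, 1497⟩, ⟨7037, 398360, -2422, -10202, 1127⟩, ⟨8016, 376872, -2716,
    -11287, 1505⟩, ⟨6671, 356496, -2948, -9091, 1016⟩, ⟨5552, 340065, -3102, -7343, 966⟩, ⟨4621,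
    326772, -3204, -5953, 657⟩, ⟨4807, 314782, -3278, -6038, 584⟩, ⟨3039, 305014, -3326, -3735,
    441⟩, ⟨3161, 297459, -3356, -3818, 441⟩, ⟨2498, 290673, -3377, -2969, 333⟩, ⟨1974, 285388,
    -3390, -2317, 282⟩, ⟨1560, 281259, -3397, -1812, 252⟩, ⟨1233, 278026, -3402, -1421, 227⟩],
    [⟨4647, 271324, -3408, -5266, 574⟩], ⟨20971, 225587, -1655, 2993⟩⟩,
    ⟨32258, -161170, 2610, ⟨0, 221425, -1865, 53⟩, true, false, ⟨10486, 507569, -411, -16717,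
    2926⟩, [], [⟨10738, 473699, -1226, -17148, 2877⟩, ⟨11127, 439072, -1993, -17473, 2678⟩, ⟨8684,
    408356, -2587, -13241, 2466⟩, ⟨7634, 383854, -2989, -11262, 1785⟩, ⟨7942, 361310, -3295,
    -11286, 1486⟩, ⟨6276, 341442, -3512, -8586, 1284⟩, ⟨6200, 324673, -3654, -8185, 1016⟩, ⟨4575,
    310644, -3745, -5849, 840⟩, ⟨4219, 299544, -3799, -5251, 689⟩, ⟨2837, 290844, -3830, -3454,
    427⟩, ⟨2384, 284535, -3846, -2856, 360⟩, ⟨2199, 279084, -3856, -2596, 333⟩, ⟨1237, 275045,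
    -3860, -1445, 256⟩], [], ⟨26214, 222509, -1865, 5047⟩⟩,
    ⟨37097, -155771, 2747, ⟨0, 217464, -2094, 64⟩, true, false, ⟨10486, 506669, -494, -17616,
    3510⟩, [], [⟨10738, 471025, -1470, -18019, 3434⟩, ⟨11127, 434741, -2374, -18258, 3131⟩, ⟨8684,
    402738, -3056, -13743, 2795⟩, ⟨9170, 375101, -3541, -13896, 2330⟩, ⟨7247, 350727, -3877,
    -10484, 1932⟩, ⟨7159, 330341, -4093, -9904, 1497⟩, ⟨5282, 313428, -4224, -7016, 1178⟩, ⟨4872,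
    300156, -4297, -6254, 952⟩, ⟨4094, 288808, -4339, -5097, 697⟩, ⟨3021, 280048, -4359, -3670,
    497⟩, ⟨2304, 273634, -4367, -2748, 409⟩], [⟨576, 270211, -4368, -680, 207⟩], ⟨26214, 218646,
    -2094, 5499⟩⟩,
    ⟨42661, -150112, 2859, ⟨0, 213029, -2339, 80⟩, true, false, ⟨10486, 505583, -599, -18701,
    4249⟩, [], [⟨13422, 463121, -1913, -23750, 5088⟩, ⟨10028, 422224, -3021, -17135, 3146⟩,
    ⟨10240, 388435, -3770, -16655, 3495⟩, ⟨8092, 359335, -4270, -12453, 2009⟩, ⟨7994, 335234,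
    -4578, -11647, 2109⟩, ⟨7373, 313417, -4772, -10161, 1582⟩, ⟨4957, 296752, -4866, -6523, 1102⟩,
    ⟨4166, 284938, -4906, -5295, 819⟩, ⟨3075, 275848, -4921, -3802, 584⟩, ⟨2344, 269212, -4924,
    -2839, 497⟩], [⟨586, 265678, -4922, -702, 282⟩], ⟨26214, 214317, -2339, 6008⟩⟩,
    ⟨49061, -144250, 2939, ⟨0, 208087, -2599, 104⟩, true, false, ⟨10486, 504266, -731, -20017,
    5175⟩, [], [⟨10738, 463937, -2150, -20294, 4934⟩, ⟨11127, 423408, -3401, -20222, 5943⟩,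
    ⟨10104, 385893, -4328, -17294, 3990⟩, ⟨9981, 352685, -4933, -15914, 3914⟩, ⟨7365, 325811,
    -5266, -10969, 1995⟩, ⟨6793, 305292, -5430, -9543, 1525⟩, ⟨5709, 288148, -5507, -7609, 1445⟩,
    ⟨4213, 275171, -5530, -5384, 916⟩, ⟨3212, 265825, -5528, -3977, 791⟩], [⟨803, 260882, -5521,
    -978, 373⟩], ⟨26214, 209494, -2599, 6566⟩⟩,
    ⟨56420, -138267, 2985, ⟨0, 202616, -2869, 127⟩, true, false, ⟨10486, 502657, -901, -21627,
    6365⟩, [], [⟨10738, 459228, -2625, -21774, 5950⟩, ⟨11127, 416011, -4087, -21427, 6850⟩,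
    ⟨10766, 375400, -5131, -19191, 4552⟩, ⟨9929, 339971, -5749, -16213, 4206⟩, ⟨8345, 311230,
    -6051, -12530, 2573⟩, ⟨6159, 290094, -6163, -8636, 1897⟩, ⟨5869, 273689, -6189, -7774, 1203⟩],
    [], ⟨31457, 204819, -2869, 10257⟩⟩,
    ⟨64883, -132215, 2998, ⟨0, 196600, -3142, 158⟩, true, false, ⟨10486, 500673, -1121, -23612,
    7886⟩, [], [⟨10738, 453477, -3226, -23543, 7188⟩, ⟨11127, 407135, -4916, -22783, 7756⟩,
    ⟨10062, 365592, -5999, -18777, 6209⟩, ⟨9281, 331063, -6569, -15714, 4167⟩, ⟨7800, 303293,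
    -6819, -12066, 2534⟩, ⟨7195, 280957, -6893, -10275, 1869⟩, ⟨4047, 265318, -6883, -5444,
    1054⟩], [], ⟨31457, 199003, -3142, 11197⟩⟩,
    ⟨74615, -126166, 2982, ⟨0, 190040, -3413, 196⟩, true, false, ⟨10486, 498207, -1410, -26081,
    9890⟩, [], [⟨10738, 446417, -3987, -25648, 8668⟩, ⟨11127, 396488, -5904, -24267, 8560⟩,
    ⟨11614, 349771, -7052, -22362, 8463⟩, ⟨9760, 310889, -7536, -16527, 4661⟩, ⟨7203, 283441,
    -7646, -11001, 2293⟩, ⟨5492, 264745, -7622, -7773, 1817⟩, ⟨1373, 255156, -7580, -1866, 619⟩],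
    [], ⟨31457, 192658, -3413, 8724⟩⟩,
    ⟨85808, -120268, 2947, ⟨0, 182949, -3671, 168⟩, true, false, ⟨10486, 495106, -1797, -29182,
    12597⟩, [], [⟨10738, 437715, -4949, -28125, 14508⟩, ⟨11127, 383766, -7049, -25822, 12624⟩,
    ⟨10566, 336651, -8079, -21171, 7983⟩, ⟨8879, 300006, -8411, -15512, 4365⟩, ⟨8192, 271856,
    -8423, -12720, 3692⟩, ⟨4607, 252704, -8324, -6564, 1448⟩], [], ⟨31457, 185796, -3671, 9496⟩⟩,
    ⟨98679, -114371, 2903, ⟨0, 175361, -3909, 200⟩, true, false, ⟨10486, 491179, -2321, -33109,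
    16262⟩, [], [⟨10738, 426978, -6149, -30978, 17044⟩, ⟨11127, 368543, -8322, -27337, 14315⟩,
    ⟨11797, 317033, -9167, -23979, 10252⟩, ⟨8706, 278361, -9255, -14974, 3626⟩, ⟨6639, 253400,
    -9107, -10144, 2608⟩, ⟨1660, 240957, -8982, -2385, 1127⟩], [], ⟨31457, 178450, -3909, 10320⟩⟩,
    ⟨113481, -108554, 2864, ⟨0, 167326, -4118, 237⟩, true, false, ⟨7340, 497290, -2158, -26998,
    15121⟩, [], [⟨9395, 438387, -6285, -31774, 20890⟩, ⟨10967, 375479, -9052, -30936, 19347⟩,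
    ⟨12199, 316932, -10064, -27301, 9839⟩, ⟨9003, 273644, -10063, -16455, 4914⟩, ⟨6865, 246472,
    -9812, -10916, 3378⟩, ⟨1717, 233113, -9630, -2541, 1023⟩], [], ⟨31457, 170673, -4118, 11193⟩⟩,
    ⟨130503, -102803, 2839, ⟨0, 158909, -4290, 272⟩, true, false, ⟨7340, 492514, -2893, -31774,
    20254⟩, [], [⟨9395, 424867, -7922, -35690, 33973⟩, ⟨10967, 356078, -10507, -32611, 21700⟩,
    ⟨10618, 299248, -11010, -24311, 8820⟩, ⟨9796, 257332, -10718, -17994, 4914⟩, ⟨5510, 230917,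
    -10324, -8719, 2337⟩], [], ⟨31457, 162532, -4290, 12130⟩⟩,
    ⟨150078, -97083, 2829, ⟨0, 150191, -4420, 311⟩, true, false, ⟨5243, 496671, -2867, -27617,
    20082⟩, [], [⟨6711, 437397, -8025, -31441, 25339⟩, ⟨9793, 369794, -11204, -35600, 28151⟩,
    ⟨10488, 306177, -11903, -27962, 12191⟩, ⟨11017, 256448, -11470, -22222, 7459⟩, ⟨6721, 223589,
    -10874, -11113, 3398⟩, ⟨3780, 206945, -10494, -5623, 2054⟩], [], ⟨26214, 152920, -4420,
    9214⟩⟩,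
    ⟨172590, -91376, 2831, ⟨0, 141258, -4505, 340⟩, true, false, ⟨3670, 500128, -2863, -24160,
    14322⟩, [], [⟨4698, 447934, -8139, -27775, 26270⟩, ⟨6855, 387897, -11692, -32011, 26656⟩,
    ⟨7981, 328047, -12787, -27493, 12138⟩, ⟨10027, 275401, -12495, -25403, 9457⟩, ⟨8426, 234079,
    -11760, -16462, 5736⟩, ⟨4975, 209603, -11176, -8264, 2965⟩, ⟨3672, 195826, -10800, -5547,
    2323⟩, ⟨2240, 187102, -10547, -3181, 1325⟩, ⟨1259, 182185, -10399, -1726, 1151⟩], [], ⟨20971,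
    143155, -4505, 6493⟩⟩,
    ⟨198478, -85650, 2835, ⟨0, 132204, -4542, 373⟩, true, false, ⟨2621, 502060, -3006, -22210,
    15123⟩, [], [⟨3355, 454054, -8549, -25499, 19718⟩, ⟨4896, 399069, -12341, -29407, 25976⟩,
    ⟨5700, 343992, -13634, -25342, 11560⟩, ⟨6951, 295913, -13516, -22965, 11624⟩, ⟨6362, 257079,
    -12905, -16302, 5807⟩, ⟨6285, 227741, -12233, -13182, 4858⟩, ⟨5797, 204356, -11593, -10297,
    3980⟩, ⟨3897, 187990, -11099, -6136, 1966⟩, ⟨2096, 178780, -10803, -3078, 1458⟩, ⟨1237,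
    173941, -10641, -1750, 1285⟩], [⟨4663, 166007, -10362, -6194, 2034⟩], ⟨15728, 133365, -4542,
    4092⟩⟩]

set_option maxRecDepth 100000 in
theorem checkAll_curveSlabs : CurveSlab.checkAll 2621440 curveSlabs 5242880 = true := by
  decide +kernel

end

noncomputable section

open Real Set AffForm

/-- A condition on a point of the curve for `slopeE q r c / (q - 1)` to be nonnegative for all
`-1 < q ≤ 3 / 2`. -/
def Favourable (r c : ℝ) : Prop :=
  0 < slopeE (3 / 2) r c ∧ slopeE 2 r c / 2 < 4 / 3 * slopeE (3 / 2) r c * (1 - r - c) ^ (1 / 2 : ℝ)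

/-- Decides `Favourable` from enclosures of `slopeE (3 / 2) r c`, of `slopeE 2 r c` and of
`1 - r - c`. -/
def favourableOf (e₁ e₂ z : AffForm) : Bool :=
  e₁.pos && (e₁ * pow (const 1 2) z * const 4 3 - e₂ * const 1 2).pos

theorem favourableOf_sound {t : Noise} {fe₁ fe₂ fz : AffForm} {e₁ e₂ z : ℝ} (h₁ : fe₁.Encl t e₁)
    (h₂ : fe₂.Encl t e₂) (hz : fz.Encl t z) (hz0 : 0 < z) (h : favourableOf fe₁ fe₂ fz = true) :
    0 < e₁ ∧ 0 < e₁ * z ^ (1 / 2 : ℝ) * (4 / 3) - e₂ * (1 / 2) := by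
  simp only [favourableOf, Bool.and_eq_true] at h
  have c1 : (const 1 2).Encl t (1 / 2) := encl_const' 1 two_pos (by norm_num)
  have c2 : (const 4 3).Encl t (4 / 3) := encl_const' 4 (by norm_num) (by norm_num)
  exact ⟨h₁.lt_of_pos h.1,
    (((h₁.hMul (hz.pow c1 hz0)).hMul c2).hSub (h₂.hMul c1)).lt_of_pos h.2⟩

/-- Decides `Favourable` on a cell. -/
def testFavourable (_ _ r c _ _ _ _ : AffForm) : Bool :=
  r.compl.bind fun r' => c.compl.bind fun c' =>
  favourableOf (slopeEF r c (powSmall (const 3 2) r) (pow (const 3 2) c) (pow (const 3 2) r')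
    (pow (const 3 2) c')) (slopeEF r c (r * r) (c * c) (r' * r') (c' * c')) (r' - c)

theorem testFavourable_sound {t : Noise} {p r : ℝ} {fp fq fr fc fρ fγ fR fC : AffForm}
    (hp : 0 < p) (hr0 : 0 < r) (hr : r < 1 / 2) (he : CurveEncl t p r fp fq fr fc fρ fγ fR fC)
    (h : testFavourable fp fq fr fc fρ fγ fR fC = true) : Favourable r (curveC p r) := by
  have hc0 := curveC_pos hp hr0.le hr
  have hc1 := (curveC_mem hp (r := r) ⟨hr0.le, hr.le⟩).1.2
  have e1 := he.hr
  have e2 := he.hc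
  generalize curveC p r = c at *
  simp only [testFavourable, bind_eq] at h
  have c1 : (const 3 2).Encl t (3 / 2) := encl_const' 3 two_pos (by norm_num)
  have e : ∀ x : ℝ, x ^ (2 : ℝ) = x * x := fun x => by rw [rpow_two, sq]
  have k1 := Encl.slopeEF e1 e2 (e1.powSmall c1 hr0) (e2.pow c1 hc0)
    (e1.compl.pow c1 (by linarith)) (e2.compl.pow c1 (by linarith))
  have k2 := Encl.slopeEF e1 e2 (by rw [e]; exact e1.hMul e1) (by rw [e]; exact e2.hMul e2)
    (by rw [e]; exact e1.compl.hMul e1.compl) (by rw [e]; exact e2.compl.hMul e2.compl) (q := 2)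
  obtain ⟨h1, h2⟩ := favourableOf_sound k1 k2 (e1.compl.hSub e2) (by linarith) h
  exact ⟨h1, by linarith⟩

namespace DiagCell

/-- Decides `Favourable` on a cell about the diagonal. -/
def testFavourable (_ _ r c m : AffForm) : Bool :=
  (const 1 2).bind fun i => r.compl.bind fun r' => c.compl.bind fun c' =>
  favourableOf (slopeWF (const 3 2) r c (powSmall i r) (pow i c) (pow i r') (pow i c'))
    (slopeWF (const 2 1) r c r c r' c') (m + m).compl

theorem favourable_of_check {pc hp : ℤ} {d : DiagCell} (h : check pc hp d testFavourable = true)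
    {u p r : ℝ} (hu : |u| ≤ 1) (hp0 : 1 < p) (hpu : p = (pc + hp * u) / gridScale) (hr0 : 0 < r)
    (hr : r < curveTau p) (hT : (curveC p r - r) * gridScale ≤ 4 * d.th) :
    Favourable r (curveC p r) := by
  have hp1 : 0 < p := by linarith
  have hτ := curveTau_spec hp1
  have hC := curveC_mem hp1 (r := r) ⟨hr0.le, by linarith [hτ.1.2]⟩
  have hlt := lt_curveC_of_lt_curveTau hp1 hr0.le hr
  have hhalf := curveTau_lt_half hp1
  set c := curveC p r
  have e1 : (r + c) / 2 - (c - r) / 2 = r := by ring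
  have e2 : (r + c) / 2 + (c - r) / 2 = c := by ring
  obtain ⟨fp, fq, fr, fc, fm, ht, he⟩ := check_sound h hu hp0 hpu (m := (r + c) / 2)
    (T := (c - r) / 2) (by linarith)
    (by
      have hG : (gridScale : ℝ) = 1048576 := by norm_num
      rw [hG] at hT ⊢; linarith) (by rw [e1]; exact hr0.le)
    (by rw [e2]; linarith [hC.1.2]) (by rw [e1, e2, hC.2]; ring)
  set m := (r + c) / 2 with hm
  have key : ∀ s ∈ Icc 0 ((c - r) / 2), 0 < slopeW (3 / 2) (m - s) (m + s) ∧
      0 < slopeW (3 / 2) (m - s) (m + s) * (1 - (m + m)) ^ (1 / 2 : ℝ) * (4 / 3)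
        - slopeW 2 (m - s) (m + s) * (1 / 2) := by
    intro s hs
    obtain ⟨h1, h2, t, -, -, k2, k3, k4, k5⟩ := he s hs.1 hs.2
    simp only [testFavourable, bind_eq] at ht
    have c1 : (const 1 2).Encl t (3 / 2 - 1) := encl_const' 1 two_pos (by norm_num)
    have c2 : (const 3 2).Encl t (3 / 2) := encl_const' 3 two_pos (by norm_num)
    have c3 : (const 2 1).Encl t 2 := encl_const' 2 one_pos (by norm_num)
    have hs0 := hs.1
    have e : ∀ x : ℝ, x ^ (2 - 1 : ℝ) = x := fun x => by norm_num
    exact favourableOf_sound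
      (Encl.slopeWF c2 k3 k4 (k3.powSmall c1 h1) (k4.pow c1 (by linarith))
        (k3.compl.pow c1 (by linarith)) (k4.compl.pow c1 (by linarith)))
      (Encl.slopeWF c3 k3 k4 (by rw [e]; exact k3) (by rw [e]; exact k4)
        (by rw [e]; exact k3.compl) (by rw [e]; exact k4.compl))
      (k5.hAdd k5).compl (by rw [hm]; linarith [hC.1.2]) ht
  have hd : ∀ q : ℝ, ∀ s ∈ Icc 0 ((c - r) / 2), HasDerivAt (fun s => slopeE q (m - s) (m + s))
      (slopeW q (m - s) (m + s)) s := fun q s hs => by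
    obtain ⟨h1, h2, -⟩ := he s hs.1 hs.2
    exact hasDerivAt_slopeE q h1 (by linarith [hs.1]) (by linarith [hs.1]) h2
  have k1 := pos_of_hasDerivAt_pos (by linarith) (by simp [slopeE_self]) (hd (3 / 2))
    fun s hs => (key s hs).1
  have k2 := pos_of_hasDerivAt_pos (by linarith) (by simp [slopeE_self])
    (fun s hs => (((hd (3 / 2) s hs).mul_const ((1 - (m + m)) ^ (1 / 2 : ℝ))).mul_const (4 / 3)).sub
      ((hd 2 s hs).mul_const (1 / 2))) fun s hs => (key s hs).2
  simp only [Pi.sub_apply, e1, e2] at k1 k2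
  have e3 : 1 - (m + m) = 1 - r - c := by rw [hm]; ring
  rw [e3] at k2
  exact ⟨k1, by linarith⟩

end DiagCell

/-- Tabulated data for the values `p` in an interval of half width `hp`, by which the points of the
curve are seen to be favourable. -/
structure FavourableSlab where
  hp : ℤ
  cells : List CurveCell
  diag : DiagCell

namespace FavourableSlab

/-- Verifies the data of a slab with centre `pc`. -/
def check (pc : ℤ) (s : FavourableSlab) : Bool :=
  CurveCell.chain pc s.hp testFavourable 20972 s.cells fun r =>
    curveBelow pc s.hp r (r + 4 * s.diag.th) && s.diag.check pc s.hp DiagCell.testFavourable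

variable {p r : ℝ}

theorem check_sound {pc : ℤ} {s : FavourableSlab} (h : s.check pc = true) {u : ℝ} (hu : |u| ≤ 1)
    (hp0 : 1 < p) (hpu : p = (pc + s.hp * u) / gridScale) (hr0 : 20972 < r * gridScale)
    (hr : r < curveTau p) : Favourable r (curveC p r) := by
  have hp : 0 < p := by linarith
  have hG : (gridScale : ℝ) = 1048576 := by norm_num
  have hτ := curveTau_lt_half hp
  have hr1 : 0 < r := by rw [hG] at hr0; linarith
  obtain ⟨r', -, hlast, hcells⟩ := CurveCell.chain_sound hu hp0 hpu
    (Q := fun r => r < 1 / 2 → Favourable r (curveC p r))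
    (fun t r fp fq fr fc fρ fγ fR fC _ h0 _ he ht h1 => testFavourable_sound hp h0 h1 he ht)
    (by norm_num) h
  by_cases hA : r * gridScale ≤ r'
  · exact hcells r (by push_cast; exact hr0) hA (by linarith)
  simp only [Bool.and_eq_true] at hlast
  obtain ⟨b1, b2, b3⟩ := curveBelow_sound hlast.1 hu hp0 hpu
  have hlt : (r' : ℝ) / gridScale < r := by
    rw [hG] at hA ⊢
    rw [div_lt_iff₀ (by norm_num)]
    exact not_le.1 hA
  refine DiagCell.favourable_of_check hlast.2 hu hp0 hpu hr1 hr ?_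
  have := strictAntiOn_curveC hp ⟨b1.le, b2⟩ ⟨hr1.le, by linarith⟩ hlt
  rw [hG] at b3 hlt this ⊢
  rw [lt_div_iff₀ (by norm_num)] at b3
  rw [div_lt_iff₀ (by norm_num)] at hlt
  push_cast at b3
  linarith

/-- Verifies consecutive slabs covering `[a, b]`. -/
def checkAll : ℤ → List FavourableSlab → ℤ → Bool
  | a, [], b => decide (b ≤ a)
  | a, s :: l, b => check (a + s.hp) s && forceInt (a + s.hp + s.hp) fun a => checkAll a l b

theorem checkAll_sound {l : List FavourableSlab} {b : ℤ} (hp0 : 1 < p)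
    (hr0 : 20972 < r * gridScale) (hr : r < curveTau p) : ∀ {a : ℤ}, checkAll a l b = true →
    a ≤ p * gridScale → p * gridScale < b → Favourable r (curveC p r) := by
  induction l with
  | nil =>
    intro a h h1 h2
    simp only [checkAll, decide_eq_true_eq] at h
    have : (b : ℝ) ≤ a := by exact_mod_cast h
    exact absurd (h1.trans_lt h2) (not_lt.2 this)
  | cons s l ih =>
    intro a h h1 h2
    simp only [checkAll, Bool.and_eq_true, forceInt_eq] at h
    by_cases hx : p * gridScale ≤ ((a + s.hp + s.hp : ℤ) : ℝ)
    · obtain ⟨u, hu, hpu⟩ := exists_noise_coord (c := a + s.hp) (h := s.hp) (x := p) (by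
        have hG : (gridScale : ℝ) = 1048576 := by norm_num
        rw [hG] at hx h1 ⊢
        push_cast at hx ⊢
        rw [abs_le]; constructor <;> linarith)
      exact check_sound h.1 hu hp0 hpu hr0 hr
    · exact ih h.2 (not_le.1 hx).le h2

end FavourableSlab

end

section

open Real Set AffForm

set_option maxRecDepth 100000 in
/-- Slabs covering the exponents from `1` to `5 / 2`. -/
def favourableSlabs : List FavourableSlab :=
  [⟨36700, [⟨13422, 514757, -413, -3870, 1157⟩, ⟨19585, 504652, -802, -6229, 2337⟩, ⟨21475,
    490649, -1286, -7784, 2761⟩, ⟨21475, 473873, -1803, -9020, 3173⟩, ⟨17180, 456514, -2282,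
    -8324, 3667⟩, ⟨13744, 440648, -2675, -7528, 2993⟩, ⟨9823, 427161, -2981, -5940, 2898⟩, ⟨7763,
    416143, -3211, -5072, 2313⟩, ⟨7668, 405699, -3415, -5376, 3317⟩, ⟨5658, 396092, -3591, -4225,
    2466⟩, ⟨5219, 387759, -3735, -4109, 2313⟩, ⟨3509, 380762, -3849, -2886, 2285⟩, ⟨2948, 375372,
    -3933, -2505, 2024⟩, ⟨2720, 370487, -4006, -2380, 1897⟩, ⟨1530, 366739, -4060, -1369, 1952⟩],
    ⟨10486, 347059, -2158, 2951⟩⟩,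
    ⟨42205, [⟨13422, 513840, -505, -4222, 1417⟩, ⟨19585, 502868, -982, -6741, 2040⟩, ⟨21475,
    487767, -1575, -8350, 3153⟩, ⟨17180, 471845, -2140, -7565, 3587⟩, ⟨17180, 455768, -2652,
    -8528, 3954⟩, ⟨13744, 439577, -3121, -7655, 3234⟩, ⟨10281, 425616, -3490, -6296, 3378⟩, ⟨8125,
    413946, -3774, -5370, 2687⟩, ⟨6421, 404057, -3998, -4518, 3030⟩, ⟨6343, 394817, -4194, -4724,
    3084⟩, ⟨4680, 386427, -4362, -3666, 2362⟩, ⟨4316, 379236, -4498, -3526, 3098⟩, ⟨2902, 373258,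
    -4606, -2454, 2313⟩, ⟨2439, 368689, -4685, -2117, 2069⟩, ⟨2250, 364575, -4753, -1998, 1995⟩,
    ⟨1265, 361437, -4804, -1143, 2177⟩], ⟨10486, 342380, -2539, 3941⟩⟩,
    ⟨33975, [⟨13422, 512904, -431, -4584, 1210⟩, ⟨19585, 501049, -838, -7266, 1745⟩, ⟨21475,
    484861, -1345, -8929, 2820⟩, ⟨21475, 465777, -1879, -10187, 3226⟩, ⟨17180, 446300, -2366,
    -9277, 3682⟩, ⟨13744, 428709, -2759, -8302, 2954⟩, ⟨11045, 413057, -3074, -7341, 3317⟩, ⟨8149,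
    399850, -3316, -5854, 2362⟩, ⟨7516, 388230, -3512, -5769, 2216⟩, ⟨5053, 378357, -3666, -4097,
    2053⟩, ⟨4247, 370670, -3777, -3590, 1732⟩, ⟨3918, 363644, -3873, -3438, 1631⟩, ⟨2204, 358217,
    -3944, -1990, 1465⟩], ⟨10486, 337769, -2088, 2617⟩⟩,
    ⟨39071, [⟨13422, 511951, -523, -4952, 1050⟩, ⟨19585, 499192, -1019, -7799, 2117⟩, ⟨21475,
    481867, -1634, -9516, 3250⟩, ⟨17180, 463837, -2216, -8507, 2617⟩, ⟨17180, 445864, -2735,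
    -9480, 3949⟩, ⟨13744, 427955, -3202, -8422, 3181⟩, ⟨11631, 411721, -3583, -7812, 3798⟩, ⟨8582,
    397676, -3881, -6224, 2734⟩, ⟨7916, 385325, -4120, -6130, 2554⟩, ⟨5322, 374839, -4307, -4351,
    2389⟩, ⟨4472, 366679, -4441, -3810, 2053⟩, ⟨3301, 359962, -4545, -2908, 2216⟩, ⟨2516, 354782,
    -4621, -2274, 1842⟩, ⟨629, 351939, -4661, -576, 1148⟩], ⟨10486, 333251, -2447, 3481⟩⟩,
    ⟨44932, [⟨13422, 510789, -639, -5402, 1284⟩, ⟨19585, 496926, -1248, -8451, 2590⟩, ⟨21475,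
    478233, -2001, -10230, 3963⟩, ⟨17180, 458913, -2708, -9079, 3166⟩, ⟨17180, 439777, -3334,
    -10051, 4395⟩, ⟨13744, 420851, -3892, -8874, 3530⟩, ⟨10998, 404252, -4329, -7724, 3941⟩,
    ⟨8115, 390423, -4657, -6102, 2862⟩, ⟨5988, 379577, -4893, -4745, 2993⟩, ⟨5523, 370263, -5079,
    -4573, 2765⟩, ⟨4641, 361694, -5238, -3999, 2368⟩, ⟨2740, 355269, -5349, -2431, 2285⟩, ⟨2022,
    351012, -5419, -1829, 1918⟩, ⟨1928, 347412, -5476, -1772, 1869⟩], ⟨10486, 327951, -2872,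
    3273⟩⟩,
    ⟨51672, [⟨10738, 510577, -726, -4741, 1271⟩, ⟨17387, 497734, -1367, -8090, 2849⟩, ⟨17180,
    481031, -2151, -8599, 2795⟩, ⟨17180, 463092, -2925, -9327, 3872⟩, ⟨13744, 445672, -3613,
    -8083, 4288⟩, ⟨13744, 428855, -4216, -8728, 4206⟩, ⟨10852, 412708, -4743, -7414, 4529⟩, ⟨8576,
    399066, -5148, -6225, 3495⟩, ⟨8472, 386338, -5491, -6501, 3346⟩, ⟨6251, 374802, -5776, -5041,
    3503⟩, ⟨4613, 365905, -5978, -3863, 2687⟩, ⟨4254, 358370, -6136, -3676, 2520⟩, ⟨2860, 352166,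
    -6258, -2535, 2687⟩, ⟨2404, 347462, -6345, -2172, 2426⟩, ⟨1774, 343666, -6413, -1628, 2107⟩,
    ⟨1082, 341039, -6458, -1003, 1809⟩, ⟨609, 339471, -6484, -568, 1651⟩], ⟨10486, 321730, -3372,
    4234⟩⟩,
    ⟨41596, [⟨10738, 509227, -624, -5200, 1094⟩, ⟨17387, 495192, -1176, -8828, 2446⟩, ⟨17180,
    477031, -1851, -9323, 2396⟩, ⟨17180, 457658, -2513, -10042, 3303⟩, ⟨17180, 436709, -3161,
    -10901, 4483⟩, ⟨13744, 416354, -3726, -9448, 3475⟩, ⟨10331, 399312, -4148, -7591, 2520⟩,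
    ⟨9529, 384303, -4479, -7418, 3104⟩, ⟨8008, 370315, -4755, -6574, 2534⟩, ⟨5910, 358677, -4961,
    -5067, 2554⟩, ⟨4507, 349618, -5106, -3995, 1952⟩, ⟨1126, 344616, -5180, -1017, 1315⟩], ⟨15728,
    315367, -2762, 4161⟩⟩,
    ⟨47835, [⟨10738, 507840, -763, -5668, 1334⟩, ⟨13909, 494540, -1357, -7623, 1722⟩, ⟨17180,
    476973, -2100, -9933, 2932⟩, ⟨17180, 456416, -2909, -10613, 4018⟩, ⟨17180, 434373, -3695,
    -11421, 3867⟩, ⟨13744, 413129, -4373, -9815, 4137⟩, ⟨10535, 395321, -4877, -7989, 3023⟩,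
    ⟨9716, 379564, -5272, -7767, 3667⟩, ⟨6533, 366343, -5568, -5456, 2323⟩, ⟨5490, 356150, -5772,
    -4741, 2657⟩, ⟨5065, 346908, -5940, -4507, 2418⟩, ⟨2848, 339818, -6057, -2593, 2177⟩], ⟨15728,
    309429, -3222, 5253⟩⟩,
    ⟨55010, [⟨10738, 506135, -941, -6245, 1648⟩, ⟨13909, 491510, -1674, -8367, 2121⟩, ⟨17180,
    472288, -2591, -10841, 3604⟩, ⟨17180, 449935, -3581, -11498, 4878⟩, ⟨13744, 428679, -4439,
    -9746, 3724⟩, ⟨10995, 410731, -5092, -8194, 3990⟩, ⟨11330, 393680, -5648, -8854, 3872⟩, ⟨8359,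
    378002, -6105, -6823, 3721⟩, ⟨7710, 364651, -6449, -6530, 3201⟩, ⟨5184, 353600, -6704, -4526,
    2876⟩, ⟨4356, 345192, -6878, -3892, 2426⟩, ⟨3215, 338384, -7008, -2926, 2685⟩, ⟨2452, 333202,
    -7099, -2263, 2254⟩, ⟨613, 330383, -7146, -570, 1533⟩], ⟨15728, 302507, -3753, 4584⟩⟩,
    ⟨63262, [⟨10738, 504022, -1172, -6961, 2054⟩, ⟨13909, 487753, -2086, -9290, 2638⟩, ⟨13744,
    468922, -3099, -9522, 3584⟩, ⟨13744, 449480, -4082, -9905, 3461⟩, ⟨13744, 429231, -5026,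
    -10332, 4608⟩, ⟨10995, 410284, -5829, -8604, 3481⟩, ⟨9731, 393787, -6457, -7889, 4029⟩, ⟨7690,
    379470, -6948, -6429, 4167⟩, ⟨7597, 366513, -7346, -6530, 3798⟩, ⟨5605, 355050, -7661, -4938,
    3653⟩, ⟨4136, 346414, -7874, -3712, 2726⟩, ⟨3814, 339235, -8036, -3475, 2471⟩, ⟨2565, 333407,
    -8157, -2366, 2685⟩, ⟨2155, 329040, -8241, -2007, 2389⟩, ⟨1988, 325171, -8311, -1866, 2216⟩,
    ⟨1119, 322256, -8362, -1057, 1809⟩], ⟨15728, 294456, -4359, 5289⟩⟩,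
    ⟨50926, [⟨8590, 503388, -949, -6152, 1428⟩, ⟨12502, 488068, -1628, -9158, 2060⟩, ⟨13245,
    468914, -2448, -9985, 2993⟩, ⟨13744, 448225, -3284, -10695, 2981⟩, ⟨13744, 426457, -4094,
    -11063, 3954⟩, ⟨10995, 406253, -4775, -9134, 2951⟩, ⟨9673, 388859, -5299, -8259, 3346⟩, ⟨9555,
    372228, -5742, -8374, 3009⟩, ⟨7050, 357536, -6085, -6322, 2795⟩, ⟨6503, 345273, -6335, -5945,
    2323⟩, ⟨5465, 334252, -6530, -5082, 2466⟩, ⟨4033, 325374, -6667, -3802, 1658⟩, ⟨3075, 318650,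
    -6759, -2929, 1760⟩, ⟨769, 314997, -6804, -737, 994⟩], ⟨15728, 286642, -3525, 3941⟩⟩,
    ⟨58565, [⟨8590, 501265, -1174, -6769, 1764⟩, ⟨10001, 486462, -1913, -8021, 2040⟩, ⟨12196,
    468439, -2785, -9989, 2426⟩, ⟨13744, 446903, -3774, -11536, 3655⟩, ⟨10995, 425907, -4667,
    -9447, 2761⟩, ⟨10995, 406809, -5407, -9645, 3591⟩, ⟨10267, 387972, -6061, -9190, 3062⟩, ⟨8114,
    371394, -6570, -7391, 3049⟩, ⟨6412, 358086, -6929, -5922, 3049⟩, ⟨6335, 346247, -7211, -5923,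
    2706⟩, ⟨4674, 335917, -7428, -4416, 2534⟩, ⟨4311, 327399, -7584, -4109, 2148⟩, ⟨2898, 320518,
    -7697, -2781, 1952⟩, ⟨3045, 314801, -7780, -2939, 1842⟩, ⟨1857, 310072, -7843, -1801, 1842⟩,
    ⟨1044, 307262, -7877, -1015, 1445⟩], ⟨15728, 279127, -4050, 4028⟩⟩,
    ⟨47145, [⟨8590, 499079, -1013, -7409, 1516⟩, ⟨10001, 482902, -1649, -8760, 1746⟩, ⟨12196,
    463266, -2396, -10869, 2888⟩, ⟨10995, 442423, -3148, -9965, 2494⟩, ⟨10995, 422339, -3819,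
    -10113, 2340⟩, ⟨10995, 401969, -4438, -10253, 3009⟩, ⟨10003, 382271, -4970, -9444, 2446⟩,
    ⟨7905, 365293, -5370, -7538, 2398⟩, ⟨7809, 350251, -5677, -7509, 2082⟩, ⟨5762, 337169, -5906,
    -5579, 1877⟩, ⟨5314, 326421, -6066, -5174, 1516⟩, ⟨4466, 316884, -6187, -4370, 1582⟩, ⟨4120,
    308472, -6277, -4048, 1284⟩, ⟨2317, 302146, -6334, -2284, 977⟩], ⟨15728, 271904, -3243,
    3240⟩⟩,
    ⟨37951, [⟨8590, 497205, -862, -7956, 1291⟩, ⟨10001, 479854, -1402, -9391, 1477⟩, ⟨12196,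
    458844, -2033, -11614, 2438⟩, ⟨10995, 436623, -2661, -10600, 2082⟩, ⟨10995, 415317, -3214,
    -10702, 1925⟩, ⟨10995, 393830, -3716, -10784, 2438⟩, ⟨9331, 373844, -4124, -9203, 1809⟩,
    ⟨9218, 355516, -4445, -9128, 2158⟩, ⟨6801, 339640, -4678, -6753, 1354⟩, ⟨6273, 326652, -4837,
    -6240, 1477⟩, ⟨5272, 315166, -4952, -5251, 1054⟩, ⟨4864, 305070, -5035, -4849, 1129⟩, ⟨2735,
    297497, -5085, -2729, 840⟩], ⟨15728, 266141, -2590, 2466⟩⟩,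
    ⟨30551, [⟨8590, 495619, -726, -8419, 1088⟩, ⟨10001, 477276, -1179, -9921, 1242⟩, ⟨12196,
    455114, -1705, -12237, 2034⟩, ⟨10995, 431747, -2225, -11126, 1722⟩, ⟨10995, 409438, -2677,
    -11181, 1579⟩, ⟨10995, 387049, -3080, -11207, 1952⟩, ⟨8794, 366878, -3393, -8965, 1353⟩,
    ⟨8687, 349071, -3627, -8844, 1582⟩, ⟨8013, 332090, -3810, -8140, 1206⟩, ⟨6734, 317131, -3939,
    -6823, 1148⟩, ⟨4969, 305289, -4018, -5022, 977⟩, ⟨4737, 295492, -4069, -4777, 765⟩], ⟨15728,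
    261548, -2068, 1995⟩⟩,
    ⟨35133, [⟨6872, 495808, -820, -7097, 1045⟩, ⟨9101, 479218, -1288, -9489, 1353⟩, ⟨8878, 460394,
    -1801, -9331, 1277⟩, ⟨10995, 439440, -2343, -11619, 2107⟩, ⟨10995, 416172, -2899, -11646,
    1925⟩, ⟨8796, 395218, -3348, -9307, 1382⟩, ⟨10074, 375289, -3723, -10623, 1946⟩, ⟨7961,
    356318, -4029, -8351, 1823⟩, ⟨7865, 339769, -4253, -8202, 1516⟩, ⟨5803, 325556, -4411, -6016,
    1301⟩, ⟨5352, 314026, -4515, -5518, 994⟩, ⟨4498, 303897, -4589, -4615, 977⟩, ⟨4150, 295047,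
    -4639, -4238, 765⟩, ⟨2334, 288437, -4668, -2375, 574⟩], ⟨15728, 257166, -2354, 1760⟩⟩,
    ⟨40403, [⟨6872, 493999, -991, -7543, 1256⟩, ⟨7280, 478402, -1489, -8049, 1305⟩, ⟨8267, 461162,
    -2024, -9187, 1434⟩, ⟨8796, 442170, -2586, -9800, 1452⟩, ⟨8796, 422574, -3128, -9793, 1889⟩,
    ⟨8796, 403024, -3623, -9755, 1717⟩, ⟨8796, 383578, -4063, -9691, 2137⟩, ⟨8215, 364919, -4431,
    -8971, 1712⟩, ⟨6837, 348556, -4706, -7396, 1705⟩, ⟨5690, 335064, -4898, -6101, 1206⟩, ⟨5919,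
    322679, -5046, -6290, 1472⟩, ⟨4678, 311467, -5156, -4928, 966⟩, ⟨4621, 301714, -5232, -4830,
    1094⟩, ⟨3409, 293352, -5283, -3538, 977⟩, ⟨3145, 286573, -5315, -3245, 735⟩, ⟨2114, 281159,
    -5334, -2171, 780⟩, ⟨1777, 277170, -5345, -1818, 709⟩, ⟨1639, 273681, -5351, -1672, 505⟩,
    ⟨922, 271071, -5355, -938, 505⟩], ⟨10486, 252109, -2671, 1259⟩⟩,
    ⟨22767, [⟨6872, 492428, -581, -7931, 742⟩, ⟨7280, 476042, -873, -8453, 766⟩, ⟨8267, 457957,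
    -1184, -9630, 1178⟩, ⟨8796, 438081, -1509, -10244, 1183⟩, ⟨8796, 417636, -1818, -10201, 1094⟩,
    ⟨8796, 397315, -2097, -10120, 1369⟩, ⟨8796, 377188, -2341, -10007, 1196⟩, ⟨7768, 358459,
    -2536, -8722, 898⟩, ⟨6465, 342573, -2675, -7165, 896⟩, ⟨6725, 328055, -2781, -7355, 765⟩,
    ⟨5315, 314964, -2858, -5738, 697⟩, ⟨5250, 303626, -2910, -5601, 574⟩, ⟨4842, 292921, -2948,
    -5105, 574⟩, ⟨4069, 283571, -2970, -4245, 427⟩, ⟨3003, 276219, -2982, -3107, 319⟩, ⟨2290,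
    270760, -2986, -2354, 256⟩, ⟨573, 267820, -2988, -587, 153⟩], ⟨10486, 247966, -1486, 717⟩⟩,
    ⟨6734, [⟨6872, 491671, -175, -8118, 468⟩, ⟨9101, 472739, -274, -10814, 840⟩, ⟨8878, 451357,
    -381, -10568, 786⟩, ⟨10995, 427747, -491, -13041, 1256⟩, ⟨10995, 401795, -600, -12911, 1102⟩,
    ⟨8796, 378699, -684, -10185, 791⟩, ⟨7848, 359557, -743, -8954, 669⟩, ⟨8164, 341437, -790,
    -9161, 697⟩, ⟨6452, 325158, -824, -7120, 354⟩, ⟨6373, 311112, -847, -6924, 333⟩, ⟨5878,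
    297901, -863, -6287, 282⟩, ⟨4940, 286406, -872, -5209, 216⟩, ⟨4558, 276451, -877, -4746, 182⟩,
    ⟨2563, 269066, -879, -2643, 76⟩], ⟨10486, 246049, -437, 524⟩⟩]

set_option maxRecDepth 100000 in
theorem checkAll_favourableSlabs :
    FavourableSlab.checkAll 1048576 favourableSlabs 2621441 = true := by
  decide +kernel

end

noncomputable section

open Real Set AffForm

section

variable {p r c : ℝ}

/-- On the curve `1 - 2 * c` is at least of the order of `r`. -/
theorem half_mul_le_one_sub_two_mul (hp : 1 ≤ p) (hr0 : 0 ≤ r) (hrc : r ≤ c) (hc0 : 0 < c)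
    (hc1 : c ≤ 1 / 2) (h : curveH p r c = 0) : 1 / 2 * r ≤ 1 - 2 * c := by
  have e1 : p * r * (1 - r) ^ (p - 1) ≤ 1 - (1 - r) ^ p := by
    have h1 : 0 < 1 - r := by linarith
    have h := one_add_mul_self_le_rpow_one_add (s := r / (1 - r))
      (by linarith [div_nonneg hr0 h1.le]) hp
    have e : 1 + r / (1 - r) = 1 / (1 - r) := by field_simp; ring
    rw [e, div_rpow zero_le_one h1.le, one_rpow, le_div_iff₀ (rpow_pos_of_pos h1 p)] at h
    have e2 : (1 + p * (r / (1 - r))) * (1 - r) ^ p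
        = (1 - r) ^ p + p * r * (1 - r) ^ (p - 1) := by
      rw [rpow_eq_mul_rpow_sub_one h1 p]; field_simp
    linarith
  have e2 : (1 - c) ^ p - c ^ p ≤ p * (1 - 2 * c) * (1 - c) ^ (p - 1) := by
    have h1 : 0 < 1 - c := by linarith
    have h := one_add_mul_self_le_rpow_one_add (s := (2 * c - 1) / (1 - c))
      (by rw [le_div_iff₀ h1]; linarith) hp
    have e : 1 + (2 * c - 1) / (1 - c) = c / (1 - c) := by field_simp; ring
    rw [e, div_rpow hc0.le h1.le, le_div_iff₀ (rpow_pos_of_pos h1 p)] at h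
    have e2 : (1 + p * ((2 * c - 1) / (1 - c))) * (1 - c) ^ p
        = (1 - c) ^ p - p * (1 - 2 * c) * (1 - c) ^ (p - 1) := by
      rw [rpow_eq_mul_rpow_sub_one h1 p]; field_simp; ring
    linarith
  have hU0 := one_sub_rpow_pos (by linarith : 0 < p) hr0 (by linarith : r < 1)
  have hU : 1 - r ^ p ≤ 1 := by linarith [rpow_nonneg hr0 p]
  have hV : 1 / 2 ≤ 1 - c ^ p := by
    have := rpow_le_rpow_of_exponent_ge hc0 (by linarith) hp
    rw [rpow_one] at this
    linarith
  have hC : 0 < (1 - c) ^ (p - 1) := rpow_pos_of_pos (by linarith) _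
  have hR : (1 - c) ^ (p - 1) ≤ (1 - r) ^ (p - 1) :=
    rpow_le_rpow (by linarith) (by linarith) (by linarith)
  unfold curveH at h
  have k1 : (1 - r ^ p) * ((1 - c) ^ p - c ^ p) ≤ p * (1 - 2 * c) * (1 - c) ^ (p - 1) :=
    (mul_le_mul_of_nonneg_left e2 hU0.le).trans
      (mul_le_of_le_one_left (mul_nonneg (mul_nonneg (by linarith) (by linarith)) hC.le) hU)
  have k2 : 1 / 2 * (p * r * (1 - c) ^ (p - 1)) ≤ (1 - c ^ p) * (1 - (1 - r) ^ p) := by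
    refine mul_le_mul hV (le_trans ?_ e1) (by positivity) (by linarith)
    gcongr
  have k3 : p * (1 - c) ^ (p - 1) * (1 / 2 * r) ≤ p * (1 - c) ^ (p - 1) * (1 - 2 * c) := by
    nlinarith
  exact le_of_mul_le_mul_left k3 (by positivity)

theorem le_rpow_add_rpow {q : ℝ} (hq : q ≤ 3 / 2) (hc0 : 0 < c) (hc1 : c < 1) :
    0.706 ≤ (1 - c) ^ q + c ^ q := by
  have key : ∀ x : ℝ, 0 < x → x < 1 → 3 / 2 * 0.707 * x - 0.707 ^ 3 / 2 ≤ x ^ q := by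
    intro x h0 h1
    have h2 := rpow_le_rpow_of_exponent_ge h0 h1.le hq
    have e : x ^ (3 / 2 : ℝ) = √x ^ 3 := by
      rw [sqrt_eq_rpow, ← rpow_natCast, ← rpow_mul h0.le]; norm_num
    have hs := sqrt_nonneg x
    have hx := mul_self_sqrt h0.le
    rw [e] at h2
    generalize √x = s at *
    subst hx
    nlinarith [mul_nonneg (sq_nonneg (s - 0.707)) (by linarith : 0 ≤ s + 0.707 / 2)]
  linarith [key (1 - c) (by linarith) (by linarith), key c hc0 hc1]

theorem mul_one_sub_two_mul_le (hp0 : 1 ≤ p) (hp : p ≤ 5 / 2) (hc0 : 0 < c) (hc1 : c ≤ 1 / 2) :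
    0.353 * p * (1 - 2 * c) ≤ (1 - c) ^ p - c ^ p := by
  have hd : ∀ x : ℝ, 0 < x → x < 1 → HasDerivAt
      (fun x : ℝ => (1 - x) ^ p - x ^ p - 0.353 * p * (1 - 2 * x))
      (-1 * p * (1 - x) ^ (p - 1) - p * x ^ (p - 1) - 0.353 * p * (-(2 * 1))) x := by
    intro x h0 h1
    exact ((((hasDerivAt_id' x).const_sub 1).rpow_const (Or.inl (by linarith))).sub
      (hasDerivAt_rpow_const (Or.inl h0.ne'))).sub
      ((((hasDerivAt_id' x).const_mul 2).const_sub 1).const_mul (0.353 * p))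
  have hanti : AntitoneOn (fun x : ℝ => (1 - x) ^ p - x ^ p - 0.353 * p * (1 - 2 * x))
      (Icc c (1 / 2)) := by
    refine antitoneOn_of_deriv_nonpos (convex_Icc _ _)
      (fun x hx => (hd x (by linarith [hx.1]) (by linarith [hx.2])).continuousAt.continuousWithinAt)
      (fun x hx => ?_) fun x hx => ?_
    · have hx := interior_subset hx
      exact (hd x (by linarith [hx.1]) (by linarith [hx.2])).differentiableAt.differentiableWithinAt
    · have hx := interior_subset hx
      rw [(hd x (by linarith [hx.1]) (by linarith [hx.2])).deriv]
      have := le_rpow_add_rpow (q := p - 1) (c := x) (by linarith) (by linarith [hx.1])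
        (by linarith [hx.2])
      nlinarith
  have := hanti ⟨le_rfl, hc1⟩ ⟨hc1, le_rfl⟩ hc1
  norm_num at this
  linarith

/-- On the curve `1 - 2 * c` is at most of the order of `r`. -/
theorem one_sub_two_mul_le_mul (hp0 : 1 ≤ p) (hp : p ≤ 5 / 2) (hr0 : 0 < r) (hr1 : r ≤ 0.0201)
    (hc0 : 0 < c) (hc1 : c ≤ 1 / 2) (h : curveH p r c = 0) : 1 - 2 * c ≤ 2.6 * r := by
  have h1 := mul_one_sub_two_mul_le hp0 hp hc0 hc1
  have h2 := one_sub_one_sub_rpow_le (r := r) hp0 (by linarith)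
  have hU : 0.9799 ≤ 1 - r ^ p := by
    have := rpow_le_rpow_of_exponent_ge hr0 (by linarith) hp0
    rw [rpow_one] at this
    linarith
  have hV0 := one_sub_rpow_pos (by linarith : 0 < p) hc0.le (by linarith : c < 1)
  have hV1 : 1 - c ^ p ≤ 1 := by linarith [rpow_nonneg hc0.le p]
  have h3 : 0.345 * (1 - 2 * c) ≤ (1 - c ^ p) * r := by
    unfold curveH at h
    have k1 := mul_le_mul hU h1 (by nlinarith) (by linarith)
    have k2 := mul_le_mul_of_nonneg_left h2 hV0.le
    have : p * (0.345 * (1 - 2 * c)) ≤ p * ((1 - c ^ p) * r) := by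
      nlinarith [mul_nonneg (by linarith : 0 ≤ p) (by linarith : 0 ≤ 1 - 2 * c)]
    exact le_of_mul_le_mul_left this (by linarith)
  have h4 : 0.47 ≤ c := by nlinarith
  have h5 : (0.103 : ℝ) ≤ c ^ p := by
    calc (0.103 : ℝ) ≤ 0.47 ^ 3 := by norm_num
      _ ≤ c ^ 3 := by gcongr
      _ = c ^ (3 : ℝ) := by norm_cast
      _ ≤ c ^ p := rpow_le_rpow_of_exponent_ge hc0 (by linarith) (by linarith)
  nlinarith

end

/-- The quotient `slopeE q r c / r` in variables that extend to `r = 0`. -/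
def cornerE (r c ρ γ R C d e : ℝ) : ℝ :=
  (1 - c * γ) * (R - ((1 - r) * C + γ * R) * ρ)
    - (1 - r * (r * ρ)) * ((1 - c) * (c * d + γ * e) - ρ * (γ * C))

theorem slopeE_eq_mul_cornerE {q r c ρ d e : ℝ} (hρ : r ^ q = r * ρ)
    (hd : c * (1 - c) ^ q - (1 - c) * c ^ q = r * ((1 - c) * c * d)) (he : 1 - (1 - r) ^ q = r * e) :
    slopeE q r c = r * cornerE r c ρ (c ^ q) ((1 - r) ^ q) ((1 - c) ^ q) d e := by
  rw [slopeE_eq, hρ]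
  unfold cornerE
  linear_combination (-1 + r * (r * ρ)) * hd - (1 - r * (r * ρ)) * (1 - c) * c ^ q * he

/-- Enclosure of `cornerE`. -/
def AffForm.cornerEF (r c ρ γ R C d e : AffForm) : AffForm :=
  (c * γ).compl * (R - (r.compl * C + γ * R) * ρ)
    - (r * (r * ρ)).compl * (c.compl * (c * d + γ * e) - ρ * (γ * C))

theorem AffForm.Encl.cornerEF {t : Noise} {r c ρ γ R C d e : ℝ}
    {fr fc fρ fγ fR fC fd fe : AffForm} (hr : fr.Encl t r) (hc : fc.Encl t c) (hρ : fρ.Encl t ρ)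
    (hγ : fγ.Encl t γ) (hR : fR.Encl t R) (hC : fC.Encl t C) (hd : fd.Encl t d) (he : fe.Encl t e) :
    (cornerEF fr fc fρ fγ fR fC fd fe).Encl t (cornerE r c ρ γ R C d e) := by
  unfold AffForm.cornerEF cornerE
  repeat' first | with_reducible assumption | with_reducible apply Encl.hMul | with_reducible apply Encl.hSub | with_reducible apply Encl.compl | with_reducible apply Encl.hAdd

/-- Decides `Favourable` for the points with `r = z ^ 2` and `1 - 2 * c = k r`. -/
def cornerFavourable (zc zr kc kr : ℤ) : Bool :=
  (grid zc zr 0 0).bind fun z => (grid kc 0 kr 0).bind fun k => (z * z).bind fun r =>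
  ((k * r).compl * const 1 2).bind fun c => r.compl.bind fun r' => c.compl.bind fun c' =>
  (r' * pow (const 1 2) r').bind fun R => (pow (const 1 2) c).bind fun s =>
  (pow (const 1 2) c').bind fun s' =>
  favourableOf
    (cornerEF r c z (c * s) R (c' * s') (k * pow (const (-1) 1) (s' + s))
      ((const 3 1 - const 3 1 * r + r * r) * pow (const (-1) 1) (const 1 1 + R)))
    (cornerEF r c r (c * c) (r' * r') (c' * c') k (const 2 1 - r)) (r' - c)

theorem cornerFavourable_sound {zc zr kc kr : ℤ} (h : cornerFavourable zc zr kc kr = true)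
    {z k : ℝ} (hz0 : 0 < z) (hz1 : z ^ 2 < 1 / 2) (hz : |z * gridScale - zc| ≤ zr) (hk0 : 0 ≤ k)
    (hc0 : 0 < (1 - k * z ^ 2) / 2) (hk : |k * gridScale - kc| ≤ kr) :
    Favourable (z ^ 2) ((1 - k * z ^ 2) / 2) := by
  obtain ⟨u, hu, hzu⟩ := exists_noise_coord hz
  obtain ⟨v, hv, hkv⟩ := exists_noise_coord hk
  set t : Noise := ⟨u, v, 0, hu, hv, by norm_num⟩
  simp only [cornerFavourable, bind_eq] at h
  have ez : (grid zc zr 0 0).Encl t z := by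
    convert encl_grid zc zr 0 0 using 1; rw [hzu]; simp only [t]; push_cast; ring
  have ek : (grid kc 0 kr 0).Encl t k := by
    convert encl_grid kc 0 kr 0 using 1; rw [hkv]; simp only [t]; push_cast; ring
  have er : (grid zc zr 0 0 * grid zc zr 0 0).Encl t (z ^ 2) := by
    rw [sq]; exact ez.hMul ez
  have ch : (const 1 2).Encl t (1 / 2) := encl_const' 1 two_pos (by norm_num)
  have cn : (const (-1) 1).Encl t (-1) := encl_const' (-1) one_pos (by norm_num)
  have c1 : (const 1 1).Encl t 1 := encl_const' 1 one_pos (by norm_num)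
  have c2 : (const 2 1).Encl t 2 := encl_const' 2 one_pos (by norm_num)
  have c3 : (const 3 1).Encl t 3 := encl_const' 3 one_pos (by norm_num)
  have ec : ((grid kc 0 kr 0 * (grid zc zr 0 0 * grid zc zr 0 0)).compl * const 1 2).Encl t
      ((1 - k * z ^ 2) / 2) := by
    rw [div_eq_mul_one_div]; exact (ek.hMul er).compl.hMul ch
  have hr0 : 0 < z ^ 2 := by positivity
  have hk' : z ^ 2 * k = 1 - 2 * ((1 - k * z ^ 2) / 2) := by ring
  have hc1 : (1 - k * z ^ 2) / 2 ≤ 1 / 2 := by nlinarith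
  generalize (grid kc 0 kr 0 * (grid zc zr 0 0 * grid zc zr 0 0)).compl * const 1 2 = fc at *
  generalize (1 - k * z ^ 2) / 2 = c at *
  generalize grid zc zr 0 0 * grid zc zr 0 0 = fr at *
  have hzz : (z ^ 2) ^ (3 / 2 : ℝ) = z ^ 2 * z := by
    rw [← rpow_natCast, ← rpow_mul hz0.le, show ((2 : ℕ) : ℝ) * (3 / 2) = (3 : ℕ) by norm_num,
      rpow_natCast, rpow_natCast]; ring
  generalize z ^ 2 = r at *
  have h32 : ∀ x : ℝ, 0 < x → x ^ (3 / 2 : ℝ) = x * x ^ (1 / 2 : ℝ) := fun x hx => by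
    rw [rpow_eq_mul_rpow_sub_one hx]; norm_num
  have hinv : ∀ {f : AffForm} {x : ℝ}, 0 < x → f.Encl t x →
      (AffForm.pow (const (-1) 1) f).Encl t x⁻¹ := fun hx hf => by
    rw [← rpow_neg_one]; exact hf.pow cn hx
  have hsq : ∀ x : ℝ, 0 < x → x ^ (1 / 2 : ℝ) * x ^ (1 / 2 : ℝ) = x := fun x hx => by
    rw [← rpow_add hx]; norm_num
  have hr' : 0 < 1 - r := by linarith
  have hc' : 0 < 1 - c := by linarith
  have es := ec.pow ch hc0
  have es' := ec.compl.pow ch hc'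
  have eR := er.compl.hMul (er.compl.pow ch hr')
  have ps := rpow_pos_of_pos hc0 (1 / 2)
  have ps' := rpow_pos_of_pos hc' (1 / 2)
  have pR : 0 < (1 - r) ^ (1 / 2 : ℝ) := rpow_pos_of_pos hr' _
  have g1 := Encl.cornerEF er ec ez (ec.hMul es) eR (ec.compl.hMul es')
    (ek.hMul (hinv (by positivity) (es'.hAdd es)))
    (((c3.hSub (c3.hMul er)).hAdd (er.hMul er)).hMul (hinv (by positivity) (c1.hAdd eR)))
  have g2 := Encl.cornerEF er ec er (ec.hMul ec) (er.compl.hMul er.compl)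
    (ec.compl.hMul ec.compl) ek (c2.hSub er)
  obtain ⟨f1, f2⟩ := favourableOf_sound g1 g2 (er.compl.hSub ec) (by linarith) h
  have s1 := slopeE_eq_mul_cornerE (q := 3 / 2) (r := r) (c := c) (ρ := z)
    (d := k * ((1 - c) ^ (1 / 2 : ℝ) + c ^ (1 / 2 : ℝ))⁻¹)
    (e := (3 - 3 * r + r * r) * (1 + (1 - r) * (1 - r) ^ (1 / 2 : ℝ))⁻¹) hzz
    (by
      rw [h32 c hc0, h32 (1 - c) hc']
      have a1 := hsq c hc0
      have a2 := hsq (1 - c) hc'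
      generalize c ^ (1 / 2 : ℝ) = s, (1 - c) ^ (1 / 2 : ℝ) = s' at *
      field_simp
      linear_combination a2 - a1 - hk')
    (by
      rw [h32 (1 - r) hr']
      have a1 := hsq (1 - r) hr'
      generalize (1 - r) ^ (1 / 2 : ℝ) = s at *
      field_simp
      linear_combination (-(1 - r) ^ 2) * a1)
  have s2 := slopeE_eq_mul_cornerE (q := 2) (r := r) (c := c) (ρ := r) (d := k) (e := 2 - r)
    (by rw [rpow_two, sq]) (by simp only [rpow_two]; linear_combination (-(1 - c) * c) * hk')
    (by rw [rpow_two]; ring)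
  rw [← h32 c hc0, ← h32 (1 - c) hc', ← h32 (1 - r) hr'] at f1 f2
  simp only [← sq, ← rpow_two] at f2
  constructor
  · rw [s1, ← h32 (1 - r) hr']; exact mul_pos hr0 f1
  · rw [s1, s2, ← h32 (1 - r) hr']
    simp only [← sq, ← rpow_two] 
    nlinarith

end

noncomputable section

open Real Set AffForm

theorem favourable_corner {z k : ℝ} (hz0 : 0 < z) (hz : z * gridScale ≤ 148372) (hk0 : 1 / 2 ≤ k)
    (hk : k ≤ 2.6) : Favourable (z ^ 2) ((1 - k * z ^ 2) / 2) := by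
  have hG : (gridScale : ℝ) = 1048576 := by norm_num
  have hz1 : z ≤ 0.15 := by rw [hG] at hz; linarith
  have hz2 : z ^ 2 < 1 / 2 := by nlinarith
  have hc : 0 < (1 - k * z ^ 2) / 2 := by nlinarith
  have of_box : ∀ zc zr kc kr : ℤ, cornerFavourable zc zr kc kr = true →
      |z * gridScale - zc| ≤ zr → |k * gridScale - kc| ≤ kr →
      Favourable (z ^ 2) ((1 - k * z ^ 2) / 2) := fun _ _ _ _ h h1 h2 =>
    cornerFavourable_sound h hz0 hz2 h1 (by linarith) hc h2
  rw [hG] at hz of_box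
  by_cases h1 : k * 1048576 ≤ 1625292
  · refine of_box 74186 74186 1074790 550502 (by decide +kernel) ?_ ?_ <;>
      push_cast <;> rw [abs_le] <;> constructor <;> linarith
  by_cases h2 : k * 1048576 ≤ 2175796
  · refine of_box 74186 74186 1900544 275252 (by decide +kernel) ?_ ?_ <;>
      push_cast <;> rw [abs_le] <;> constructor <;> linarith
  by_cases h3 : z * 1048576 ≤ 74186
  · refine of_box 37093 37093 2451047 275251 (by decide +kernel) ?_ ?_ <;>
      push_cast <;> rw [abs_le] <;> constructor <;> linarith
  · refine of_box 111279 37093 2451047 275251 (by decide +kernel) ?_ ?_ <;>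
      push_cast <;> rw [abs_le] <;> constructor <;> linarith

/-- For exponents up to `5 / 2` all points of the curve are favourable. -/
theorem favourable_curveC {p r : ℝ} (hp0 : 1 < p) (hp : p ≤ 5 / 2) (hr0 : 0 < r)
    (hr : r < curveTau p) : Favourable r (curveC p r) := by
  have hG : (gridScale : ℝ) = 1048576 := by norm_num
  have hp1 : 0 < p := by linarith
  by_cases h : 20972 < r * gridScale
  · refine FavourableSlab.checkAll_sound hp0 h hr checkAll_favourableSlabs ?_ ?_ <;>
      rw [hG] <;> push_cast <;> linarith
  have hτ := curveTau_lt_half hp1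
  have hm : r ∈ Icc (0 : ℝ) (1 / 2) := ⟨hr0.le, by linarith⟩
  have hc0 := curveC_pos hp1 hr0.le (by linarith)
  have hc1 := (curveC_mem hp1 hm).1.2
  have hH := curveH_curveC hp1 hm
  have k1 := half_mul_le_one_sub_two_mul hp0.le hr0.le
    (lt_curveC_of_lt_curveTau hp1 hr0.le hr).le hc0 hc1 hH
  rw [hG] at h
  have k2 := one_sub_two_mul_le_mul hp0.le hp hr0 (by linarith) hc0 hc1 hH
  generalize curveC p r = c at *
  have e : √r ^ 2 = r := sq_sqrt hr0.le
  have := favourable_corner (z := √r) (k := (1 - 2 * c) / r) (sqrt_pos.2 hr0) ?_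
    (by rw [le_div_iff₀ hr0]; exact k1) (by rw [div_le_iff₀ hr0]; exact k2)
  · rw [e] at this
    convert this using 1
    field_simp
    ring
  · have : √r ≤ 0.14145 := by
      rw [sqrt_le_left (by norm_num)]; norm_num; linarith
    rw [hG]; linarith

end

noncomputable section

open Real Set

section VariationDiminishing

variable {a : ℝ} {k : ℝ → ℝ}

theorem continuousOn_rpow_mul (ha : 0 < a) (hk : ContinuousOn k (Icc a 1)) (p : ℝ) :
    ContinuousOn (fun s => s ^ p * k s) (Icc a 1) :=
  (continuousOn_id.rpow_const fun _ hs => Or.inl (by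
    simpa using (ha.trans_le hs.1).ne')).mul hk

theorem intervalIntegrable_rpow_mul (ha : 0 < a) (ha1 : a ≤ 1) (hk : ContinuousOn k (Icc a 1))
    (p : ℝ) : IntervalIntegrable (fun s => s ^ p * k s) MeasureTheory.volume a 1 :=
  (continuousOn_rpow_mul ha hk p).intervalIntegrable_of_Icc ha1

theorem continuousOn_log_mul (ha : 0 < a) (hk : ContinuousOn k (Icc a 1)) :
    ContinuousOn (fun s => log s * k s) (Icc a 1) :=
  (continuousOn_id.log fun _ hs => (ha.trans_le hs.1).ne').mul hk

theorem hasDerivAt_integral_rpow_mul (ha : 0 < a) (ha1 : a ≤ 1) (hk : ContinuousOn k (Icc a 1))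
    (p : ℝ) : HasDerivAt (fun p => ∫ s in a..1, s ^ p * k s)
      (∫ s in a..1, s ^ p * (log s * k s)) p := by
  have hlog := continuousOn_log_mul ha hk
  have hbd := (continuousOn_rpow_mul ha hlog (p - 1)).norm
  refine (intervalIntegral.hasDerivAt_integral_of_dominated_loc_of_deriv_le
    (F := fun p s => s ^ p * k s) (F' := fun p s => s ^ p * (log s * k s))
    (bound := fun s => ‖s ^ (p - 1) * (log s * k s)‖) (Metric.ball_mem_nhds p one_pos) ?_
    (intervalIntegrable_rpow_mul ha ha1 hk p) ?_ ?_ (hbd.intervalIntegrable_of_Icc ha1) ?_).2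
  · exact Filter.Eventually.of_forall fun x => by
      rw [uIoc_of_le ha1]
      exact ((continuousOn_rpow_mul ha hk x).mono Ioc_subset_Icc_self).aestronglyMeasurable
        measurableSet_Ioc
  · rw [uIoc_of_le ha1]
    exact ((continuousOn_rpow_mul ha hlog p).mono Ioc_subset_Icc_self).aestronglyMeasurable
      measurableSet_Ioc
  · refine Filter.Eventually.of_forall fun s hs x hx => ?_
    rw [uIoc_of_le ha1] at hs
    have hs0 : 0 < s := ha.trans hs.1
    rw [norm_mul, norm_mul (s ^ (p - 1))]
    refine mul_le_mul_of_nonneg_right ?_ (norm_nonneg _)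
    rw [norm_of_nonneg (rpow_nonneg hs0.le _), norm_of_nonneg (rpow_nonneg hs0.le _)]
    have := abs_lt.mp (by simpa [dist_eq] using hx : |x - p| < 1)
    exact rpow_le_rpow_of_exponent_ge hs0 hs.2 (by linarith)
  · refine Filter.Eventually.of_forall fun s hs x hx => ?_
    rw [uIoc_of_le ha1] at hs
    have := (hasStrictDerivAt_const_rpow (ha.trans hs.1) x).hasDerivAt.mul_const (k s)
    rwa [mul_assoc] at this

/-- Two points may be interpolated by a positive combination of two powers, on either side of the
given exponent. -/
theorem exists_rpow_interpolation {y₁ y₂ p₁ p p₂ : ℝ} (hy₁ : 0 < y₁) (hy : y₁ < y₂) (h₁ : p₁ < p)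
    (h₂ : p < p₂) : ∃ l m : ℝ, 0 < l ∧ 0 < m ∧ ∀ s, 0 < s →
      (s ≤ y₁ → s ^ p ≤ l * s ^ p₁ + m * s ^ p₂) ∧
      (y₁ ≤ s → s ≤ y₂ → l * s ^ p₁ + m * s ^ p₂ ≤ s ^ p) ∧
      (y₂ ≤ s → s ^ p ≤ l * s ^ p₁ + m * s ^ p₂) := by
  have hy₂ := hy₁.trans hy
  have e1 : y₁ ^ (p₂ - p) < y₂ ^ (p₂ - p) := rpow_lt_rpow hy₁.le hy (by linarith)
  have e2 : y₂ ^ (p₁ - p) < y₁ ^ (p₁ - p) := rpow_lt_rpow_of_neg hy₁ hy (by linarith)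
  have a1 := rpow_pos_of_pos hy₁ (p₂ - p)
  have a2 := rpow_pos_of_pos hy₂ (p₁ - p)
  have hD : 0 < y₁ ^ (p₁ - p) * y₂ ^ (p₂ - p) - y₂ ^ (p₁ - p) * y₁ ^ (p₂ - p) := by nlinarith
  set D := y₁ ^ (p₁ - p) * y₂ ^ (p₂ - p) - y₂ ^ (p₁ - p) * y₁ ^ (p₂ - p) with hDdef
  refine ⟨(y₂ ^ (p₂ - p) - y₁ ^ (p₂ - p)) / D, (y₁ ^ (p₁ - p) - y₂ ^ (p₁ - p)) / D,
    div_pos (by linarith) hD, div_pos (by linarith) hD, ?_⟩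
  set l := (y₂ ^ (p₂ - p) - y₁ ^ (p₂ - p)) / D with hl
  set m := (y₁ ^ (p₁ - p) - y₂ ^ (p₁ - p)) / D with hm
  have hl0 : 0 < l := div_pos (by linarith) hD
  have hm0 : 0 < m := div_pos (by linarith) hD
  have v1 : l * y₁ ^ (p₁ - p) + m * y₁ ^ (p₂ - p) = 1 := by
    rw [hl, hm]; field_simp; rw [hDdef]; ring
  have v2 : l * y₂ ^ (p₁ - p) + m * y₂ ^ (p₂ - p) = 1 := by
    rw [hl, hm]; field_simp; rw [hDdef]; ring
  set ψ : ℝ → ℝ := fun x => l * exp (x * (p₁ - p)) + m * exp (x * (p₂ - p)) with hψ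
  have hexp : ∀ b : ℝ, ConvexOn ℝ univ fun x => exp (x * b) := fun b =>
    convexOn_exp.comp_linearMap (LinearMap.mulRight ℝ b)
  have hconv : ConvexOn ℝ univ ψ := ((hexp _).smul hl0.le).add ((hexp _).smul hm0.le)
  have hψs : ∀ s, 0 < s → ψ (log s) = l * s ^ (p₁ - p) + m * s ^ (p₂ - p) := fun s hs => by
    simp only [hψ, rpow_def_of_pos hs]
  have hmul : ∀ s, 0 < s → l * s ^ p₁ + m * s ^ p₂ = s ^ p * ψ (log s) := fun s hs => by
    rw [hψs s hs, mul_add, mul_left_comm, mul_left_comm (s ^ p), ← rpow_add hs, ← rpow_add hs]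
    ring_nf
  have w1 : ψ (log y₁) = 1 := by rw [hψs y₁ hy₁, v1]
  have w2 : ψ (log y₂) = 1 := by rw [hψs y₂ hy₂, v2]
  have hlog := log_lt_log hy₁ hy
  intro s hs
  have hsp := rpow_pos_of_pos hs p
  rw [hmul s hs]
  refine ⟨fun h => le_mul_of_one_le_right hsp.le ?_, fun h h' => mul_le_of_le_one_right hsp.le ?_,
    fun h => le_mul_of_one_le_right hsp.le ?_⟩
  · rcases h.eq_or_lt with rfl | h
    · exact w1.ge
    · have := hconv.slope_mono_adjacent (mem_univ (log s)) (mem_univ (log y₂))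
        (log_lt_log hs h) hlog
      rw [w1, w2, sub_self, zero_div, div_le_iff₀ (by linarith [log_lt_log hs h])] at this
      linarith
  · have hseg : log s ∈ segment ℝ (log y₁) (log y₂) := by
      rw [segment_eq_Icc hlog.le]
      exact ⟨log_le_log hy₁ h, log_le_log hs h'⟩
    have := hconv.le_on_segment (mem_univ _) (mem_univ _) hseg
    rwa [w1, w2, max_self] at this
  · rcases h.eq_or_lt with rfl | h
    · exact w2.ge
    · have := hconv.slope_mono_adjacent (mem_univ (log y₁)) (mem_univ (log s)) hlog
        (log_lt_log hy₂ h)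
      rw [w1, w2, sub_self, zero_div, le_div_iff₀ (by linarith [log_lt_log hy₂ h])] at this
      linarith

/-- If `k` changes sign at most twice, from positive to negative and back, then the exponents for
which the moment of `k` is negative form an interval. -/
theorem integral_rpow_mul_nonpos (ha : 0 < a) (ha1 : a ≤ 1) (hk : ContinuousOn k (Icc a 1))
    {y₁ y₂ p₁ p p₂ : ℝ} (hy₁ : 0 < y₁) (hy : y₁ ≤ y₂) (h₁ : p₁ < p) (h₂ : p < p₂)
    (hsign : ∀ s ∈ Icc a 1, (s ≤ y₁ → 0 ≤ k s) ∧ (y₁ ≤ s → s ≤ y₂ → k s ≤ 0) ∧ (y₂ ≤ s → 0 ≤ k s))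
    (hn₁ : ∫ s in a..1, s ^ p₁ * k s < 0) (hn₂ : ∫ s in a..1, s ^ p₂ * k s < 0) :
    ∫ s in a..1, s ^ p * k s ≤ 0 := by
  rcases hy.eq_or_lt with rfl | hy
  · refine absurd hn₁ (not_lt.2 (intervalIntegral.integral_nonneg ha1 fun s hs => ?_))
    refine mul_nonneg (rpow_nonneg (ha.le.trans hs.1) _) ?_
    rcases le_total s y₁ with h | h
    · exact (hsign s hs).1 h
    · exact (hsign s hs).2.2 h
  obtain ⟨l, m, hl, hm, hlm⟩ := exists_rpow_interpolation hy₁ hy h₁ h₂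
  have i1 := intervalIntegrable_rpow_mul ha ha1 hk p₁
  have i2 := intervalIntegrable_rpow_mul ha ha1 hk p₂
  have key : ∫ s in a..1, s ^ p * k s ≤
      ∫ s in a..1, (l * (s ^ p₁ * k s) + m * (s ^ p₂ * k s)) := by
    refine intervalIntegral.integral_mono_on ha1 (intervalIntegrable_rpow_mul ha ha1 hk p)
      ((i1.const_mul l).add (i2.const_mul m)) fun s hs => ?_
    obtain ⟨h1, h2, h3⟩ := hlm s (ha.trans_le hs.1)
    obtain ⟨g1, g2, g3⟩ := hsign s hs
    rcases le_total s y₁ with h | h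
    · nlinarith [h1 h, g1 h]
    rcases le_total s y₂ with h' | h'
    · nlinarith [h2 h h', g2 h h']
    · nlinarith [h3 h', g3 h']
  rw [intervalIntegral.integral_add (i1.const_mul l) (i2.const_mul m),
    intervalIntegral.integral_const_mul, intervalIntegral.integral_const_mul] at key
  nlinarith

/-- If `k s * log (s / z)` has the sign pattern `+, -, +`, then the moments of `k` are nonnegative
between a zero and an exponent after which they decrease relative to the powers of `z`. -/
theorem integral_rpow_mul_nonneg (ha : 0 < a) (ha1 : a ≤ 1) (hk : ContinuousOn k (Icc a 1))
    {y₁ y₂ z p₀ p₁ p₂ p : ℝ} (hy₁ : 0 < y₁) (hy : y₁ ≤ y₂) (hz : 0 < z) (h₁ : p₁ < p₂)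
    (hp₀ : p₀ < p) (hp₁ : p ≤ p₁)
    (hsign : ∀ s ∈ Icc a 1, (s ≤ y₁ → 0 ≤ (log s - log z) * k s) ∧
      (y₁ ≤ s → s ≤ y₂ → (log s - log z) * k s ≤ 0) ∧ (y₂ ≤ s → 0 ≤ (log s - log z) * k s))
    (h0 : ∫ s in a..1, s ^ p₀ * k s = 0) (hn₁ : 0 ≤ ∫ s in a..1, s ^ p₁ * k s)
    (hn₂ : ∫ s in a..1, s ^ p₂ * k s < (∫ s in a..1, s ^ p₁ * k s) * z ^ (p₂ - p₁)) :
    0 ≤ ∫ s in a..1, s ^ p * k s := by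
  by_contra! hneg
  have hlog := continuousOn_log_mul ha hk
  set J : ℝ → ℝ := fun p => ∫ s in a..1, s ^ p * k s with hJ
  have hK : ContinuousOn (fun s => (log s - log z) * k s) (Icc a 1) :=
    ((continuousOn_id.log fun _ hs => (ha.trans_le hs.1).ne').sub continuousOn_const).mul hk
  set I : ℝ → ℝ := fun p => ∫ s in a..1, s ^ p * ((log s - log z) * k s) with hI
  have hd : ∀ x, HasDerivAt (fun x => J x * z ^ (-x)) (z ^ (-x) * I x) x := by
    intro x
    have h2 : HasDerivAt (fun x : ℝ => z ^ (-x)) (z ^ (-x) * log z * -1) x :=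
      (hasStrictDerivAt_const_rpow hz (-x)).hasDerivAt.comp x (hasDerivAt_neg x)
    have : I x = (∫ s in a..1, s ^ x * (log s * k s)) - log z * J x := by
      simp only [hI, hJ]
      rw [← intervalIntegral.integral_const_mul, ← intervalIntegral.integral_sub
        (intervalIntegrable_rpow_mul ha ha1 hlog x)
        ((intervalIntegrable_rpow_mul ha ha1 hk x).const_mul _)]
      refine intervalIntegral.integral_congr fun s _ => ?_
      ring
    refine ((hasDerivAt_integral_rpow_mul ha ha1 hk x).mul h2).congr_deriv ?_
    rw [this]; ring
  have mvt : ∀ u v : ℝ, u < v → ∃ x ∈ Ioo u v,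
      z ^ (-x) * I x = (J v * z ^ (-v) - J u * z ^ (-u)) / (v - u) := fun u v huv =>
    exists_hasDerivAt_eq_slope _ _ huv (fun x _ => (hd x).continuousAt.continuousWithinAt)
      fun x _ => hd x
  have zpos : ∀ x : ℝ, 0 < z ^ (-x) := fun x => rpow_pos_of_pos hz _
  have hp₁' : p < p₁ := hp₁.lt_of_ne (by rintro rfl; exact absurd hneg (not_lt.2 hn₁))
  obtain ⟨x₁, hx₁, e₁⟩ := mvt p₀ p hp₀
  obtain ⟨x₂, hx₂, e₂⟩ := mvt p p₁ hp₁'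
  obtain ⟨x₃, hx₃, e₃⟩ := mvt p₁ p₂ h₁
  have n₁ : I x₁ < 0 := by
    have : z ^ (-x₁) * I x₁ < 0 := by
      rw [e₁]
      refine div_neg_of_neg_of_pos ?_ (by linarith)
      have : J p₀ = 0 := h0
      rw [this]
      nlinarith [zpos p, (show J p < 0 from hneg)]
    exact neg_of_mul_neg_right this (zpos _).le
  have n₂ : 0 < I x₂ := by
    have : 0 < z ^ (-x₂) * I x₂ := by
      rw [e₂]
      refine div_pos ?_ (by linarith)
      have h3 : J p < 0 := hneg
      have h4 : 0 ≤ J p₁ := hn₁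
      nlinarith [zpos p, zpos p₁, mul_nonneg h4 (zpos p₁).le]
    exact pos_of_mul_pos_right this (zpos _).le
  have n₃ : I x₃ < 0 := by
    have : z ^ (-x₃) * I x₃ < 0 := by
      rw [e₃]
      refine div_neg_of_neg_of_pos ?_ (by linarith)
      have h3 : J p₂ < J p₁ * z ^ (p₂ - p₁) := hn₂
      have h4 := mul_lt_mul_of_pos_right h3 (zpos p₂)
      rw [mul_assoc, ← rpow_add hz, show p₂ - p₁ + -p₂ = -p₁ by ring] at h4
      linarith
    exact neg_of_mul_neg_right this (zpos _).le
  have := integral_rpow_mul_nonpos ha ha1 hK hy₁ hy (hx₁.2.trans hx₂.1) (hx₂.2.trans hx₃.1) hsign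
    n₁ n₃
  exact absurd n₂ (not_lt.2 this)

end VariationDiminishing

end

noncomputable section

open Real Set

theorem integral_rpow_mul_max {a β e : ℝ} (ha : 0 < a) (hβ : a ≤ β) (hβ1 : β ≤ 1) (h1 : e + 1 ≠ 0)
    (h2 : e + 2 ≠ 0) : ∫ s in a..1, s ^ e * max (s - β) 0 =
      1 / (e + 2) - β / (e + 1) + β ^ (e + 2) / ((e + 1) * (e + 2)) := by
  have hβ0 : 0 < β := ha.trans_le hβ
  have hc : ContinuousOn (fun s : ℝ => s ^ e * max (s - β) 0) (Icc a 1) :=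
    continuousOn_rpow_mul ha (by fun_prop) e
  have i1 : IntervalIntegrable (fun s : ℝ => s ^ e * max (s - β) 0) MeasureTheory.volume a β :=
    (hc.mono (Icc_subset_Icc le_rfl hβ1)).intervalIntegrable_of_Icc hβ
  have i2 : IntervalIntegrable (fun s : ℝ => s ^ e * max (s - β) 0) MeasureTheory.volume β 1 :=
    (hc.mono (Icc_subset_Icc hβ le_rfl)).intervalIntegrable_of_Icc hβ1
  have z1 : ∫ s in a..β, s ^ e * max (s - β) 0 = 0 := by
    refine (intervalIntegral.integral_congr (g := fun _ => 0) fun s hs => ?_).trans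
      intervalIntegral.integral_zero
    rw [uIcc_of_le hβ] at hs
    beta_reduce
    rw [max_eq_right (by linarith [hs.2]), mul_zero]
  have z2 : ∫ s in β..1, s ^ e * max (s - β) 0 = ∫ s in β..1, (s ^ (e + 1) - β * s ^ e) := by
    refine intervalIntegral.integral_congr fun s hs => ?_
    rw [uIcc_of_le hβ1] at hs
    rw [max_eq_left (by linarith [hs.1]), rpow_add (hβ0.trans_le hs.1), rpow_one]
    ring
  have n0 : (0 : ℝ) ∉ uIcc β 1 := by
    rw [uIcc_of_le hβ1]
    exact fun h => absurd h.1 (not_le.2 hβ0)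
  have hj : ∀ x : ℝ, IntervalIntegrable (fun s : ℝ => s ^ x) MeasureTheory.volume β 1 := fun x =>
    intervalIntegral.intervalIntegrable_rpow (Or.inr n0)
  rw [← intervalIntegral.integral_add_adjacent_intervals i1 i2, z1, z2,
    intervalIntegral.integral_sub (hj _) ((hj _).const_mul _),
    intervalIntegral.integral_const_mul,
    integral_rpow (Or.inr ⟨fun h => h2 (by linarith), n0⟩),
    integral_rpow (Or.inr ⟨fun h => h1 (by linarith), n0⟩), one_rpow, one_rpow,
    show e + 1 + 1 = e + 2 by ring, show e + 2 = 1 + (e + 1) by ring, rpow_add hβ0, rpow_one]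
  have h2' : 1 + (e + 1) ≠ 0 := by rwa [show 1 + (e + 1) = e + 2 by ring]
  field_simp
  ring

/-- The piecewise linear function whose moments are the values of `slopeE`. -/
def slopeKernel (r c s : ℝ) : ℝ :=
  r * max (s - (1 - r)) 0 - c * max (s - (1 - c)) 0 + (1 - c - r * c) * max (s - c * (1 - r)) 0
    - (1 - r - r * c) * max (s - r * (1 - c)) 0 - (1 + r - r * c) * max (s - r * c * (1 - r)) 0
    + (1 + c - r * c) * max (s - r * c * (1 - c)) 0 + c * max (s - r * c ^ 2 * (1 - r)) 0
    - r * max (s - r ^ 2 * c * (1 - c)) 0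

theorem continuous_slopeKernel (r c : ℝ) : Continuous (slopeKernel r c) := by
  unfold slopeKernel
  fun_prop

variable {r c s : ℝ}

theorem slopeKernel_knots (hr : 0 < r) (hrc : r < c) (hc : c ≤ 1 / 2) :
    0 < r ^ 2 * c * (1 - c) ∧ r ^ 2 * c * (1 - c) ≤ r * c ^ 2 * (1 - r) ∧
      r * c ^ 2 * (1 - r) ≤ r * c * (1 - c) ∧ r * c * (1 - c) ≤ r * c * (1 - r) ∧
      r * c * (1 - r) ≤ r * (1 - c) ∧ r * (1 - c) < c * (1 - r) ∧ c * (1 - r) ≤ 1 - c ∧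
      1 - c ≤ 1 - r ∧ 1 - r ≤ 1 := by
  have hc0 := hr.trans hrc
  have hrc0 := mul_pos hr hc0
  have h1 : c * (1 - r) ≤ 1 - c := by nlinarith
  refine ⟨mul_pos (by positivity) (by linarith), ?_, ?_, ?_, ?_, ?_, h1, by linarith, by linarith⟩
  · have : r * (1 - c) ≤ c * (1 - r) := by linarith
    nlinarith [mul_le_mul_of_nonneg_left this hrc0.le]
  · nlinarith [mul_le_mul_of_nonneg_left h1 hrc0.le]
  · exact mul_le_mul_of_nonneg_left (by linarith) hrc0.le
  · nlinarith [mul_le_mul_of_nonneg_left h1 hr.le]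
  · linarith

theorem integral_rpow_mul_slopeKernel (hr : 0 < r) (hrc : r < c) (hc : c ≤ 1 / 2) {e : ℝ}
    (h1 : e + 1 ≠ 0) (h2 : e + 2 ≠ 0) :
    ∫ s in r ^ 2 * c * (1 - c)..1, s ^ e * slopeKernel r c s =
      slopeE (e + 2) r c / ((e + 1) * (e + 2)) := by
  obtain ⟨k0, k1, k2, k3, k4, k5, k6, k7, k8⟩ := slopeKernel_knots hr hrc hc
  have hc0 := hr.trans hrc
  set a := r ^ 2 * c * (1 - c) with ha
  have hi : ∀ β : ℝ, IntervalIntegrable (fun s : ℝ => s ^ e * max (s - β) 0)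
      MeasureTheory.volume a 1 := fun β =>
    intervalIntegrable_rpow_mul k0 (by linarith) (by fun_prop) e
  have key : ∫ s in a..1, s ^ e * slopeKernel r c s = ∫ s in a..1,
      (r * (s ^ e * max (s - (1 - r)) 0) - c * (s ^ e * max (s - (1 - c)) 0)
      + (1 - c - r * c) * (s ^ e * max (s - c * (1 - r)) 0)
      - (1 - r - r * c) * (s ^ e * max (s - r * (1 - c)) 0)
      - (1 + r - r * c) * (s ^ e * max (s - r * c * (1 - r)) 0)
      + (1 + c - r * c) * (s ^ e * max (s - r * c * (1 - c)) 0)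
      + c * (s ^ e * max (s - r * c ^ 2 * (1 - r)) 0) - r * (s ^ e * max (s - a) 0)) := by
    congr 1
    funext s
    unfold slopeKernel
    ring
  have g1 := (hi (1 - r)).const_mul r
  have g2 := g1.sub ((hi (1 - c)).const_mul c)
  have g3 := g2.add ((hi (c * (1 - r))).const_mul (1 - c - r * c))
  have g4 := g3.sub ((hi (r * (1 - c))).const_mul (1 - r - r * c))
  have g5 := g4.sub ((hi (r * c * (1 - r))).const_mul (1 + r - r * c))
  have g6 := g5.add ((hi (r * c * (1 - c))).const_mul (1 + c - r * c))
  have g7 := g6.add ((hi (r * c ^ 2 * (1 - r))).const_mul c)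
  rw [key, intervalIntegral.integral_sub g7 ((hi a).const_mul r),
    intervalIntegral.integral_add g6 ((hi _).const_mul _),
    intervalIntegral.integral_add g5 ((hi _).const_mul _),
    intervalIntegral.integral_sub g4 ((hi _).const_mul _),
    intervalIntegral.integral_sub g3 ((hi _).const_mul _),
    intervalIntegral.integral_add g2 ((hi _).const_mul _),
    intervalIntegral.integral_sub g1 ((hi _).const_mul _)]
  simp only [intervalIntegral.integral_const_mul]
  rw [integral_rpow_mul_max k0 (by linarith) (by linarith) h1 h2,
    integral_rpow_mul_max k0 (by linarith) (by linarith) h1 h2,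
    integral_rpow_mul_max k0 (by linarith) (by linarith) h1 h2,
    integral_rpow_mul_max k0 (by linarith) (by linarith) h1 h2,
    integral_rpow_mul_max k0 (by linarith) (by linarith) h1 h2,
    integral_rpow_mul_max k0 (by linarith) (by linarith) h1 h2,
    integral_rpow_mul_max k0 (by linarith) (by linarith) h1 h2,
    integral_rpow_mul_max k0 le_rfl (by linarith) h1 h2, slopeE_eq, ha]
  have hr' : 0 ≤ 1 - r := by linarith
  have hc' : 0 ≤ 1 - c := by linarith
  have m : ∀ {x y : ℝ}, 0 ≤ x → 0 ≤ y → (x * y) ^ (e + 2) = x ^ (e + 2) * y ^ (e + 2) :=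
    fun hx hy => mul_rpow hx hy
  rw [m (by positivity) hr', m (by positivity) hc', m (by positivity) hr', m (by positivity) hc',
    m (by positivity) hr', m (by positivity) hc', m (by positivity) (by positivity),
    m (by positivity) (by positivity), m (by positivity) (by positivity), sq, sq,
    m (by positivity) (by positivity), m (by positivity) (by positivity)]
  field_simp
  ring

/-- The lower half of the sign pattern of `slopeKernel`. -/
theorem exists_slopeKernel_sign_low (hr : 0 < r) (hrc : r < c) (hc : c ≤ 1 / 2) :
    ∃ z, 0 < z ∧ z ≤ r * (1 - c) ∧ (∀ s, s ≤ z → slopeKernel r c s ≤ 0) ∧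
      ∀ s, z ≤ s → s ≤ r * (1 - c) → 0 ≤ slopeKernel r c s := by
  obtain ⟨k0, k1, k2, k3, k4, k5, k6, k7, -⟩ := slopeKernel_knots hr hrc hc
  have hc0 := hr.trans hrc
  have hrc0 := mul_pos hr hc0
  have d0 : 0 < c - r := by linarith
  have hcoef : 0 < 1 + c - r * c := by nlinarith
  have P0 : ∀ s, s ≤ r ^ 2 * c * (1 - c) → slopeKernel r c s ≤ 0 := fun s hs => by
    unfold slopeKernel
    rw [max_eq_right (by linarith : s - (1 - r) ≤ 0),
      max_eq_right (by linarith : s - (1 - c) ≤ 0),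
      max_eq_right (by linarith : s - c * (1 - r) ≤ 0),
      max_eq_right (by linarith : s - r * (1 - c) ≤ 0),
      max_eq_right (by linarith : s - r * c * (1 - r) ≤ 0),
      max_eq_right (by linarith : s - r * c * (1 - c) ≤ 0),
      max_eq_right (by linarith : s - r * c ^ 2 * (1 - r) ≤ 0),
      max_eq_right (by linarith : s - r ^ 2 * c * (1 - c) ≤ 0)]
    simp
  have P1 : ∀ s, r ^ 2 * c * (1 - c) ≤ s → s ≤ r * c ^ 2 * (1 - r) → slopeKernel r c s ≤ 0 :=
    fun s hs hs' => by
    unfold slopeKernel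
    rw [max_eq_right (by linarith : s - (1 - r) ≤ 0),
      max_eq_right (by linarith : s - (1 - c) ≤ 0),
      max_eq_right (by linarith : s - c * (1 - r) ≤ 0),
      max_eq_right (by linarith : s - r * (1 - c) ≤ 0),
      max_eq_right (by linarith : s - r * c * (1 - r) ≤ 0),
      max_eq_right (by linarith : s - r * c * (1 - c) ≤ 0),
      max_eq_right (by linarith : s - r * c ^ 2 * (1 - r) ≤ 0)]
    have := le_max_left (s - r ^ 2 * c * (1 - c)) 0
    nlinarith
  have P2 : ∀ s, r * c ^ 2 * (1 - r) ≤ s → s ≤ r * c * (1 - c) →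
      slopeKernel r c s = (c - r) * (s - r * c * (c + r - r * c)) := fun s hs hs' => by
    unfold slopeKernel
    rw [max_eq_left (by linarith : 0 ≤ s - r ^ 2 * c * (1 - c)),
      max_eq_left (by linarith : 0 ≤ s - r * c ^ 2 * (1 - r))]
    rw [max_eq_right (by linarith : s - (1 - r) ≤ 0),
      max_eq_right (by linarith : s - (1 - c) ≤ 0),
      max_eq_right (by linarith : s - c * (1 - r) ≤ 0),
      max_eq_right (by linarith : s - r * (1 - c) ≤ 0),
      max_eq_right (by linarith : s - r * c * (1 - r) ≤ 0),
      max_eq_right (by linarith : s - r * c * (1 - c) ≤ 0)]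
    ring
  have P3 : ∀ s, r * c * (1 - c) ≤ s → s ≤ r * c * (1 - r) →
      slopeKernel r c s = (c - r) * (s - r * c * (c + r - r * c))
        + (1 + c - r * c) * (s - r * c * (1 - c)) := fun s hs hs' => by
    unfold slopeKernel
    rw [max_eq_left (by linarith : 0 ≤ s - r ^ 2 * c * (1 - c)),
      max_eq_left (by linarith : 0 ≤ s - r * c ^ 2 * (1 - r)),
      max_eq_left (by linarith : 0 ≤ s - r * c * (1 - c))]
    rw [max_eq_right (by linarith : s - (1 - r) ≤ 0),
      max_eq_right (by linarith : s - (1 - c) ≤ 0),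
      max_eq_right (by linarith : s - c * (1 - r) ≤ 0),
      max_eq_right (by linarith : s - r * (1 - c) ≤ 0),
      max_eq_right (by linarith : s - r * c * (1 - r) ≤ 0)]
    ring
  have P4 : ∀ s, r * c * (1 - r) ≤ s → s ≤ r * (1 - c) → 0 ≤ slopeKernel r c s := fun s hs hs' => by
    have : slopeKernel r c s = 2 * (c - r) * s := by
      unfold slopeKernel
      rw [max_eq_left (by linarith : 0 ≤ s - r ^ 2 * c * (1 - c)),
        max_eq_left (by linarith : 0 ≤ s - r * c ^ 2 * (1 - r)),
        max_eq_left (by linarith : 0 ≤ s - r * c * (1 - c)),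
        max_eq_left (by linarith : 0 ≤ s - r * c * (1 - r))]
      rw [max_eq_right (by linarith : s - (1 - r) ≤ 0),
        max_eq_right (by linarith : s - (1 - c) ≤ 0),
        max_eq_right (by linarith : s - c * (1 - r) ≤ 0),
        max_eq_right (by linarith : s - r * (1 - c) ≤ 0)]
      ring
    rw [this]
    have : 0 ≤ s := by linarith
    positivity
  have hζ0 : r * c ^ 2 * (1 - r) ≤ r * c * (c + r - r * c) := by
    nlinarith [mul_pos hrc0 hr]
  rcases le_total (r * c * (c + r - r * c)) (r * c * (1 - c)) with hζ | hζ
  · refine ⟨r * c * (c + r - r * c), by linarith, by linarith, fun s hs => ?_, fun s hs hs' => ?_⟩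
    · rcases le_total s (r ^ 2 * c * (1 - c)) with h | h
      · exact P0 s h
      rcases le_total s (r * c ^ 2 * (1 - r)) with h' | h'
      · exact P1 s h h'
      rw [P2 s h' (by linarith)]
      exact mul_nonpos_of_nonneg_of_nonpos d0.le (by linarith)
    · rcases le_total s (r * c * (1 - c)) with h | h
      · rw [P2 s (by linarith) h]
        exact mul_nonneg d0.le (by linarith)
      rcases le_total s (r * c * (1 - r)) with h' | h'
      · rw [P3 s h h']
        exact add_nonneg (mul_nonneg d0.le (by linarith)) (mul_nonneg hcoef.le (by linarith))
      · exact P4 s h' hs'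
  · have hD : 0 < (c - r) + (1 + c - r * c) := by linarith
    set z := ((c - r) * (r * c * (c + r - r * c)) + (1 + c - r * c) * (r * c * (1 - c)))
      / ((c - r) + (1 + c - r * c)) with hz
    have ez : z * ((c - r) + (1 + c - r * c)) =
        (c - r) * (r * c * (c + r - r * c)) + (1 + c - r * c) * (r * c * (1 - c)) :=
      div_mul_cancel₀ _ hD.ne'
    have P3' : ∀ s, r * c * (1 - c) ≤ s → s ≤ r * c * (1 - r) →
        slopeKernel r c s = ((c - r) + (1 + c - r * c)) * (s - z) := fun s hs hs' => by
      rw [P3 s hs hs']; linear_combination ez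
    have z1 : r * c * (1 - c) ≤ z := by
      refine le_of_mul_le_mul_right ?_ hD
      rw [ez]
      nlinarith [mul_le_mul_of_nonneg_left hζ d0.le]
    have z2 : z ≤ r * c * (1 - r) := by
      have h := P4 (r * c * (1 - r)) le_rfl k4
      rw [P3' _ k3 le_rfl] at h
      linarith [nonneg_of_mul_nonneg_right h hD]
    refine ⟨z, by linarith, by linarith, fun s hs => ?_, fun s hs hs' => ?_⟩
    · rcases le_total s (r ^ 2 * c * (1 - c)) with h | h
      · exact P0 s h
      rcases le_total s (r * c ^ 2 * (1 - r)) with h' | h'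
      · exact P1 s h h'
      rcases le_total s (r * c * (1 - c)) with g | g
      · rw [P2 s h' g]
        exact mul_nonpos_of_nonneg_of_nonpos d0.le (by linarith)
      · rw [P3' s g (by linarith)]
        exact mul_nonpos_of_nonneg_of_nonpos hD.le (by linarith)
    · rcases le_total s (r * c * (1 - r)) with h' | h'
      · rw [P3' s (by linarith) h']
        exact mul_nonneg hD.le (by linarith)
      · exact (P4 s h' hs')

/-- The upper half of the sign pattern of `slopeKernel`. -/
theorem slopeKernel_sign_high (hr : 0 < r) (hrc : r < c) (hc : c ≤ 1 / 2) :
    (∀ s, r * (1 - c) ≤ s → 0 ≤ slopeKernel r c s) ∨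
    ∃ z, r * (1 - c) ≤ z ∧ z ≤ 1 - r - c ∧
      (∀ s, r * (1 - c) ≤ s → s ≤ z → 0 ≤ slopeKernel r c s) ∧
      (∀ s, z ≤ s → s ≤ 1 - r - c → slopeKernel r c s ≤ 0) ∧
      ∀ s, 1 - r - c ≤ s → 0 ≤ slopeKernel r c s := by
  obtain ⟨k0, k1, k2, k3, k4, k5, k6, k7, -⟩ := slopeKernel_knots hr hrc hc
  have d0 : 0 < c - r := by linarith
  have P5 : ∀ s, r * (1 - c) ≤ s → s ≤ c * (1 - r) →
      slopeKernel r c s = 2 * (c - r) * s - (1 - r - r * c) * (s - r * (1 - c)) := fun s hs hs' => by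
    unfold slopeKernel
    rw [max_eq_left (by linarith : 0 ≤ s - r ^ 2 * c * (1 - c)),
      max_eq_left (by linarith : 0 ≤ s - r * c ^ 2 * (1 - r)),
      max_eq_left (by linarith : 0 ≤ s - r * c * (1 - c)),
      max_eq_left (by linarith : 0 ≤ s - r * c * (1 - r)),
      max_eq_left (by linarith : 0 ≤ s - r * (1 - c))]
    rw [max_eq_right (by linarith : s - (1 - r) ≤ 0),
      max_eq_right (by linarith : s - (1 - c) ≤ 0),
      max_eq_right (by linarith : s - c * (1 - r) ≤ 0)]
    ring
  have P6 : ∀ s, c * (1 - r) ≤ s → s ≤ 1 - c →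
      slopeKernel r c s = (c - r) * (s - (1 - r - c)) := fun s hs hs' => by
    unfold slopeKernel
    rw [max_eq_left (by linarith : 0 ≤ s - r ^ 2 * c * (1 - c)),
      max_eq_left (by linarith : 0 ≤ s - r * c ^ 2 * (1 - r)),
      max_eq_left (by linarith : 0 ≤ s - r * c * (1 - c)),
      max_eq_left (by linarith : 0 ≤ s - r * c * (1 - r)),
      max_eq_left (by linarith : 0 ≤ s - r * (1 - c)),
      max_eq_left (by linarith : 0 ≤ s - c * (1 - r))]
    rw [max_eq_right (by linarith : s - (1 - r) ≤ 0),
      max_eq_right (by linarith : s - (1 - c) ≤ 0)]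
    ring
  have P7 : ∀ s, 1 - c ≤ s → 0 ≤ slopeKernel r c s := fun s hs => by
    have : slopeKernel r c s = r * (max (s - (1 - r)) 0 - (s - (1 - r))) := by
      unfold slopeKernel
      rw [max_eq_left (by linarith : 0 ≤ s - r ^ 2 * c * (1 - c)),
        max_eq_left (by linarith : 0 ≤ s - r * c ^ 2 * (1 - r)),
        max_eq_left (by linarith : 0 ≤ s - r * c * (1 - c)),
        max_eq_left (by linarith : 0 ≤ s - r * c * (1 - r)),
        max_eq_left (by linarith : 0 ≤ s - r * (1 - c)),
        max_eq_left (by linarith : 0 ≤ s - c * (1 - r)),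
        max_eq_left (by linarith : 0 ≤ s - (1 - c))]
      ring
    rw [this]
    exact mul_nonneg hr.le (sub_nonneg.2 (le_max_left _ _))
  have v4 : 0 < r * (1 - c) := by nlinarith
  rcases le_or_gt (1 - r - c) (c * (1 - r)) with hz | hz
  · left
    intro s hs
    rcases le_total s (c * (1 - r)) with h | h
    · rw [P5 s hs h]
      have e : (2 * (c - r) * s - (1 - r - r * c) * (s - r * (1 - c))) * (c - r) =
          (c - r) * (c * (1 - r) - (1 - r - c)) * (s - r * (1 - c))
          + 2 * (c - r) * (r * (1 - c)) * (c * (1 - r) - s) := by ring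
      refine nonneg_of_mul_nonneg_left (b := c - r) ?_ d0
      rw [e]
      refine add_nonneg (mul_nonneg (mul_nonneg d0.le (by linarith)) (by linarith))
        (mul_nonneg (mul_nonneg (by linarith) v4.le) (by linarith))
    rcases le_total s (1 - c) with h' | h'
    · rw [P6 s h h']
      exact mul_nonneg d0.le (by linarith)
    · exact P7 s h'
  · right
    have hD : 0 < 1 - r - r * c - 2 * (c - r) := by nlinarith
    set z := (1 - r - r * c) * (r * (1 - c)) / (1 - r - r * c - 2 * (c - r)) with hzdef
    have ez : z * (1 - r - r * c - 2 * (c - r)) = (1 - r - r * c) * (r * (1 - c)) :=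
      div_mul_cancel₀ _ hD.ne'
    have P5' : ∀ s, r * (1 - c) ≤ s → s ≤ c * (1 - r) →
        slopeKernel r c s = (1 - r - r * c - 2 * (c - r)) * (z - s) := fun s hs hs' => by
      rw [P5 s hs hs']; linear_combination -ez
    have z1 : r * (1 - c) ≤ z := by
      refine le_of_mul_le_mul_right ?_ hD
      rw [ez]
      nlinarith
    have z2 : z ≤ c * (1 - r) := by
      have h := P6 (c * (1 - r)) le_rfl k6
      rw [P5' _ k5.le le_rfl] at h
      have : (c - r) * (c * (1 - r) - (1 - r - c)) ≤ 0 :=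
        mul_nonpos_of_nonneg_of_nonpos d0.le (by linarith)
      rw [← h] at this
      by_contra! hlt
      exact absurd (mul_pos hD (sub_pos.2 hlt)) (not_lt.2 this)
    refine ⟨z, z1, by linarith, fun s hs hs' => ?_, fun s hs hs' => ?_, fun s hs => ?_⟩
    · rw [P5' s hs (by linarith)]
      exact mul_nonneg hD.le (by linarith)
    · rcases le_total s (c * (1 - r)) with h | h
      · rw [P5' s (by linarith) h]
        exact mul_nonpos_of_nonneg_of_nonpos hD.le (by linarith)
      · rw [P6 s h (by linarith)]
        exact mul_nonpos_of_nonneg_of_nonpos d0.le (by linarith)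
    · rcases le_total s (1 - c) with h' | h'
      · rw [P6 s (by linarith) h']
        exact mul_nonneg d0.le (by linarith)
      · exact P7 s h'

theorem integral_rpow_mul_slopeKernel_nonneg (hr : 0 < r) (hrc : r < c) (hc : c ≤ 1 / 2)
    (hf : Favourable r c) {e : ℝ} (he0 : -3 < e) (he : e ≤ -1 / 2) :
    0 ≤ ∫ s in r ^ 2 * c * (1 - c)..1, s ^ e * slopeKernel r c s := by
  obtain ⟨k0, k1, k2, k3, k4, k5, k6, k7, k8⟩ := slopeKernel_knots hr hrc hc
  have hc0 := hr.trans hrc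
  have z3 : 0 < 1 - r - c := by linarith
  have h0 : ∫ s in r ^ 2 * c * (1 - c)..1, s ^ (-3 : ℝ) * slopeKernel r c s = 0 := by
    rw [integral_rpow_mul_slopeKernel hr hrc hc (by norm_num) (by norm_num)]
    have : slopeE (-3 + 2) r c = 0 := by
      rw [slopeE_eq, show (-3 + 2 : ℝ) = -1 by norm_num]
      simp only [rpow_neg_one]
      have n1 : 1 - r ≠ 0 := by linarith
      have n2 : 1 - c ≠ 0 := by linarith
      field_simp
      ring
    rw [this, zero_div]
  have e1 := integral_rpow_mul_slopeKernel hr hrc hc (e := -1 / 2) (by norm_num) (by norm_num)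
  have e2 := integral_rpow_mul_slopeKernel hr hrc hc (e := 0) (by norm_num) (by norm_num)
  rw [show (-1 / 2 + 2 : ℝ) = 3 / 2 by norm_num] at e1
  norm_num at e1
  rw [zero_add, zero_add, one_mul] at e2
  have hk := (continuous_slopeKernel r c).continuousOn (s := Icc (r ^ 2 * c * (1 - c)) 1)
  have main : ∀ {y₁ y₂ : ℝ}, 0 < y₁ → y₁ ≤ y₂ → (∀ s ∈ Icc (r ^ 2 * c * (1 - c)) 1,
      (s ≤ y₁ → 0 ≤ (log s - log (1 - r - c)) * slopeKernel r c s) ∧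
      (y₁ ≤ s → s ≤ y₂ → (log s - log (1 - r - c)) * slopeKernel r c s ≤ 0) ∧
      (y₂ ≤ s → 0 ≤ (log s - log (1 - r - c)) * slopeKernel r c s)) →
      0 ≤ ∫ s in r ^ 2 * c * (1 - c)..1, s ^ e * slopeKernel r c s := fun hy₁ hy hs => by
    refine integral_rpow_mul_nonneg k0 (by linarith) hk hy₁ hy z3 (p₁ := -1 / 2) (p₂ := 0)
      (by norm_num) he0 he hs h0 ?_ ?_
    · rw [neg_div, e1]
      exact div_nonneg hf.1.le (by norm_num)
    · rw [e2, neg_div, e1]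
      have := hf.2
      norm_num at this ⊢
      linarith
  have lneg : ∀ {s}, 0 < s → s ≤ 1 - r - c → log s - log (1 - r - c) ≤ 0 := fun h0 h =>
    sub_nonpos.2 (log_le_log h0 h)
  have lpos : ∀ {s}, 1 - r - c ≤ s → 0 ≤ log s - log (1 - r - c) := fun h =>
    sub_nonneg.2 (log_le_log z3 h)
  obtain ⟨z, hz0, hz1, hzn, hzp⟩ := exists_slopeKernel_sign_low hr hrc hc
  rcases slopeKernel_sign_high hr hrc hc with hh | ⟨w, hw1, hw2, hwp, hwn, hwl⟩
  · have hpos : ∀ s, z ≤ s → 0 ≤ slopeKernel r c s := fun s hs => by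
      rcases le_total s (r * (1 - c)) with h | h
      · exact hzp s hs h
      · exact hh s h
    rcases le_total z (1 - r - c) with hz | hz
    · refine main hz0 hz fun s hs => ?_
      have s0 : 0 < s := k0.trans_le hs.1
      exact ⟨fun h => mul_nonneg_of_nonpos_of_nonpos (lneg s0 (by linarith)) (hzn s h),
        fun h h' => mul_nonpos_of_nonpos_of_nonneg (lneg s0 h') (hpos s h),
        fun h => mul_nonneg (lpos h) (hpos s (by linarith))⟩
    · refine main z3 hz fun s hs => ?_
      have s0 : 0 < s := k0.trans_le hs.1
      exact ⟨fun h => mul_nonneg_of_nonpos_of_nonpos (lneg s0 h) (hzn s (by linarith)),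
        fun h h' => mul_nonpos_of_nonneg_of_nonpos (lpos h) (hzn s h'),
        fun h => mul_nonneg (lpos (by linarith)) (hpos s h)⟩
  · refine main hz0 (hz1.trans hw1) fun s hs => ?_
    have s0 : 0 < s := k0.trans_le hs.1
    refine ⟨fun h => mul_nonneg_of_nonpos_of_nonpos (lneg s0 (by linarith)) (hzn s h),
      fun h h' => mul_nonpos_of_nonpos_of_nonneg (lneg s0 (by linarith)) ?_, fun h => ?_⟩
    · rcases le_total s (r * (1 - c)) with g | g
      · exact hzp s h g
      · exact hwp s g h'
    · rcases le_total s (1 - r - c) with g | g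
      · exact mul_nonneg_of_nonpos_of_nonpos (lneg s0 g) (hwn s h g)
      · exact mul_nonneg (lpos g) (hwl s g)

theorem slopeE_one (r c : ℝ) : slopeE 1 r c = 0 := by
  rw [slopeE_eq]
  simp only [rpow_one]
  ring

theorem slopeE_nonpos_of_favourable (hr : 0 < r) (hrc : r < c) (hc : c ≤ 1 / 2)
    (hf : Favourable r c) {q : ℝ} (hq0 : 0 < q) (hq : q ≤ 1) : slopeE q r c ≤ 0 := by
  rcases hq.eq_or_lt with rfl | hq
  · exact (slopeE_one r c).le
  have h := integral_rpow_mul_slopeKernel_nonneg hr hrc hc hf (e := q - 2) (by linarith)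
    (by linarith)
  rw [integral_rpow_mul_slopeKernel hr hrc hc (by linarith) (by linarith), sub_add_cancel] at h
  by_contra! hpos
  exact absurd h (not_le.2 (div_neg_of_pos_of_neg hpos (by nlinarith)))

theorem slopeE_nonneg_of_favourable (hr : 0 < r) (hrc : r < c) (hc : c ≤ 1 / 2)
    (hf : Favourable r c) {q : ℝ} (hq0 : 1 ≤ q) (hq : q ≤ 3 / 2) : 0 ≤ slopeE q r c := by
  rcases hq0.eq_or_lt with rfl | hq0
  · exact (slopeE_one r c).ge
  have h := integral_rpow_mul_slopeKernel_nonneg hr hrc hc hf (e := q - 2) (by linarith)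
    (by linarith)
  rw [integral_rpow_mul_slopeKernel hr hrc hc (by linarith) (by linarith), sub_add_cancel] at h
  by_contra! hneg
  exact absurd h (not_le.2 (div_neg_of_neg_of_pos hneg (by nlinarith)))

end

noncomputable section

open Real Set

variable {p r c : ℝ}

theorem rpow_sub_rpow_le_mul {x y : ℝ} (hp : 1 ≤ p) (hx : 0 < x) (hy : 0 ≤ y) :
    x ^ p - y ^ p ≤ p * x ^ (p - 1) * (x - y) := by
  have h := one_add_mul_self_le_rpow_one_add (s := (y - x) / x)
    (by rw [le_div_iff₀ hx]; linarith) hp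
  have e : 1 + (y - x) / x = y / x := by field_simp; ring
  rw [e, div_rpow hy hx.le, le_div_iff₀ (rpow_pos_of_pos hx p)] at h
  have e2 : (1 + p * ((y - x) / x)) * x ^ p = x ^ p - p * x ^ (p - 1) * (x - y) := by
    rw [rpow_eq_mul_rpow_sub_one hx p]; field_simp; ring
  linarith

theorem rpow_mul_sub_le_mul_sub_one (hp : 5 ≤ p) {z : ℝ} (hz : 1 ≤ (p - 1) * z) (hz1 : z ≤ 1) :
    z ^ (p - 1) * (p - z) ≤ p * z - 1 := by
  have hz0 : 0 < z := by
    by_contra! h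
    nlinarith
  rcases le_total z (1 / 4) with h | h
  · have h1 : z ^ (p - 1 - 1) * p ≤ 1 := by
      have h2 : z ^ (p - 1 - 1) ≤ (1 / 4) ^ (p - 1 - 1) := rpow_le_rpow hz0.le h (by linarith)
      have h3 := one_add_mul_self_le_rpow_one_add (s := 3) (by norm_num) (p := p - 1 - 1)
        (by linarith)
      have h4 : (1 / 4 : ℝ) ^ (p - 1 - 1) * (1 + 3) ^ (p - 1 - 1) = 1 := by
        rw [← mul_rpow (by norm_num) (by norm_num)]; norm_num
      calc z ^ (p - 1 - 1) * p ≤ (1 / 4) ^ (p - 1 - 1) * (1 + 3) ^ (p - 1 - 1) :=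
            mul_le_mul h2 (by linarith) (by linarith) (by positivity)
        _ ≤ 1 := h4.le
    rw [rpow_eq_mul_rpow_sub_one hz0]
    have h5 := rpow_pos_of_pos hz0 (p - 1 - 1)
    nlinarith [mul_le_mul_of_nonneg_left h1 hz0.le, mul_pos (mul_pos hz0 h5) hz0]
  · have h1 : z ^ (p - 1) ≤ z ^ 4 := by
      rw [← rpow_natCast]
      exact rpow_le_rpow_of_exponent_ge hz0 hz1 (by push_cast; linarith)
    have h2 : z ^ 4 ≤ z := by
      calc z ^ 4 = z * z ^ 3 := by ring
        _ ≤ z * 1 := mul_le_mul_of_nonneg_left (pow_le_one₀ hz0.le hz1) hz0.le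
        _ = z := mul_one z
    have h3 : 0 ≤ (1 - z) * (4 * z - 1 + 4 * z ^ 2 + z ^ 3 * (4 - z)) := by
      have : 0 ≤ z ^ 3 * (4 - z) := mul_nonneg (by positivity) (by linarith)
      exact mul_nonneg (by linarith) (by nlinarith)
    nlinarith [mul_le_mul_of_nonneg_right h1 (by linarith : 0 ≤ p - z),
      mul_le_mul_of_nonneg_right h2 (by linarith : 0 ≤ p - 5)]

theorem one_sub_rpow_mul_le (hp : 5 ≤ p) (hr : 0 < r) (hrc : r < c) (hc : c ≤ 1 / 2) :
    (1 - r ^ p) * (1 - c) ^ (p - 1) ≤ (1 - c ^ p) * (1 - r) ^ (p - 1) := by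
  have hc0 := hr.trans hrc
  have hq : r ^ (p - 1) ≤ c ^ (p - 1) := rpow_le_rpow hr.le hrc.le (by linarith)
  have hU := one_sub_rpow_pos (by linarith : 0 < p) hr.le (by linarith)
  have hR := rpow_pos_of_pos (by linarith : 0 < 1 - r) (p - 1 - 1)
  have hC : (1 - c) ^ (p - 1 - 1) ≤ (1 - r) ^ (p - 1 - 1) :=
    rpow_le_rpow (by linarith) (by linarith) (by linarith)
  have h1 : c ^ p - r ^ p ≤ c - r := by
    have h2 := rpow_sub_rpow_le_mul (by linarith : 1 ≤ p) hc0 hr.le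
    have h3 : c ^ (p - 1) ≤ (1 / 2) ^ (p - 1) := rpow_le_rpow hc0.le hc (by linarith)
    have h4 := one_add_mul_self_le_rpow_one_add (s := 1) (by norm_num) (p := p - 1) (by linarith)
    have h5 : (1 / 2 : ℝ) ^ (p - 1) * (1 + 1) ^ (p - 1) = 1 := by
      rw [← mul_rpow (by norm_num) (by norm_num)]; norm_num
    have h6 : p * c ^ (p - 1) ≤ 1 := by
      calc p * c ^ (p - 1) ≤ (1 + 1) ^ (p - 1) * (1 / 2) ^ (p - 1) :=
            mul_le_mul (by linarith) h3 (rpow_nonneg hc0.le _) (by positivity)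
        _ ≤ 1 := by rw [mul_comm]; exact h5.le
    nlinarith
  have h2 : (1 - r ^ p) * (1 - c) ≤ (1 - c ^ p) * (1 - r) := by
    rw [rpow_eq_mul_rpow_sub_one hc0 p, rpow_eq_mul_rpow_sub_one hr p] at *
    nlinarith [mul_le_mul_of_nonneg_left hq (mul_pos hr hc0).le]
  rw [rpow_eq_mul_rpow_sub_one (by linarith : 0 < 1 - c),
    rpow_eq_mul_rpow_sub_one (by linarith : 0 < 1 - r)]
  calc (1 - r ^ p) * ((1 - c) * (1 - c) ^ (p - 1 - 1))
      = (1 - r ^ p) * (1 - c) * (1 - c) ^ (p - 1 - 1) := by ring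
    _ ≤ (1 - r ^ p) * (1 - c) * (1 - r) ^ (p - 1 - 1) :=
        mul_le_mul_of_nonneg_left hC (mul_nonneg hU.le (by linarith))
    _ ≤ (1 - c ^ p) * (1 - r) * (1 - r) ^ (p - 1 - 1) := mul_le_mul_of_nonneg_right h2 hR.le
    _ = _ := by ring

theorem slopeE_le (hp : 5 ≤ p) (hr : 0 < r) (hrc : r < c) (hc : c ≤ 1 / 2) :
    slopeE (p - 1) r c ≤ (1 - c ^ p) * (r * (1 - r) ^ (p - 1) - (1 - r) * r ^ (p - 1)
      * (1 - c) ^ (p - 1)) - (1 - r ^ p) * (c * (1 - c) ^ (p - 1)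
      - (1 - c) * c ^ (p - 1) * (1 - r) ^ (p - 1)) := by
  have h := one_sub_rpow_mul_le hp hr hrc hc
  have hc0 := hr.trans hrc
  rw [slopeE_eq, ← rpow_eq_mul_rpow_sub_one hc0, ← rpow_eq_mul_rpow_sub_one hr]
  have hpos : 0 < r ^ (p - 1) * c ^ (p - 1) :=
    mul_pos (rpow_pos_of_pos hr _) (rpow_pos_of_pos hc0 _)
  nlinarith [mul_le_mul_of_nonneg_left h hpos.le]

theorem slopeE_nonpos_of_one_le_mul (hp : 5 ≤ p) (hr : 0 < r) (hrc : r < c) (hc : c ≤ 1 / 2)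
    (h : curveH p r c = 0) (hpc : 1 ≤ p * c) : slopeE (p - 1) r c ≤ 0 := by
  refine (slopeE_le hp hr hrc hc).trans ?_
  have hc0 := hr.trans hrc
  have hc1 : 0 < 1 - c := by linarith
  have hU := one_sub_rpow_pos (by linarith : 0 < p) hr.le (by linarith)
  have hV := one_sub_rpow_pos (by linarith : 0 < p) hc0.le (by linarith)
  have hb := rpow_sub_rpow_le_mul (by linarith : 1 ≤ p) (by linarith : 0 < 1 - r) zero_le_one
  rw [one_rpow] at hb
  set z := c / (1 - c) with hz
  have ez : c = z * (1 - c) := by rw [hz]; field_simp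
  have hz0 : 0 < z := div_pos hc0 hc1
  have key := rpow_mul_sub_le_mul_sub_one hp (z := z)
    (by rw [hz, ← mul_div_assoc, le_div_iff₀ hc1]; linarith)
    (by rw [hz, div_le_one hc1]; linarith)
  have hγ : c ^ (p - 1) = z ^ (p - 1) * (1 - c) ^ (p - 1) := by
    conv_lhs => rw [ez]
    exact mul_rpow hz0.le hc1.le
  have hC := rpow_pos_of_pos hc1 (p - 1)
  have hR0 := rpow_pos_of_pos (by linarith : 0 < 1 - r) (p - 1)
  have hR1 : (1 - r) ^ (p - 1) ≤ 1 := rpow_le_one (by linarith) (by linarith) (by linarith)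
  have hρ := rpow_pos_of_pos hr (p - 1)
  have hγ0 := rpow_pos_of_pos hc0 (p - 1)
  have t1 : p * ((1 - c ^ p) * (r * (1 - r) ^ (p - 1))) ≤ (1 - r ^ p) * ((1 - c) ^ p - c ^ p) := by
    unfold curveH at h
    nlinarith [mul_le_mul_of_nonneg_left hb hV.le]
  have t2 : (1 - c) ^ p - c ^ p - p * (c * (1 - c) ^ (p - 1)) + p * ((1 - c) * c ^ (p - 1)) ≤ 0 := by
    rw [rpow_eq_mul_rpow_sub_one hc1 p, rpow_eq_mul_rpow_sub_one hc0 p, hγ]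
    have e : (1 - c) * (1 - c) ^ (p - 1) - c * (z ^ (p - 1) * (1 - c) ^ (p - 1))
        - p * (c * (1 - c) ^ (p - 1)) + p * ((1 - c) * (z ^ (p - 1) * (1 - c) ^ (p - 1)))
        = (1 - c) * (1 - c) ^ (p - 1) * (z ^ (p - 1) * (p - z) - (p * z - 1)) := by
      linear_combination (-(z ^ (p - 1) * (1 - c) ^ (p - 1)) - p * (1 - c) ^ (p - 1)) * ez
    rw [e]
    exact mul_nonpos_of_nonneg_of_nonpos (mul_pos hc1 hC).le (by linarith)
  have t3 : (1 - c) * c ^ (p - 1) * (1 - r) ^ (p - 1) ≤ (1 - c) * c ^ (p - 1) :=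
    mul_le_of_le_one_right (mul_pos hc1 hγ0).le hR1
  have t4 : 0 ≤ (1 - c ^ p) * ((1 - r) * r ^ (p - 1) * (1 - c) ^ (p - 1)) :=
    mul_nonneg hV.le (mul_nonneg (mul_nonneg (by linarith) hρ.le) hC.le)
  have hp0 : 0 < p := by linarith
  refine nonpos_of_mul_nonpos_right (a := p) ?_ hp0
  have t5 := mul_le_mul_of_nonneg_left t2 hU.le
  have t6 := mul_le_mul_of_nonneg_left t3 (mul_pos hp0 hU).le
  have t7 := mul_nonneg hp0.le t4
  linarith

theorem one_sub_rpow_le_exp (hp : 0 ≤ p) {t : ℝ} (ht : 0 < 1 - t) :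
    (1 - t) ^ p ≤ exp (-(p * t)) := by
  rw [rpow_def_of_pos ht, exp_le_exp]
  nlinarith [log_le_sub_one_of_pos ht]

theorem rpow_mul_sub_rpow_mul_le (hp : 5 ≤ p) (hr : 0 < r) (hrc : r < c) (hc : c < 1) :
    c ^ (p - 1) * (1 - r) ^ (p - 1 - 1) - r ^ (p - 1) * (1 - c) ^ (p - 1 - 1) ≤
      (c - r) * ((p - 1) * c ^ (p - 1 - 1) + (p - 1 - 1) * r ^ (p - 1)) := by
  have hr1 : 0 < 1 - r := by linarith
  have d0 : 0 < c - r := by linarith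
  have h1 := rpow_sub_rpow_le_mul (by linarith : 1 ≤ p - 1) (hr.trans hrc) hr.le
  have h2 := rpow_sub_rpow_le_mul (by linarith : 1 ≤ p - 1 - 1) hr1 (by linarith : 0 ≤ 1 - c)
  have h3 : (1 - r) ^ (p - 1 - 1 - 1) ≤ 1 := rpow_le_one hr1.le (by linarith) (by linarith)
  have hR : (1 - r) ^ (p - 1 - 1) ≤ 1 := rpow_le_one hr1.le (by linarith) (by linarith)
  have h4 : (1 - r) ^ (p - 1 - 1) - (1 - c) ^ (p - 1 - 1) ≤ (p - 1 - 1) * (c - r) := by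
    refine h2.trans ?_
    have : 0 ≤ (p - 1 - 1) * (c - r) := mul_nonneg (by linarith) d0.le
    linarith [mul_le_mul_of_nonneg_left h3 this]
  have h5 : 0 ≤ c ^ (p - 1) - r ^ (p - 1) :=
    sub_nonneg.2 (rpow_le_rpow hr.le hrc.le (by linarith))
  linarith [mul_le_mul_of_nonneg_left h4 (rpow_pos_of_pos hr (p - 1)).le,
    mul_le_of_le_one_right h5 hR]

theorem mul_add_rpow_le (hp : 5 ≤ p) (hr : 0 < r) (hrc : r < c) (hpc : p * c ≤ 1) :
    p * ((p - 1) * c ^ (p - 1 - 1) + (p - 1 - 1) * r ^ (p - 1)) ≤ 184 / 1000 := by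
  have hc0 := hr.trans hrc
  have hc5 : c ≤ 1 / 5 := by nlinarith
  have g1 : c ^ (p - 1 - 1) ≤ c ^ 3 := by
    rw [← rpow_natCast]
    exact rpow_le_rpow_of_exponent_ge hc0 (by linarith) (by push_cast; linarith)
  have g2 : r ^ (p - 1) ≤ c ^ 4 := by
    refine (rpow_le_rpow hr.le hrc.le (by linarith)).trans ?_
    rw [← rpow_natCast]
    exact rpow_le_rpow_of_exponent_ge hc0 (by linarith) (by push_cast; linarith)
  have g3 : p * (p - 1) * c ^ 3 ≤ 4 / 25 := by
    have i1 : p * c * ((p - 1) * c) ≤ 1 * (1 - c) :=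
      mul_le_mul hpc (by linarith) (mul_nonneg (by linarith) hc0.le) zero_le_one
    have i2 : c * (1 - c) ≤ 4 / 25 := by nlinarith
    linarith [mul_le_mul_of_nonneg_left i1 hc0.le]
  have g4 : p * (p - 1 - 1) * c ^ 4 ≤ 3 / 125 := by
    have i1 : p * c * ((p - 1 - 1) * c) ≤ 1 * (1 - 2 * c) :=
      mul_le_mul hpc (by linarith) (mul_nonneg (by linarith) hc0.le) zero_le_one
    have i2 : c * (1 - 2 * c) ≤ 3 / 25 := by nlinarith
    have i3 : c * (c * (1 - 2 * c)) ≤ 1 / 5 * (3 / 25) :=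
      mul_le_mul hc5 i2 (mul_nonneg hc0.le (by linarith)) (by norm_num)
    linarith [mul_le_mul_of_nonneg_left i1 (sq_nonneg c)]
  linarith [mul_le_mul_of_nonneg_left g1 (by nlinarith : 0 ≤ p * (p - 1)),
    mul_le_mul_of_nonneg_left g2 (by nlinarith : 0 ≤ p * (p - 1 - 1))]

set_option maxHeartbeats 800000 in
theorem slopeE_nonpos_of_mul_le_one (hp : 5 ≤ p) (hr : 0 < r) (hrc : r < c) (hc : c ≤ 1 / 2)
    (h : curveH p r c = 0) (hpc : p * c ≤ 1) : slopeE (p - 1) r c ≤ 0 := by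
  refine (slopeE_le hp hr hrc hc).trans ?_
  have hc0 := hr.trans hrc
  have hp0 : 0 < p := by linarith
  have hc5 : c ≤ 1 / 5 := by nlinarith
  have hc1 : 0 < 1 - c := by linarith
  have hr1 : 0 < 1 - r := by linarith
  have hV := one_sub_rpow_pos hp0 hc0.le (by linarith)
  have hUV : r ^ p ≤ c ^ p := rpow_le_rpow hr.le hrc.le hp0.le
  have ha := rpow_pos_of_pos hr p
  have hb5 : c ^ p ≤ 1 / 1000 := by
    calc c ^ p ≤ c ^ (5 : ℝ) := rpow_le_rpow_of_exponent_ge hc0 (by linarith) hp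
      _ ≤ (1 / 5) ^ (5 : ℝ) := rpow_le_rpow hc0.le hc5 (by norm_num)
      _ ≤ 1 / 1000 := by norm_num
  have hyb : c ^ p ≤ (1 - c) ^ p := rpow_le_rpow hc0.le (by linarith) hp0.le
  have hx0 := rpow_pos_of_pos hr1 p
  have hyx : (1 - c) ^ p ≤ (1 - r) ^ p := rpow_le_rpow hc1.le (by linarith) hp0.le
  have hxy : 1 ≤ (1 - r) ^ p + (1 - c) ^ p := by
    unfold curveH at h
    nlinarith [mul_nonneg (hUV.trans' ha.le) hx0.le, mul_nonneg ha.le (sub_nonneg.2 hyb)]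
  have hxR : (1 - r) ^ p ≤ (1 - r) ^ (p - 1 - 1) :=
    rpow_le_rpow_of_exponent_ge hr1 (by linarith) (by linarith)
  have eR := rpow_eq_mul_rpow_sub_one hr1 (p - 1)
  have eC := rpow_eq_mul_rpow_sub_one hc1 (p - 1)
  set R' := (1 - r) ^ (p - 1 - 1) with hR'
  set C' := (1 - c) ^ (p - 1 - 1) with hC'
  have hR'0 : 0 < R' := rpow_pos_of_pos hr1 _
  have hC'0 : 0 < C' := rpow_pos_of_pos hc1 _
  have hR'1 : R' ≤ 1 := rpow_le_one hr1.le (by linarith) (by linarith)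
  have hρ0 := rpow_pos_of_pos hr (p - 1)
  have hγ0 := rpow_pos_of_pos hc0 (p - 1)
  have d0 : 0 < c - r := by linarith
  -- the decrease of `t ↦ t * (1 - t) ^ (p - 1)`
  have l1 : (c - r) * (R' * (1 - r - (p - 1) * c)) ≤ c * (1 - c) ^ (p - 1) - r * (1 - r) ^ (p - 1) := by
    have := rpow_sub_rpow_le_mul (by linarith : 1 ≤ p - 1) hr1 hc1.le
    rw [← hR', eR] at this
    rw [eR]
    linarith [mul_le_mul_of_nonneg_left this hc0.le]
  have l2 := rpow_mul_sub_rpow_mul_le hp hr hrc (by linarith : c < 1)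
  rw [← hR', ← hC'] at l2
  have l3 := mul_add_rpow_le hp hr hrc hpc
  have l4 : 184 / 1000 ≤ p * (999 / 1000 * (R' * (1 - r - (p - 1) * c))) := by
    rcases le_total (p * c) (9 / 10) with hu | hu
    · have : 1 / 2 ≤ R' := by linarith
      have h2 : 1 / 10 ≤ 1 - r - (p - 1) * c := by linarith
      have h3 : 1 / 2 * (1 / 10) ≤ R' * (1 - r - (p - 1) * c) :=
        mul_le_mul this h2 (by norm_num) hR'0.le
      linarith [mul_le_mul hp h3 (by norm_num) hp0.le]
    · have y1 : (1 - c) ^ p ≤ 408 / 1000 := by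
        refine (one_sub_rpow_le_exp hp0.le hc1).trans ((exp_le_exp.2 (by linarith : -(p * c) ≤ -(9 / 10))).trans ?_)
        rw [exp_neg, inv_le_comm₀ (exp_pos _) (by norm_num)]
        have := sum_le_exp_of_nonneg (by norm_num : (0 : ℝ) ≤ 9 / 10) 5
        norm_num [Finset.sum_range_succ, Nat.factorial] at this
        linarith
      have hv : p * r ≤ 55 / 100 := by
        by_contra! hv
        have h1 := (one_sub_rpow_le_exp hp0.le hr1).trans (exp_le_exp.2 (by linarith : -(p * r) ≤ -(55 / 100)))
        have h2 : exp (-(55 / 100)) ≤ 59 / 100 := by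
          rw [exp_neg, inv_le_comm₀ (exp_pos _) (by norm_num)]
          have := sum_le_exp_of_nonneg (by norm_num : (0 : ℝ) ≤ 55 / 100) 4
          norm_num [Finset.sum_range_succ, Nat.factorial] at this ⊢
          linarith
        linarith
      have : 592 / 1000 ≤ R' := by linarith
      have h2 : 35 / 100 ≤ p * (1 - r - (p - 1) * c) := by
        linarith [mul_nonneg hp0.le (sub_nonneg.2 hpc)]
      have h3 := mul_le_mul this h2 (by norm_num) hR'0.le
      linarith
  have l5 : (p - 1) * c ^ (p - 1 - 1) + (p - 1 - 1) * r ^ (p - 1)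
      ≤ 999 / 1000 * (R' * (1 - r - (p - 1) * c)) :=
    le_of_mul_le_mul_left (l3.trans l4) hp0
  have l6 : (1 - c) * (1 - r) * (c ^ (p - 1) * R' - r ^ (p - 1) * C')
      ≤ 999 / 1000 * (c * (1 - c) ^ (p - 1) - r * (1 - r) ^ (p - 1)) := by
    have h1 : (1 - c) * (1 - r) * (c ^ (p - 1) * R' - r ^ (p - 1) * C')
        ≤ 1 * ((c - r) * (999 / 1000 * (R' * (1 - r - (p - 1) * c)))) := by
      have h2 := l2.trans (mul_le_mul_of_nonneg_left l5 d0.le)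
      have h3 : 0 ≤ (c - r) * (999 / 1000 * (R' * (1 - r - (p - 1) * c))) := by
        refine mul_nonneg d0.le (le_trans ?_ l5)
        have := rpow_pos_of_pos hc0 (p - 1 - 1)
        exact add_nonneg (mul_nonneg (by linarith) this.le) (mul_nonneg (by linarith) hρ0.le)
      have h4 : (1 - c) * (1 - r) ≤ 1 := mul_le_one₀ (by linarith) hr1.le (by linarith)
      have h5 := mul_le_mul_of_nonneg_left h2 (mul_pos hc1 hr1).le
      exact h5.trans (mul_le_mul_of_nonneg_right h4 h3)
    linarith
  have l7 : 0 ≤ (c ^ p - r ^ p) * (1 - c) ^ (p - 1) * (c - (1 - r) * r ^ (p - 1)) := by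
    have hρc : r ^ (p - 1) ≤ r ^ (1 : ℝ) :=
      rpow_le_rpow_of_exponent_ge hr (by linarith) (by linarith)
    rw [rpow_one] at hρc
    exact mul_nonneg (mul_nonneg (by linarith) (rpow_pos_of_pos hc1 _).le) (by nlinarith)
  set g := c * (1 - c) ^ (p - 1) - r * (1 - r) ^ (p - 1) with hg
  have l8 : 0 ≤ g := by
    refine le_trans ?_ l1
    have : 0 < 999 / 1000 * (R' * (1 - r - (p - 1) * c)) := by
      refine pos_of_mul_pos_right (lt_of_lt_of_le (by norm_num) l4) hp0.le
    exact mul_nonneg d0.le (by linarith)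
  have l9 : (1 - r ^ p) * ((1 - c) * (1 - r) * (c ^ (p - 1) * R' - r ^ (p - 1) * C'))
      ≤ (1 - c ^ p) * g := by
    have hU := one_sub_rpow_pos hp0 hr.le (by linarith)
    calc (1 - r ^ p) * ((1 - c) * (1 - r) * (c ^ (p - 1) * R' - r ^ (p - 1) * C'))
        ≤ (1 - r ^ p) * (999 / 1000 * g) := mul_le_mul_of_nonneg_left l6 hU.le
      _ ≤ 1 * (999 / 1000 * g) := mul_le_mul_of_nonneg_right (by linarith) (by linarith)
      _ ≤ (1 - c ^ p) * g := by linarith [mul_le_mul_of_nonneg_right hb5 l8]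
  have e : (1 - c ^ p) * (r * (1 - r) ^ (p - 1) - (1 - r) * r ^ (p - 1)
      * (1 - c) ^ (p - 1)) - (1 - r ^ p) * (c * (1 - c) ^ (p - 1)
      - (1 - c) * c ^ (p - 1) * (1 - r) ^ (p - 1)) =
      (1 - r ^ p) * ((1 - c) * (1 - r) * (c ^ (p - 1) * R' - r ^ (p - 1) * C'))
      - (1 - c ^ p) * g - (c ^ p - r ^ p) * (1 - c) ^ (p - 1) * (c - (1 - r) * r ^ (p - 1)) := by
    rw [hg, eR, eC]; ring
  rw [e]
  linarith

theorem slopeE_nonpos_of_five_le (hp : 5 ≤ p) (hr : 0 < r) (hrc : r < c) (hc : c ≤ 1 / 2)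
    (h : curveH p r c = 0) : slopeE (p - 1) r c ≤ 0 := by
  rcases le_total (p * c) 1 with hpc | hpc
  · exact slopeE_nonpos_of_mul_le_one hp hr hrc hc h hpc
  · exact slopeE_nonpos_of_one_le_mul hp hr hrc hc h hpc

end

noncomputable section

open Real Set AffForm

namespace DiagCell

/-- Verifies that consecutive intervals of values `p` covering `[a, b]` pass a test on the diagonal. -/
def checkTau (test : AffForm → AffForm → AffForm → Bool) : ℤ → List (ℤ × DiagCell) → ℤ → Bool
  | a, [], b => decide (b ≤ a)
  | a, s :: l, b => check (a + s.1) s.1 s.2 (fun p q _ _ m => test p q m) &&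
      forceInt (a + s.1 + s.1) fun a => checkTau test a l b

theorem checkTau_sound {test : AffForm → AffForm → AffForm → Bool} {l : List (ℤ × DiagCell)} {b : ℤ}
    {p : ℝ} (hp0 : 1 < p) : ∀ {a : ℤ}, checkTau test a l b = true → a ≤ p * gridScale →
    p * gridScale < b → ∃ (t : Noise) (fp fq fm : AffForm), fp.Encl t p ∧ fq.Encl t (p - 1) ∧
      fm.Encl t (curveTau p) ∧ test fp fq fm = true := by
  induction l with
  | nil =>
    intro a h h1 h2
    simp only [checkTau, decide_eq_true_eq] at h
    have : (b : ℝ) ≤ a := by exact_mod_cast h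
    exact absurd (h1.trans_lt h2) (not_lt.2 this)
  | cons s l ih =>
    intro a h h1 h2
    simp only [checkTau, Bool.and_eq_true, forceInt_eq] at h
    by_cases hx : p * gridScale ≤ ((a + s.1 + s.1 : ℤ) : ℝ)
    · obtain ⟨u, hu, hpu⟩ := exists_noise_coord (c := a + s.1) (h := s.1) (x := p) (by
        have hG : (gridScale : ℝ) = 1048576 := by norm_num
        rw [hG] at hx h1 ⊢
        push_cast at hx ⊢
        rw [abs_le]; constructor <;> linarith)
      obtain ⟨t, -, h⟩ := check_sound_tau h.1 hu hp0 hpu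
      exact ⟨t, h⟩
    · exact ih h.2 (not_le.1 hx).le h2

end DiagCell

/-- Intervals of values `p` on which `logEnd` is smaller than `logDiag`. -/
def endCells : List (ℤ × DiagCell) :=
   [(10321, ⟨0, 245794, -669, 10⟩),
    (7939, ⟨0, 244613, -512, 7⟩),
    (6107, ⟨0, 243708, -393, 3⟩),
    (4698, ⟨0, 243014, -301, 4⟩),
    (3614, ⟨0, 242481, -231, 2⟩),
    (2780, ⟨0, 242072, -178, 3⟩),
    (2138, ⟨0, 241757, -137, 2⟩),
    (1645, ⟨0, 241516, -105, 1⟩),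
    (1265, ⟨0, 241330, -81, 1⟩),
    (973, ⟨0, 241188, -62, 1⟩),
    (748, ⟨0, 241078, -48, 1⟩),
    (576, ⟨0, 240994, -37, 1⟩),
    (443, ⟨0, 240929, -28, 1⟩),
    (341, ⟨0, 240879, -22, 1⟩),
    (262, ⟨0, 240841, -17, 1⟩)]

/-- Intervals of values `p` on which `logDiag` is smaller than `logEnd`. -/
def diagCells : List (ℤ × DiagCell) :=
   [(524, ⟨0, 240125, -33, 1⟩),
    (681, ⟨0, 240048, -43, 1⟩),
    (886, ⟨0, 239949, -56, 1⟩),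
    (1152, ⟨0, 239820, -73, 1⟩),
    (1497, ⟨0, 239652, -95, 1⟩),
    (1946, ⟨0, 239434, -123, 1⟩),
    (2530, ⟨0, 239151, -160, 1⟩),
    (3290, ⟨0, 238783, -208, 3⟩),
    (4277, ⟨0, 238307, -269, 3⟩),
    (5560, ⟨0, 237688, -349, 3⟩),
    (7228, ⟨0, 236886, -452, 6⟩),
    (9396, ⟨0, 235848, -585, 7⟩),
    (12215, ⟨0, 234506, -756, 11⟩),
    (15879, ⟨0, 232774, -975, 16⟩),
    (20643, ⟨0, 230544, -1254, 25⟩),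
    (26836, ⟨0, 227681, -1607, 45⟩),
    (34887, ⟨0, 224024, -2048, 63⟩),
    (45353, ⟨0, 219382, -2590, 127⟩),
    (58959, ⟨0, 213540, -3244, 188⟩),
    (76646, ⟨0, 206278, -4007, 216⟩),
    (99640, ⟨0, 197395, -4857, 340⟩),
    (129533, ⟨0, 186763, -5747, 524⟩),
    (168393, ⟨0, 174377, -6601, 550⟩),
    (218910, ⟨0, 160404, -7327, 756⟩),
    (284584, ⟨0, 145188, -7841, 976⟩),
    (369959, ⟨0, 129214, -8090, 1176⟩)]

theorem checkTau_endCells : DiagCell.checkTau (fun p q m => (logDiagF p q m - logEndF p).pos)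
    2607141 endCells 2694841 = true := by
  decide +kernel

theorem checkTau_diagCells : DiagCell.checkTau (fun p q m => (logEndF p - logDiagF p q m).pos)
    2705326 diagCells 5242881 = true := by
  decide +kernel

theorem logEnd_le_logDiag {p : ℝ} (h1 : 5 / 2 ≤ p) (h2 : p ≤ 2.57) : logEnd p ≤ logDiag p := by
  have hG : (gridScale : ℝ) = 1048576 := by norm_num
  obtain ⟨t, fp, fq, fm, e1, e2, e3, h⟩ := DiagCell.checkTau_sound (p := p) (by linarith)
    checkTau_endCells (by rw [hG]; push_cast; linarith) (by rw [hG]; push_cast; linarith)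
  have hp : 0 < p := by linarith
  have := ((e1.logDiagF e2 e3 hp).hSub (e1.logEndF hp)).lt_of_pos h
  linarith

theorem logDiag_le_logEnd {p : ℝ} (h1 : 2.58 ≤ p) (h2 : p ≤ 5) : logDiag p ≤ logEnd p := by
  have hG : (gridScale : ℝ) = 1048576 := by norm_num
  obtain ⟨t, fp, fq, fm, e1, e2, e3, h⟩ := DiagCell.checkTau_sound (p := p) (by linarith)
    checkTau_diagCells (by rw [hG]; push_cast; linarith) (by rw [hG]; push_cast; linarith)
  have hp : 0 < p := by linarith
  have := ((e1.logEndF hp).hSub (e1.logDiagF e2 e3 hp)).lt_of_pos h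
  linarith

theorem checkTau_bounds : DiagCell.checkTau
    (fun _ _ m => (m - grid 240000 0 0 0).pos && (grid 240900 0 0 0 - m).pos)
    2694839 [(5244, ⟨0, 240491, -333, 3⟩)] 2705327 = true := by
  decide +kernel

theorem curveTau_mem {p : ℝ} (h1 : 2.57 ≤ p) (h2 : p ≤ 2.58) :
    curveTau p ∈ Ioo (240000 / 1048576) (240900 / 1048576) := by
  have hG : (gridScale : ℝ) = 1048576 := by norm_num
  obtain ⟨t, fp, fq, fm, e1, e2, e3, h⟩ := DiagCell.checkTau_sound (p := p) (by linarith)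
    checkTau_bounds (by rw [hG]; push_cast; linarith) (by rw [hG]; push_cast; linarith)
  simp only [Bool.and_eq_true] at h
  have k1 := (e3.hSub (encl_grid 240000 0 0 0)).lt_of_pos h.1
  have k2 := ((encl_grid 240900 0 0 0).hSub e3).lt_of_pos h.2
  rw [hG] at k1 k2
  push_cast at k1 k2
  constructor <;> linarith

theorem curveTau_rpow {p : ℝ} (hp : 0 < p) : 2 * (1 - curveTau p) ^ p = 1 + curveTau p ^ p := by
  have h := (curveTau_spec hp).2
  have h1 := one_sub_rpow_pos hp (curveTau_pos hp).le (by linarith [curveTau_lt_half hp])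
  rw [phiF, div_eq_iff h1.ne'] at h
  linarith

theorem logDiag_eq {p : ℝ} (hp : 0 < p) :
    logDiag p = p * Real.log (1 + curveTau p) - p * Real.log (1 - curveTau p) - 2 * Real.log 2 := by
  have h0 := curveTau_pos hp
  have h1 := curveTau_lt_half hp
  have hr := curveTau_rpow hp
  have ha := one_sub_rpow_pos hp h0.le (by linarith)
  set τ := curveTau p
  have hb : 0 < 1 + τ ^ p := by positivity
  have hx : 0 < 1 - τ := by linarith
  have e1 : Real.log (1 + τ ^ p) = Real.log 2 + p * Real.log (1 - τ) := by
    rw [← hr, Real.log_mul (by norm_num) (rpow_pos_of_pos hx p).ne', Real.log_rpow hx]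
  have e2 : Real.log (1 - τ * τ) = Real.log (1 - τ) + Real.log (1 + τ) := by
    rw [← Real.log_mul hx.ne' (by linarith)]; congr 1; ring
  have e3 : Real.log (1 - τ ^ p * τ ^ p) = Real.log (1 - τ ^ p) + Real.log (1 + τ ^ p) := by
    rw [← Real.log_mul ha.ne' hb.ne']; congr 1; ring
  rw [logDiag, logDet]
  rw [e2, e3, e1]; ring

/-- The derivative of `2 * (1 - t) ^ x - t ^ x` along `t = a - x / 16`. -/
def tauSlope (x t : ℝ) : ℝ :=
  2 * (1 - t) ^ x * (Real.log (1 - t) + x / 16 * (1 - t)⁻¹) - t ^ x * (Real.log t - x / 16 * t⁻¹)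

/-- The derivative of `x log (1 + t) - x log (1 - t) - log (1 - 2 ^ (-x))` along `t = a - x / 16`. -/
def diffSlope (x t : ℝ) : ℝ :=
  Real.log (1 + t) - Real.log (1 - t) - x / 16 * ((1 + t)⁻¹ + (1 - t)⁻¹)
    + (1 / 2) ^ x * Real.log (1 / 2) * (1 - (1 / 2) ^ x)⁻¹

/-- Decides that `tauSlope` and `diffSlope` are negative on a box. -/
def slopesNeg : Bool :=
  (grid 2700083 5244 0 0).bind fun x => (grid 240100 0 900 0).bind fun t =>
  t.compl.bind fun t' => (const 1 1 + t).bind fun s => (x * const 1 16).bind fun y =>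
  (pow x (const 1 2)).bind fun h =>
    ((const 2 1 * pow x t') * (AffForm.log t' + y * pow (const (-1) 1) t')
      - pow x t * (AffForm.log t - y * pow (const (-1) 1) t)).neg &&
    ((AffForm.log s - AffForm.log t' - y * (pow (const (-1) 1) s + pow (const (-1) 1) t'))
      + h * AffForm.log (const 1 2) * pow (const (-1) 1) h.compl).neg

theorem slopesNeg_eq : slopesNeg = true := by decide +kernel

theorem slopes_neg {x t : ℝ} (h1 : 2.57 ≤ x) (h2 : x ≤ 2.58) (h3 : 239200 / 1048576 ≤ t)
    (h4 : t ≤ 241000 / 1048576) : tauSlope x t < 0 ∧ diffSlope x t < 0 := by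
  have hG : (gridScale : ℝ) = 1048576 := by norm_num
  obtain ⟨u, hu, hxu⟩ := exists_noise_coord (c := 2700083) (h := 5244) (x := x) (by
    rw [hG, abs_le]; push_cast; constructor <;> linarith)
  obtain ⟨v, hv, htv⟩ := exists_noise_coord (c := 240100) (h := 900) (x := t) (by
    rw [hG, abs_le]; push_cast; constructor <;> linarith)
  let n : Noise := ⟨u, v, 0, hu, hv, by norm_num⟩
  have ex : (grid 2700083 5244 0 0).Encl n x := by
    convert encl_grid 2700083 5244 0 0 using 1; rw [hxu]; simp only [n]; push_cast; ring
  have et : (grid 240100 0 900 0).Encl n t := by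
    convert encl_grid 240100 0 900 0 using 1; rw [htv]; simp only [n]; push_cast; ring
  have c1 : (const 1 1).Encl n 1 := encl_const' 1 one_pos (by norm_num)
  have c2 : (const 2 1).Encl n 2 := encl_const' 2 one_pos (by norm_num)
  have c3 : (const (-1) 1).Encl n (-1) := encl_const' (-1) one_pos (by norm_num)
  have ch : (const 1 2).Encl n (1 / 2) := encl_const' 1 two_pos (by norm_num)
  have c16 : (const 1 16).Encl n (1 / 16) := encl_const' 1 (by norm_num) (by norm_num)
  have t0 : 0 < t := by linarith
  have t1 : 0 < 1 - t := by linarith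
  have t2 : 0 < 1 + t := by linarith
  have t3 : 0 < 1 - (1 / 2 : ℝ) ^ x := one_sub_rpow_pos (by linarith) (by norm_num) (by norm_num)
  have ey := ex.hMul c16
  have es := c1.hAdd et
  have eh := ch.pow ex (by norm_num)
  have hs := slopesNeg_eq
  simp only [slopesNeg, bind_eq, Bool.and_eq_true] at hs
  have k1 := (((c2.hMul (et.compl.pow ex t1)).hMul (et.compl.log.hAdd (ey.hMul (et.compl.pow c3 t1)))).hSub
    ((et.pow ex t0).hMul (et.log.hSub (ey.hMul (et.pow c3 t0))))).lt_of_neg hs.1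
  have k2 := (((es.log.hSub et.compl.log).hSub (ey.hMul ((es.pow c3 t2).hAdd (et.compl.pow c3 t1)))).hAdd
    ((eh.hMul ch.log).hMul (eh.compl.pow c3 t3))).lt_of_neg hs.2
  simp only [rpow_neg_one, mul_one_div] at k1 k2
  exact ⟨k1, k2⟩

/-- The difference of `logDiag` and `logEnd` decreases. -/
theorem logDiag_sub_logEnd_lt {p p' : ℝ} (h1 : 2.57 ≤ p) (h : p < p') (h2 : p' ≤ 2.58) :
    logDiag p' - logEnd p' < logDiag p - logEnd p := by
  have hp : 0 < p := by linarith
  have hp' : 0 < p' := by linarith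
  obtain ⟨τ1, τ2⟩ := curveTau_mem h1 (h.le.trans h2)
  have hτ := curveTau_rpow hp
  have hτ' := curveTau_rpow hp'
  have hE := logDiag_eq hp
  have hE' := logDiag_eq hp'
  have hτ0 := curveTau_pos hp'
  have hτh := curveTau_lt_half hp'
  rw [hE, hE', logEnd_eq hp, logEnd_eq hp']
  set τ := curveTau p
  set τ' := curveTau p'
  set T : ℝ → ℝ := fun x => τ - (x - p) / 16 with hT
  have hTp : T p = τ := by simp [hT]
  have hTd : ∀ x, HasDerivAt T (-(1 / 16)) x := fun x => by
    simpa using (((hasDerivAt_id x).sub_const p).div_const 16).const_sub τ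
  have hTm : ∀ x ∈ Icc p p', 239200 / 1048576 ≤ T x ∧ T x ≤ 241000 / 1048576 := fun x hx => by
    simp only [hT]; constructor <;> linarith [hx.1, hx.2]
  have hneg : ∀ x ∈ Icc p p', tauSlope x (T x) < 0 ∧ diffSlope x (T x) < 0 := fun x hx =>
    slopes_neg (h1.trans hx.1) (hx.2.trans h2) (hTm x hx).1 (hTm x hx).2
  have key : ∀ {f f' : ℝ → ℝ}, (∀ x ∈ Icc p p', HasDerivAt f (f' x) x) →
      (∀ x ∈ Icc p p', f' x < 0) → f p' < f p := fun {f f'} hd hn => by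
    refine strictAntiOn_of_deriv_neg (convex_Icc p p')
      (fun x hx => (hd x hx).continuousAt.continuousWithinAt) (fun x hx => ?_)
      (left_mem_Icc.2 h.le) (right_mem_Icc.2 h.le) h
    rw [(hd x (interior_subset hx)).deriv]
    exact hn x (interior_subset hx)
  have hlow : 2 * (1 - T p') ^ p' - T p' ^ p' < 2 * (1 - T p) ^ p - T p ^ p := by
    refine key (f := fun x => 2 * (1 - T x) ^ x - T x ^ x) (f' := fun x => tauSlope x (T x))
      (fun x hx => ?_) fun x hx => (hneg x hx).1
    have t0 : 0 < T x := by linarith [(hTm x hx).1]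
    have t1 : 0 < 1 - T x := by linarith [(hTm x hx).2]
    refine ((((hTd x).const_sub 1).rpow (hasDerivAt_id x) t1).const_mul 2 |>.sub
      ((hTd x).rpow (hasDerivAt_id x) t0)).congr_deriv ?_
    simp only [tauSlope, id]
    rw [rpow_sub_one t0.ne', rpow_sub_one t1.ne']
    field_simp
    ring
  have hlt : τ' < T p' := by
    by_contra! hc
    have b := hTm p' (right_mem_Icc.2 h.le)
    have a1 : T p' ^ p' ≤ τ' ^ p' := rpow_le_rpow (by linarith) hc hp'.le
    have a2 : (1 - τ') ^ p' ≤ (1 - T p') ^ p' := rpow_le_rpow (by linarith) (by linarith) hp'.le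
    rw [hTp] at hlow
    linarith
  have hdiff := key (f := fun x => x * Real.log (1 + T x) - x * Real.log (1 - T x)
      - Real.log (1 - (1 / 2) ^ x)) (f' := fun x => diffSlope x (T x)) (fun x hx => by
    have t0 : 0 < 1 + T x := by linarith [(hTm x hx).1]
    have t1 : 0 < 1 - T x := by linarith [(hTm x hx).2]
    have t2 : 0 < 1 - (1 / 2 : ℝ) ^ x :=
      one_sub_rpow_pos (by linarith [hx.1]) (by norm_num) (by norm_num)
    have d := (hasDerivAt_id x).const_rpow (a := 1 / 2) (by norm_num)
    refine ((((hasDerivAt_id x).mul (((hTd x).const_add 1).log t0.ne')).sub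
      ((hasDerivAt_id x).mul (((hTd x).const_sub 1).log t1.ne'))).sub
      ((d.const_sub 1).log t2.ne')).congr_deriv ?_
    simp only [diffSlope, id] at t2 ⊢
    field_simp
    ring) fun x hx => (hneg x hx).2
  simp only [hTp] at hdiff
  have b := hTm p' (right_mem_Icc.2 h.le)
  have l1 : Real.log (1 + τ') < Real.log (1 + T p') := log_lt_log (by linarith) (by linarith)
  have l2 : Real.log (1 - T p') < Real.log (1 - τ') := log_lt_log (by linarith) (by linarith)
  have m1 := mul_lt_mul_of_pos_left l1 hp'
  have m2 := mul_lt_mul_of_pos_left l2 hp'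
  linarith

end

noncomputable section

open Real Set AffForm

variable {p r c : ℝ}

theorem curveC_bounds (hp : 0 < p) (hr0 : 0 < r) (hr : r < curveTau p) :
    r < curveC p r ∧ curveC p r ≤ 1 / 2 ∧ curveH p r (curveC p r) = 0 := by
  have hm : r ∈ Icc (0 : ℝ) (1 / 2) := ⟨hr0.le, hr.le.trans (curveTau_spec hp).1.2⟩
  exact ⟨lt_curveC_of_lt_curveTau hp hr0.le hr, (curveC_mem hp hm).1.2, curveH_curveC hp hm⟩

theorem logDiag_le_of_le_two (hp : 1 < p) (hp2 : p ≤ 2) (h0 : 0 ≤ r) (hr : r ≤ curveTau p) :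
    logDiag p ≤ logDet p r (curveC p r) := by
  refine logDiag_le (by linarith) h0 hr fun s hs hst => ?_
  obtain ⟨h1, h2, -⟩ := curveC_bounds (by linarith) (h0.trans_lt hs) hst
  exact slopeE_nonpos_of_favourable (h0.trans_lt hs) h1 h2
    (favourable_curveC hp (by linarith) (h0.trans_lt hs) hst) (by linarith) (by linarith)

theorem logEnd_le_of_le_five_half (hp : 2 ≤ p) (hp2 : p ≤ 5 / 2) (h0 : 0 ≤ r)
    (hr : r ≤ curveTau p) : logEnd p ≤ logDet p r (curveC p r) := by
  have hp0 : 0 < p := by linarith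
  refine logEnd_le hp0 ⟨h0, hr.trans (curveTau_spec hp0).1.2⟩ fun s hs hsr => ?_
  obtain ⟨h1, h2, -⟩ := curveC_bounds hp0 hs (hsr.trans_le hr)
  exact slopeE_nonneg_of_favourable hs h1 h2
    (favourable_curveC (by linarith) (by linarith) hs (hsr.trans_le hr)) (by linarith) (by linarith)

theorem logDiag_le_of_five_le (hp : 5 ≤ p) (h0 : 0 ≤ r) (hr : r ≤ curveTau p) :
    logDiag p ≤ logDet p r (curveC p r) := by
  refine logDiag_le (by linarith) h0 hr fun s hs hst => ?_
  obtain ⟨h1, h2, h3⟩ := curveC_bounds (by linarith) (h0.trans_lt hs) hst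
  exact slopeE_nonpos_of_five_le hp (h0.trans_lt hs) h1 h2 h3

theorem logEnd_le_or_logDiag_le (hp : 5 / 2 ≤ p) (hp5 : p < 5) (h0 : 0 ≤ r)
    (hr : r ≤ curveTau p) :
    logEnd p ≤ logDet p r (curveC p r) ∨ logDiag p ≤ logDet p r (curveC p r) := by
  have hG : (gridScale : ℝ) = 1048576 := by norm_num
  refine CurveSlab.checkAll_sound (by linarith) h0 hr checkAll_curveSlabs ?_ ?_ <;>
    rw [hG] <;> push_cast <;> linarith

/-- The minimum of `logDet` on the curve for `p ≤ 2` and for `p` beyond the crossing point. -/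
theorem logDiag_le_logDet_curveC {p₀ : ℝ} (h1 : 2.57 ≤ p₀) (h : logEnd p₀ = logDiag p₀) (hp : 1 < p) (hp' : p ≤ 2 ∨ p₀ ≤ p) (h0 : 0 ≤ r)
    (hr : r ≤ curveTau p) : logDiag p ≤ logDet p r (curveC p r) := by
  rcases hp' with hp' | hp'
  · exact logDiag_le_of_le_two hp hp' h0 hr
  rcases le_or_gt 5 p with h5 | h5
  · exact logDiag_le_of_five_le h5 h0 hr
  have hle : logDiag p ≤ logEnd p := by
    rcases le_total 2.58 p with h3 | h3
    · exact logDiag_le_logEnd h3 h5.le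
    rcases hp'.eq_or_lt with rfl | hlt
    · exact h.ge
    · linarith [logDiag_sub_logEnd_lt h1 hlt h3]
  rcases logEnd_le_or_logDiag_le (by linarith) h5 h0 hr with h3 | h3
  · exact hle.trans h3
  · exact h3

/-- The minimum of `logDet` on the curve for `p` between `2` and the crossing point. -/
theorem logEnd_le_logDet_curveC {p₀ : ℝ} (h2 : p₀ ≤ 2.58)
    (h : logEnd p₀ = logDiag p₀) (hp : 2 ≤ p) (hp' : p ≤ p₀) (h0 : 0 ≤ r)
    (hr : r ≤ curveTau p) : logEnd p ≤ logDet p r (curveC p r) := by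
  rcases le_total p (5 / 2) with h5 | h5
  · exact logEnd_le_of_le_five_half hp h5 h0 hr
  have hle : logEnd p ≤ logDiag p := by
    rcases le_total p 2.57 with h3 | h3
    · exact logEnd_le_logDiag h5 h3
    rcases hp'.eq_or_lt with rfl | hlt
    · exact h.le
    · linarith [logDiag_sub_logEnd_lt h3 hlt h2]
  rcases logEnd_le_or_logDiag_le h5 (by linarith) h0 hr with h3 | h3
  · exact h3
  · exact hle.trans h3

theorem curveH_comm (p r c : ℝ) : curveH p r c = curveH p c r := by
  unfold curveH; ring

theorem logDet_comm (p r c : ℝ) : logDet p r c = logDet p c r := by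
  unfold logDet; rw [mul_comm r c, mul_comm (r ^ p)]; ring

/-- A lower bound for `logDet` on the lower half of the curve holds on the whole curve. -/
theorem le_logDet_of_curveH_eq_zero {L : ℝ} (hp : 0 < p)
    (hL : ∀ r, 0 ≤ r → r ≤ curveTau p → L ≤ logDet p r (curveC p r))
    (hr : r ∈ Icc (0 : ℝ) (1 / 2)) (hc : c ∈ Icc (0 : ℝ) (1 / 2)) (h : curveH p r c = 0) :
    L ≤ logDet p r c := by
  wlog hrc : r ≤ c generalizing r c
  · rw [logDet_comm]
    exact this hc hr (by rwa [curveH_comm]) (not_le.1 hrc).le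
  have e := curveC_eq hp hr hc h
  have := hL r hr.1 (le_curveTau_of_le_curveC hp hr (by rwa [e]))
  rwa [e] at this

end

noncomputable section

open Real Set

/-- The sum of the `p`-th powers of the absolute values of the coordinates. -/
def lpSum (p : ℝ) (v : ℝ × ℝ) : ℝ := |v.1| ^ p + |v.2| ^ p

/-- The determinant of two plane vectors. -/
def planeDet (u v : ℝ × ℝ) : ℝ := u.1 * v.2 - u.2 * v.1

variable {p : ℝ} {u v w : ℝ × ℝ}

theorem lpSum_nonneg (p : ℝ) (v : ℝ × ℝ) : 0 ≤ lpSum p v := by unfold lpSum; positivity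

theorem lpSum_neg (p : ℝ) (v : ℝ × ℝ) : lpSum p (-v) = lpSum p v := by simp [lpSum]

theorem lpSum_smul (p s : ℝ) (v : ℝ × ℝ) : lpSum p (s • v) = |s| ^ p * lpSum p v := by
  simp only [lpSum, Prod.smul_fst, Prod.smul_snd, smul_eq_mul, abs_mul]
  rw [mul_rpow (abs_nonneg _) (abs_nonneg _), mul_rpow (abs_nonneg _) (abs_nonneg _)]
  ring

theorem lpSum_pos (hv : v ≠ 0) : 0 < lpSum p v := by
  unfold lpSum
  rcases eq_or_ne v.1 0 with h1 | h1
  · have h2 : v.2 ≠ 0 := fun h2 => hv (Prod.ext h1 h2)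
    have := rpow_pos_of_pos (abs_pos.2 h2) p
    positivity
  · have := rpow_pos_of_pos (abs_pos.2 h1) p
    positivity

theorem lpSum_convex (hp : 1 ≤ p) {α β : ℝ} (hα : 0 ≤ α) (hβ : 0 ≤ β) (h : α + β = 1) :
    lpSum p (α • v + β • w) ≤ α * lpSum p v + β * lpSum p w := by
  have key : ∀ x y : ℝ, |α * x + β * y| ^ p ≤ α * |x| ^ p + β * |y| ^ p := fun x y => by
    have h1 : |α * x + β * y| ≤ α * |x| + β * |y| := by
      refine (abs_add_le _ _).trans ?_
      rw [abs_mul, abs_mul, abs_of_nonneg hα, abs_of_nonneg hβ]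
    refine (rpow_le_rpow (abs_nonneg _) h1 (by linarith)).trans ?_
    exact (convexOn_rpow hp).2 (abs_nonneg x) (abs_nonneg y) hα hβ h
  have h1 := key v.1 w.1
  have h2 := key v.2 w.2
  simp only [lpSum, Prod.fst_add, Prod.snd_add, Prod.smul_fst, Prod.smul_snd, smul_eq_mul]
  linarith

theorem lpSum_smul_le (hp : 1 ≤ p) {s : ℝ} (h0 : 0 ≤ s) (h1 : s ≤ 1) :
    lpSum p (s • v) ≤ s * lpSum p v := by
  rw [lpSum_smul, abs_of_nonneg h0]
  refine mul_le_mul_of_nonneg_right ?_ (lpSum_nonneg p v)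
  exact (rpow_le_rpow_of_exponent_ge' h0 h1 zero_le_one hp).trans_eq (rpow_one s)

/-- A point below the level of the chord `w, w + u` lies in the interior of the ball, if its position
is suitable. -/
theorem lpSum_lt_one_of_mem (hp : 1 < p) {l s : ℝ} (hl0 : 0 < l) (hl1 : l < 1)
    (hu : lpSum p u ≤ 1) (hw : lpSum p w ≤ 1) (hwu : lpSum p (w + u) ≤ 1) (hs0 : -(1 - l) < s)
    (hs1 : s ≤ l) : lpSum p (l • w + s • u) < 1 := by
  rcases le_or_gt 0 s with h | h
  · have e : l • w + s • u = l • ((1 - s / l) • w + (s / l) • (w + u)) := by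
      ext <;> simp <;> field_simp <;> ring
    have hsl : s / l ≤ 1 := (div_le_one hl0).2 hs1
    have hsl0 : 0 ≤ s / l := by positivity
    have h1 := lpSum_convex (v := w) (w := w + u) hp.le (sub_nonneg.2 hsl) hsl0 (by ring)
    have h2 := lpSum_smul_le (v := (1 - s / l) • w + (s / l) • (w + u)) hp.le hl0.le hl1.le
    rw [e]
    have h3 : (1 - s / l) * lpSum p w + s / l * lpSum p (w + u) ≤ 1 := by
      nlinarith
    nlinarith
  · have hl : 0 < 1 - l := by linarith
    have e : l • w + s • u = l • w + (1 - l) • ((s / (1 - l)) • u) := by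
      rw [smul_smul, mul_div_cancel₀ _ hl.ne']
    have h1 := lpSum_convex (v := w) (w := (s / (1 - l)) • u) hp.le hl0.le hl.le (by ring)
    have h2 : lpSum p ((s / (1 - l)) • u) < 1 := by
      rw [lpSum_smul, abs_div, abs_of_neg h, abs_of_pos hl]
      have : (-s / (1 - l)) ^ p < 1 :=
        rpow_lt_one (div_nonneg (by linarith) hl.le) ((div_lt_one hl).2 (by linarith)) (by linarith)
      have h0 : 0 ≤ (-s / (1 - l)) ^ p := rpow_nonneg (div_nonneg (by linarith) hl.le) _
      nlinarith [lpSum_nonneg p u]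
    rw [e]
    nlinarith

/-- A line of lattice points outside the ball lies above the chord of a hexagon. -/
theorem planeDet_le_of_line (hp : 1 < p) (hu : lpSum p u ≤ 1) (hw : lpSum p w ≤ 1)
    (hwu : lpSum p (w + u) ≤ 1) (hv0 : 0 < planeDet u v)
    (hv : ∀ k : ℤ, 1 ≤ lpSum p (v + (k : ℝ) • u)) : planeDet u w ≤ planeDet u v := by
  by_contra! hlt
  have hw0 := hv0.trans hlt
  set l := planeDet u v / planeDet u w with hl
  have hl0 : 0 < l := div_pos hv0 hw0
  have hl1 : l < 1 := (div_lt_one hw0).2 hlt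
  set s := planeDet v w / planeDet u w with hs
  have e : v = l • w + s • u := by
    rw [hl, hs]
    ext <;> simp only [Prod.fst_add, Prod.snd_add, Prod.smul_fst, Prod.smul_snd, smul_eq_mul] <;>
      field_simp <;> unfold planeDet <;> ring
  have h1 := Int.floor_le (l - s)
  have h2 := Int.lt_floor_add_one (l - s)
  have h3 := hv ⌊l - s⌋
  have e2 : v + (⌊l - s⌋ : ℝ) • u = l • w + (s + ⌊l - s⌋) • u := by
    conv_lhs => rw [e]
    rw [add_smul, add_assoc]
  rw [e2] at h3
  exact absurd (lpSum_lt_one_of_mem hp hl0 hl1 hu hw hwu (by linarith) (by linarith)) (not_lt.2 h3)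

/-- The points of a line beyond two points on the boundary of the ball lie outside the ball. -/
theorem one_le_lpSum_of_line (hp : 1 ≤ p) (hv : lpSum p v = 1) (hvu : lpSum p (v + u) = 1) (k : ℤ) :
    1 ≤ lpSum p (v + (k : ℝ) • u) := by
  by_contra! hlt
  rcases le_or_gt k 0 with hk | hk
  · have hk' : (k : ℝ) ≤ 0 := by exact_mod_cast hk
    have hd : 0 < 1 - (k : ℝ) := by linarith
    have h := lpSum_convex (v := v + (k : ℝ) • u) (w := v + u) hp (α := 1 / (1 - k))
      (β := -k / (1 - k)) (by positivity) (div_nonneg (by linarith) hd.le) (by field_simp; ring)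
    have e : (1 / (1 - k : ℝ)) • (v + (k : ℝ) • u) + (-k / (1 - k) : ℝ) • (v + u) = v := by
      ext <;> simp <;> field_simp <;> ring
    rw [e, hv, hvu] at h
    have h2 : 1 / (1 - (k : ℝ)) * lpSum p (v + (k : ℝ) • u) < 1 / (1 - (k : ℝ)) * 1 :=
      mul_lt_mul_of_pos_left hlt (by positivity)
    have h3 : 1 / (1 - (k : ℝ)) * 1 + -k / (1 - k) * 1 = 1 := by field_simp; ring
    linarith
  · have hk' : (0 : ℝ) < k := by exact_mod_cast hk
    have hk1 : (1 : ℝ) ≤ k := by exact_mod_cast hk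
    have h := lpSum_convex (v := v + (k : ℝ) • u) (w := v) hp (α := 1 / k)
      (β := (k - 1) / k) (by positivity) (div_nonneg (by linarith) hk'.le) (by field_simp; ring)
    have e : (1 / k : ℝ) • (v + (k : ℝ) • u) + ((k - 1) / k : ℝ) • v = v + u := by
      ext <;> simp <;> field_simp <;> ring
    rw [e, hv, hvu] at h
    have h2 : 1 / (k : ℝ) * lpSum p (v + (k : ℝ) • u) < 1 / (k : ℝ) * 1 :=
      mul_lt_mul_of_pos_left hlt (by positivity)
    have h3 : 1 / (k : ℝ) * 1 + (k - 1) / k * 1 = 1 := by field_simp; ring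
    linarith

/-- Two inscribed hexagons with a common vertex have the same determinant. -/
theorem planeDet_eq_of_hexagon (hp : 1 < p) (hu : lpSum p u = 1) (hv : lpSum p v = 1)
    (hvu : lpSum p (v + u) = 1) (hw : lpSum p w = 1) (hwu : lpSum p (w + u) = 1)
    (hv0 : 0 < planeDet u v) (hw0 : 0 < planeDet u w) : planeDet u v = planeDet u w :=
  le_antisymm
    (planeDet_le_of_line hp hu.le hv.le hvu.le hw0 (one_le_lpSum_of_line hp.le hw hwu))
    (planeDet_le_of_line hp hu.le hw.le hwu.le hv0 (one_le_lpSum_of_line hp.le hv hvu))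

theorem one_le_lpSum_smul {s : ℤ} (hp : 0 ≤ p) (hs : s ≠ 0) (hv : lpSum p v = 1) :
    1 ≤ lpSum p ((s : ℝ) • v) := by
  rw [lpSum_smul, hv, mul_one]
  exact one_le_rpow (by exact_mod_cast Int.one_le_abs hs) hp

theorem one_le_lpSum_of_le (hp : 1 ≤ p) (hv : lpSum p v = 1)
    (huv : lpSum p (u + v) = 1) {m n : ℤ} (hn : 0 < n) (hmn : n ≤ m) :
    1 ≤ lpSum p ((m : ℝ) • u + (n : ℝ) • v) := by
  have hn' : (1 : ℝ) ≤ n := by exact_mod_cast hn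
  have hmn' : (n : ℝ) ≤ m := by exact_mod_cast hmn
  rcases hmn'.eq_or_lt with h | h
  · rw [← h, ← smul_add]
    exact one_le_lpSum_smul (by linarith) hn.ne' huv
  have hm : (1 : ℝ) < m := by linarith
  by_contra! hlt
  have hm1 : (0 : ℝ) < m - 1 := by linarith
  have e : (1 / m : ℝ) • ((m : ℝ) • u + (n : ℝ) • v) + ((m - 1) / m : ℝ) • (((m - n) / (m - 1) : ℝ) • v)
      = u + v := by
    ext <;> simp <;> field_simp <;> ring
  have h1 := lpSum_convex (v := (m : ℝ) • u + (n : ℝ) • v) (w := ((m - n) / (m - 1) : ℝ) • v) hp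
    (α := 1 / m) (β := (m - 1) / m) (by positivity) (by positivity) (by field_simp; ring)
  have h2 : lpSum p (((m - n) / (m - 1) : ℝ) • v) ≤ 1 := by
    refine (lpSum_smul_le hp (div_nonneg (by linarith) hm1.le)
      ((div_le_one hm1).2 (by linarith))).trans ?_
    rw [hv, mul_one]
    exact (div_le_one hm1).2 (by linarith)
  rw [e, huv] at h1
  have h3 : 1 / (m : ℝ) * lpSum p ((m : ℝ) • u + (n : ℝ) • v) < 1 / (m : ℝ) * 1 :=
    mul_lt_mul_of_pos_left hlt (by positivity)
  have h4 : (m - 1) / (m : ℝ) * lpSum p (((m - n) / (m - 1) : ℝ) • v) ≤ (m - 1) / (m : ℝ) * 1 :=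
    mul_le_mul_of_nonneg_left h2 (by positivity)
  have h5 : 1 / (m : ℝ) * 1 + (m - 1) / m * 1 = 1 := by field_simp; ring
  linarith

theorem one_le_lpSum_of_pos (hp : 1 ≤ p) (hu : lpSum p u = 1) (hv : lpSum p v = 1)
    (huv : lpSum p (u + v) = 1) {m n : ℤ} (hm : 0 < m) (hn : 0 < n) :
    1 ≤ lpSum p ((m : ℝ) • u + (n : ℝ) • v) := by
  rcases le_total n m with h | h
  · exact one_le_lpSum_of_le hp hv huv hn h
  · rw [add_comm]
    exact one_le_lpSum_of_le hp hu (by rwa [add_comm]) hm h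

/-- The lattice spanned by an inscribed hexagon has no point other than the origin in the interior
of the ball. -/
theorem one_le_lpSum_of_hexagon (hp : 1 ≤ p) (hu : lpSum p u = 1) (hv : lpSum p v = 1)
    (huv : lpSum p (u + v) = 1) {m n : ℤ} (h : m ≠ 0 ∨ n ≠ 0) :
    1 ≤ lpSum p ((m : ℝ) • u + (n : ℝ) • v) := by
  wlog hm : 0 ≤ m generalizing m n
  · have := this (m := -m) (n := -n) (by simpa using h) (by omega)
    rw [← lpSum_neg]
    convert this using 2
    push_cast
    module
  rcases hm.eq_or_lt with rfl | hm
  · simpa using one_le_lpSum_smul (by linarith) (h.resolve_left (by simp)) hv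
  rcases lt_trichotomy n 0 with hn | rfl | hn
  · have e : (m : ℝ) • u + (n : ℝ) • v = (m : ℝ) • (u + v) + ((m - n : ℤ) : ℝ) • (-v) := by
      push_cast; module
    rw [e]
    exact one_le_lpSum_of_pos hp huv (by rwa [lpSum_neg]) (by simpa using hu) hm (by omega)
  · simpa using one_le_lpSum_smul (by linarith) hm.ne' hu
  · exact one_le_lpSum_of_pos hp hu hv huv hm hn

/-- Every unit vector is a vertex of an inscribed hexagon. -/
theorem exists_hexagon (hp : 1 < p) (hu : lpSum p u = 1) :
    ∃ w, lpSum p w = 1 ∧ lpSum p (w + u) = 1 ∧ 0 < planeDet u w := by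
  have hp0 : 0 < p := by linarith
  have hu0 : u ≠ 0 := by
    rintro rfl
    simp [lpSum, zero_rpow hp0.ne'] at hu
  have hq : 0 < u.1 ^ 2 + u.2 ^ 2 := by
    rcases eq_or_ne u.1 0 with h1 | h1
    · have h2 : u.2 ≠ 0 := fun h2 => hu0 (Prod.ext h1 h2)
      positivity
    · positivity
  set z : ℝ → ℝ × ℝ := fun θ => (cos θ * u.1 - sin θ * u.2, cos θ * u.2 + sin θ * u.1) with hz
  have hz0 : ∀ θ, z θ ≠ 0 := fun θ h => by
    have h1 : cos θ * u.1 - sin θ * u.2 = 0 := congrArg Prod.fst h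
    have h2 : cos θ * u.2 + sin θ * u.1 = 0 := congrArg Prod.snd h
    have : (cos θ ^ 2 + sin θ ^ 2) * (u.1 ^ 2 + u.2 ^ 2) = 0 := by
      linear_combination (cos θ * u.1 - sin θ * u.2) * h1 + (cos θ * u.2 + sin θ * u.1) * h2
    rw [cos_sq_add_sin_sq, one_mul] at this
    exact hq.ne' this
  have hcl : Continuous (lpSum p) := by
    unfold lpSum
    exact (continuous_fst.abs.rpow_const fun _ => Or.inr hp0.le).add
      (continuous_snd.abs.rpow_const fun _ => Or.inr hp0.le)
  have hcz : Continuous z := by fun_prop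
  set N : ℝ → ℝ := fun θ => lpSum p (z θ) ^ (-1 / p) with hN
  have hNp : ∀ θ, 0 < N θ := fun θ => rpow_pos_of_pos (lpSum_pos (hz0 θ)) _
  have hcN : Continuous N := (hcl.comp hcz).rpow_const fun θ => Or.inl (lpSum_pos (hz0 θ)).ne'
  have hun : ∀ θ, lpSum p (N θ • z θ) = 1 := fun θ => by
    rw [lpSum_smul, abs_of_pos (hNp θ), hN, ← rpow_mul (lpSum_nonneg _ _), div_mul_cancel₀ _ hp0.ne',
      rpow_neg_one, inv_mul_cancel₀ (lpSum_pos (hz0 θ)).ne']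
  set g : ℝ → ℝ := fun θ => lpSum p (N θ • z θ + u) with hg
  have hcg : Continuous g := hcl.comp ((hcN.smul hcz).add continuous_const)
  have z0 : z 0 = u := by simp [hz]
  have zπ : z π = -u := by ext <;> simp [hz]
  have g0 : 1 < g 0 := by
    have : N 0 • z 0 + u = (2 : ℝ) • u := by
      rw [hN]; simp only [z0, hu, one_rpow, one_smul]; rw [two_smul]
    rw [hg]; simp only [this, lpSum_smul, hu, mul_one]
    rw [abs_of_pos two_pos]
    exact one_lt_rpow one_lt_two hp0
  have gπ : g π < 1 := by
    have : N π • z π + u = 0 := by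
      rw [hN]; simp only [zπ, lpSum_neg, hu, one_rpow, one_smul]; simp
    rw [hg]; simp only [this]
    simp [lpSum, zero_rpow hp0.ne']
  obtain ⟨θ, ⟨h0, hπ⟩, hθ⟩ := intermediate_value_Icc' pi_pos.le hcg.continuousOn ⟨gπ.le, g0.le⟩
  have h0' : 0 < θ := lt_of_le_of_ne h0 (by rintro rfl; linarith)
  have hπ' : θ < π := lt_of_le_of_ne hπ (by rintro rfl; linarith)
  refine ⟨N θ • z θ, hun θ, hθ, ?_⟩
  have : planeDet u (N θ • z θ) = N θ * sin θ * (u.1 ^ 2 + u.2 ^ 2) := by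
    simp only [planeDet, hz, Prod.smul_fst, Prod.smul_snd, smul_eq_mul]; ring
  rw [this]
  have := sin_pos_of_pos_of_lt_pi h0' hπ'
  have := hNp θ
  positivity

end

noncomputable section

open Real Set

variable {p x₁ y₁ x₂ y₂ A B : ℝ}

/-- Three unit vectors in the first quadrant, with the coordinates of an inscribed hexagon up to
signs. -/
structure HexCoords (p x₁ y₁ x₂ y₂ A B : ℝ) : Prop where
  x₁_nonneg : 0 ≤ x₁
  y₁_nonneg : 0 ≤ y₁
  x₂_nonneg : 0 ≤ x₂
  y₂_nonneg : 0 ≤ y₂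
  A_nonneg : 0 ≤ A
  B_nonneg : 0 ≤ B
  x_eq : x₁ = A + x₂
  y_eq : B = y₁ + y₂
  unit₁ : x₁ ^ p + y₁ ^ p = 1
  unit₂ : x₂ ^ p + y₂ ^ p = 1
  unit₃ : A ^ p + B ^ p = 1

namespace HexCoords

theorem symm (h : HexCoords p x₁ y₁ x₂ y₂ A B) : HexCoords p B A y₂ x₂ y₁ x₁ where
  x₁_nonneg := h.B_nonneg
  y₁_nonneg := h.A_nonneg
  x₂_nonneg := h.y₂_nonneg
  y₂_nonneg := h.x₂_nonneg
  A_nonneg := h.y₁_nonneg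
  B_nonneg := h.x₁_nonneg
  x_eq := h.y_eq
  y_eq := h.x_eq
  unit₁ := by rw [add_comm, h.unit₃]
  unit₂ := by rw [add_comm, h.unit₂]
  unit₃ := by rw [add_comm, h.unit₁]

theorem eq_one_of_rpow (hp : 0 < p) {t : ℝ} (h0 : 0 ≤ t) (h : t ^ p = 1) : t = 1 :=
  (rpow_left_inj h0 zero_le_one hp.ne').1 (by rw [h, one_rpow])

theorem x₁_pos (h : HexCoords p x₁ y₁ x₂ y₂ A B) (hp : 0 < p) : 0 < x₁ := by
  refine lt_of_le_of_ne h.x₁_nonneg fun h0 => ?_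
  have hA : A = 0 := by linarith [h.x_eq, h.A_nonneg, h.x₂_nonneg]
  have hx : x₂ = 0 := by linarith [h.x_eq, h.A_nonneg, h.x₂_nonneg]
  have h1 := h.unit₁
  have h2 := h.unit₂
  have h3 := h.unit₃
  rw [← h0, zero_rpow hp.ne', zero_add] at h1
  rw [hx, zero_rpow hp.ne', zero_add] at h2
  rw [hA, zero_rpow hp.ne', zero_add] at h3
  linarith [h.y_eq, eq_one_of_rpow hp h.y₁_nonneg h1, eq_one_of_rpow hp h.y₂_nonneg h2,
    eq_one_of_rpow hp h.B_nonneg h3]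

theorem x₂_pos (h : HexCoords p x₁ y₁ x₂ y₂ A B) (hp : 0 < p) : 0 < x₂ := by
  refine lt_of_le_of_ne h.x₂_nonneg fun h0 => ?_
  have h2 := h.unit₂
  rw [← h0, zero_rpow hp.ne', zero_add] at h2
  have hy := eq_one_of_rpow hp h.y₂_nonneg h2
  have hB : 1 ≤ B ^ p := one_le_rpow (by linarith [h.y_eq, h.y₁_nonneg]) hp.le
  have hA : A ^ p = 0 := le_antisymm (by linarith [h.unit₃]) (rpow_nonneg h.A_nonneg _)
  have hA0 := (rpow_eq_zero h.A_nonneg hp.ne').1 hA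
  linarith [h.x₁_pos hp, h.x_eq]

/-- The parameters of the hexagon lie on the curve, and they determine its determinant. -/
theorem curve (h : HexCoords p x₁ y₁ x₂ y₂ A B) (hp : 0 < p) :
    y₁ / B ∈ Icc (0 : ℝ) (1 / 2) ∧ A / x₁ ∈ Icc (0 : ℝ) (1 / 2) ∧ curveH p (y₁ / B) (A / x₁) = 0 ∧
      0 < x₁ * B - A * y₁ ∧ (x₁ * B - A * y₁) ^ p = Real.exp (logDet p (y₁ / B) (A / x₁)) := by
  have hx := h.x₁_pos hp
  have hB := h.symm.x₁_pos hp
  have hx2 := h.x₂_pos hp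
  have hy2 := h.symm.x₂_pos hp
  set r := y₁ / B with hr
  set c := A / x₁ with hc
  have er : y₁ = r * B := by rw [hr]; field_simp
  have ec : A = c * x₁ := by rw [hc]; field_simp
  have er2 : y₂ = (1 - r) * B := by linarith [h.y_eq]
  have ec2 : x₂ = (1 - c) * x₁ := by linarith [h.x_eq]
  have hr0 : 0 ≤ r := div_nonneg h.y₁_nonneg hB.le
  have hc0 : 0 ≤ c := div_nonneg h.A_nonneg hx.le
  have hr1 : r < 1 := (div_lt_one hB).2 (by linarith [h.y_eq])
  have hc1 : c < 1 := (div_lt_one hx).2 (by linarith [h.x_eq])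
  have ha := one_sub_rpow_pos hp hr0 hr1
  have hb := one_sub_rpow_pos hp hc0 hc1
  have u1 := h.unit₁
  have u2 := h.unit₂
  have u3 := h.unit₃
  rw [er, mul_rpow hr0 hB.le] at u1
  rw [er2, ec2, mul_rpow (by linarith) hB.le, mul_rpow (by linarith) hx.le] at u2
  rw [ec, mul_rpow hc0 hx.le] at u3
  have ha0 : 0 ≤ r ^ p := rpow_nonneg hr0 p
  have hb0 : 0 ≤ c ^ p := rpow_nonneg hc0 p
  have hab : 0 < 1 - r ^ p * c ^ p := by nlinarith
  have eX : x₁ ^ p * (1 - r ^ p * c ^ p) = 1 - r ^ p := by linear_combination u1 - r ^ p * u3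
  have eY : B ^ p * (1 - r ^ p * c ^ p) = 1 - c ^ p := by linear_combination u3 - c ^ p * u1
  have eH : curveH p r c = 0 := by
    unfold curveH
    linear_combination (1 - r ^ p * c ^ p) * u2 - (1 - c) ^ p * eX - (1 - r) ^ p * eY
  have hφ := eH
  rw [curveH_eq hp hr0 hr1 hc0 hc1] at hφ
  have hφ' : 1 - phiF p r - phiF p c = 0 :=
    (mul_eq_zero.1 hφ).resolve_left (mul_pos ha hb).ne'
  have half : ∀ {s t : ℝ}, 0 ≤ s → s < 1 → 0 ≤ t → t < 1 → 1 - phiF p s - phiF p t = 0 →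
      s ≤ 1 / 2 := fun {s t} hs hs1 ht ht1 he => by
    by_contra! hlt
    have := strictMonoOn_phiF hp (a := 1 / 2) (b := s) ⟨by norm_num, by norm_num⟩ ⟨hs, hs1⟩ hlt
    rw [phiF_half hp] at this
    linarith [phiF_nonneg hp ht ht1]
  have hrc : 0 < 1 - r * c := by nlinarith
  have eD : x₁ * B - A * y₁ = x₁ * B * (1 - r * c) := by rw [er, ec]; ring
  refine ⟨⟨hr0, half hr0 hr1 hc0 hc1 hφ'⟩, ⟨hc0, half hc0 hc1 hr0 hr1 (by linarith)⟩, eH,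
    by rw [eD]; positivity, ?_⟩
  have hl : logDet p r c = Real.log ((1 - r ^ p) * (1 - c ^ p) * (1 - r * c) ^ p /
      (1 - r ^ p * c ^ p) ^ 2) := by
    have := rpow_pos_of_pos hrc p
    rw [Real.log_div (by positivity) (by positivity), Real.log_mul (by positivity) this.ne',
      Real.log_mul ha.ne' hb.ne', Real.log_rpow hrc, Real.log_pow, logDet]
    push_cast
    ring
  rw [hl, Real.exp_log (by have := rpow_pos_of_pos hrc p; positivity), eD,
    mul_rpow (by positivity) hrc.le, mul_rpow hx.le hB.le, ← eX, ← eY]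
  field_simp

theorem exp_le {L : ℝ} (h : HexCoords p x₁ y₁ x₂ y₂ A B) (hp : 0 < p)
    (hL : ∀ r, 0 ≤ r → r ≤ curveTau p → L ≤ logDet p r (curveC p r)) :
    Real.exp L ≤ (x₁ * B - A * y₁) ^ p := by
  obtain ⟨h1, h2, h3, -, h5⟩ := h.curve hp
  rw [h5]
  exact Real.exp_le_exp.2 (le_logDet_of_curveH_eq_zero hp hL h1 h2 h3)

end HexCoords

theorem abs_eq_add_of_sum_eq_zero {a b c : ℝ} (h : a + b + c = 0) :
    |a| = |b| + |c| ∨ |b| = |a| + |c| ∨ |c| = |a| + |b| := by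
  rcases abs_cases a with ha | ha <;> rcases abs_cases b with hb | hb <;>
    rcases abs_cases c with hc | hc <;> rw [ha.1, hb.1, hc.1] <;>
    first
      | (left; linarith [ha.2, hb.2, hc.2])
      | (right; left; linarith [ha.2, hb.2, hc.2])
      | (right; right; linarith [ha.2, hb.2, hc.2])

/-- The determinant of an inscribed hexagon with a vertex of largest abscissa and another one of
largest ordinate. -/
theorem exp_le_of_dominant {L : ℝ} {u v w : ℝ × ℝ} (hp : 0 < p)
    (hL : ∀ r, 0 ≤ r → r ≤ curveTau p → L ≤ logDet p r (curveC p r))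
    (hu : lpSum p u = 1) (hv : lpSum p v = 1) (hw : lpSum p w = 1)
    (hx : |u.1| = |v.1| + |w.1|) (hy : |v.2| = |u.2| + |w.2|) :
    Real.exp L ≤ |planeDet u v| ^ p := by
  have h : HexCoords p |u.1| |u.2| |w.1| |w.2| |v.1| |v.2| :=
    ⟨abs_nonneg _, abs_nonneg _, abs_nonneg _, abs_nonneg _, abs_nonneg _, abs_nonneg _, hx, hy,
      hu, hw, hv⟩
  refine (h.exp_le hp hL).trans (rpow_le_rpow (h.curve hp).2.2.2.1.le ?_ hp.le)
  rw [← abs_mul, ← abs_mul]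
  refine (abs_sub_abs_le_abs_sub _ _).trans_eq ?_
  rw [planeDet]; congr 1; ring

theorem false_of_dominant {u v w : ℝ × ℝ} (hp : 0 < p) (hu : lpSum p u = 1) (hv : lpSum p v = 1)
    (hw : lpSum p w = 1) (hx : |u.1| = |v.1| + |w.1|) (hy : |u.2| = |v.2| + |w.2|) : False := by
  have m : ∀ {s t : ℝ}, |s| ≤ |t| → |s| ^ p ≤ |t| ^ p := fun h =>
    rpow_le_rpow (abs_nonneg _) h hp.le
  have e : ∀ {s t : ℝ}, |t| ^ p ≤ |s| ^ p → |t| ≤ |s| := fun h =>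
    (rpow_le_rpow_iff (abs_nonneg _) (abs_nonneg _) hp).1 h
  unfold lpSum at hu hv hw
  have n1 := abs_nonneg v.1
  have n2 := abs_nonneg v.2
  have n3 := abs_nonneg w.1
  have n4 := abs_nonneg w.2
  have a1 := m (s := v.1) (t := u.1) (by linarith)
  have a2 := m (s := v.2) (t := u.2) (by linarith)
  have a3 := m (s := w.1) (t := u.1) (by linarith)
  have a4 := m (s := w.2) (t := u.2) (by linarith)
  have b1 := e (s := v.1) (t := u.1) (by linarith)
  have b2 := e (s := v.2) (t := u.2) (by linarith)
  have b3 := e (s := w.1) (t := u.1) (by linarith)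
  have b4 := e (s := w.2) (t := u.2) (by linarith)
  have c1 : |u.1| = 0 := by linarith [abs_nonneg u.1]
  have c2 : |u.2| = 0 := by linarith [abs_nonneg u.2]
  rw [c1, c2, zero_rpow hp.ne'] at hu
  norm_num at hu

theorem exp_le_of_hexagon {L : ℝ} {u v : ℝ × ℝ} (hp : 0 < p)
    (hL : ∀ r, 0 ≤ r → r ≤ curveTau p → L ≤ logDet p r (curveC p r))
    (hu : lpSum p u = 1) (hv : lpSum p v = 1) (huv : lpSum p (v + u) = 1) :
    Real.exp L ≤ |planeDet u v| ^ p := by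
  have hw : lpSum p (-(u + v)) = 1 := by rwa [lpSum_neg, add_comm]
  have e1 : u.1 + v.1 + (-(u + v)).1 = 0 := by simp
  have e2 : u.2 + v.2 + (-(u + v)).2 = 0 := by simp
  have d1 : |planeDet v u| = |planeDet u v| := by
    rw [← abs_neg]; unfold planeDet; congr 1; ring
  have d2 : |planeDet u (-(u + v))| = |planeDet u v| := by
    rw [← abs_neg]; unfold planeDet; congr 1; simp; ring
  have d3 : |planeDet (-(u + v)) u| = |planeDet u v| := by
    unfold planeDet; congr 1; simp; ring
  have d4 : |planeDet v (-(u + v))| = |planeDet u v| := by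
    unfold planeDet; congr 1; simp; ring
  have d5 : |planeDet (-(u + v)) v| = |planeDet u v| := by
    rw [← abs_neg]; unfold planeDet; congr 1; simp; ring
  generalize -(u + v) = w at *
  rcases abs_eq_add_of_sum_eq_zero e1 with hx | hx | hx <;>
    rcases abs_eq_add_of_sum_eq_zero e2 with hy | hy | hy
  · exact (false_of_dominant hp hu hv hw hx hy).elim
  · exact exp_le_of_dominant hp hL hu hv hw hx hy
  · exact d2 ▸ exp_le_of_dominant hp hL hu hw hv (by rw [hx, add_comm]) hy
  · exact d1 ▸ exp_le_of_dominant hp hL hv hu hw hx hy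
  · exact (false_of_dominant hp hv hu hw hx hy).elim
  · exact d4 ▸ exp_le_of_dominant hp hL hv hw hu (by rw [hx, add_comm]) (by rw [hy, add_comm])
  · exact d3 ▸ exp_le_of_dominant hp hL hw hu hv hx (by rw [hy, add_comm])
  · exact d5 ▸ exp_le_of_dominant hp hL hw hv hu (by rw [hx, add_comm]) (by rw [hy, add_comm])
  · exact (false_of_dominant hp hw hu hv hx hy).elim

end

noncomputable section

open Real Set

variable {p : ℝ} {e f : ℝ × ℝ}

theorem abs_fst_le_of_lpSum_le {R : ℝ} (hp : 0 < p) {z : ℝ × ℝ} (h : lpSum p z ≤ R) :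
    |z.1| ≤ R ^ (1 / p) ∧ |z.2| ≤ R ^ (1 / p) := by
  have aux : ∀ x : ℝ, |x| ^ p ≤ R → |x| ≤ R ^ (1 / p) := fun x hx => by
    have := rpow_le_rpow (by positivity) hx (one_div_pos.2 hp).le
    rwa [← rpow_mul (abs_nonneg _), mul_one_div_cancel hp.ne', rpow_one] at this
  have h1 : 0 ≤ |z.1| ^ p := by positivity
  have h2 : 0 ≤ |z.2| ^ p := by positivity
  unfold lpSum at h
  exact ⟨aux _ (by linarith), aux _ (by linarith)⟩

theorem abs_planeDet_le {R : ℝ} (u v : ℝ × ℝ) (h1 : |u.1| ≤ R) (h2 : |u.2| ≤ R) :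
    |planeDet u v| ≤ R * (|v.1| + |v.2|) := by
  have := abs_sub (u.1 * v.2) (u.2 * v.1)
  rw [abs_mul, abs_mul] at this
  unfold planeDet
  nlinarith [abs_nonneg v.1, abs_nonneg v.2]

/-- A plane lattice has a shortest vector. -/
theorem exists_shortest (hp : 0 < p) (hD : planeDet e f ≠ 0) :
    ∃ m n : ℤ, (m ≠ 0 ∨ n ≠ 0) ∧ ∀ m' n' : ℤ, (m' ≠ 0 ∨ n' ≠ 0) →
      lpSum p ((m : ℝ) • e + (n : ℝ) • f) ≤ lpSum p ((m' : ℝ) • e + (n' : ℝ) • f) := by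
  set F : ℤ × ℤ → ℝ := fun k => lpSum p ((k.1 : ℝ) • e + (k.2 : ℝ) • f) with hF
  set K : Set (ℤ × ℤ) := {k | (k.1 ≠ 0 ∨ k.2 ≠ 0) ∧ F k ≤ F (1, 0)} with hK
  set R := F (1, 0) ^ (1 / p)
  obtain ⟨M, hM⟩ := exists_nat_ge (R * (|e.1| + |e.2| + (|f.1| + |f.2|)) / |planeDet e f|)
  rw [div_le_iff₀ (abs_pos.2 hD)] at hM
  have hR : 0 ≤ R := rpow_nonneg (lpSum_nonneg _ _) _
  have hfin : K.Finite := by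
    refine ((finite_Icc (-(M : ℤ)) M).prod (finite_Icc (-(M : ℤ)) M)).subset fun k hk => ?_
    obtain ⟨b1, b2⟩ := abs_fst_le_of_lpSum_le hp hk.2
    have c1 := abs_planeDet_le _ f b1 b2
    have c2 := abs_planeDet_le _ e b1 b2
    have e1 : planeDet ((k.1 : ℝ) • e + (k.2 : ℝ) • f) f = k.1 * planeDet e f := by
      simp [planeDet]; ring
    have e2 : planeDet ((k.1 : ℝ) • e + (k.2 : ℝ) • f) e = -(k.2 * planeDet e f) := by
      simp [planeDet]; ring
    rw [e1, abs_mul] at c1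
    rw [e2, abs_neg, abs_mul] at c2
    have d1 : |(k.1 : ℝ)| ≤ M := by
      refine le_of_mul_le_mul_right (c1.trans (le_trans ?_ hM)) (abs_pos.2 hD)
      exact mul_le_mul_of_nonneg_left (by linarith [abs_nonneg e.1, abs_nonneg e.2]) hR
    have d2 : |(k.2 : ℝ)| ≤ M := by
      refine le_of_mul_le_mul_right (c2.trans (le_trans ?_ hM)) (abs_pos.2 hD)
      exact mul_le_mul_of_nonneg_left (by linarith [abs_nonneg f.1, abs_nonneg f.2]) hR
    rw [abs_le] at d1 d2
    refine ⟨⟨?_, ?_⟩, ?_, ?_⟩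
    · exact_mod_cast d1.1
    · exact_mod_cast d1.2
    · exact_mod_cast d2.1
    · exact_mod_cast d2.2
  obtain ⟨k, hk, hmin⟩ := exists_min_image K F hfin ⟨(1, 0), Or.inl one_ne_zero, le_rfl⟩
  refine ⟨k.1, k.2, hk.1, fun m' n' h => ?_⟩
  rcases le_total (F (m', n')) (F (1, 0)) with h1 | h1
  · exact hmin (m', n') ⟨h, h1⟩
  · exact hk.2.trans h1

/-- The coordinates of a shortest lattice vector are coprime. -/
theorem isCoprime_of_shortest (hp : 0 < p) {m n : ℤ} (hmn : m ≠ 0 ∨ n ≠ 0)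
    (h1 : ∀ m' n' : ℤ, (m' ≠ 0 ∨ n' ≠ 0) → 1 ≤ lpSum p ((m' : ℝ) • e + (n' : ℝ) • f))
    (h : ∀ m' n' : ℤ, (m' ≠ 0 ∨ n' ≠ 0) →
      lpSum p ((m : ℝ) • e + (n : ℝ) • f) ≤ lpSum p ((m' : ℝ) • e + (n' : ℝ) • f)) :
    IsCoprime m n := by
  rw [Int.isCoprime_iff_gcd_eq_one]
  obtain ⟨m', hm'⟩ := Int.gcd_dvd_left m n
  obtain ⟨n', hn'⟩ := Int.gcd_dvd_right m n
  have hg : 0 < Int.gcd m n := Int.gcd_pos_iff.2 hmn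
  generalize Int.gcd m n = g at *
  have hmn' : m' ≠ 0 ∨ n' ≠ 0 := by
    rcases hmn with h0 | h0
    · left; rintro rfl; simp at hm'; exact h0 hm'
    · right; rintro rfl; simp at hn'; exact h0 hn'
  have h2 := h m' n' hmn'
  have h3 := h1 m' n' hmn'
  have e1 : (m : ℝ) • e + (n : ℝ) • f = (g : ℝ) • ((m' : ℝ) • e + (n' : ℝ) • f) := by
    rw [hm', hn']; push_cast; module
  rw [e1, lpSum_smul, abs_of_nonneg (Nat.cast_nonneg g)] at h2
  by_contra hne
  have hg2 : (1 : ℝ) < g := by exact_mod_cast (by omega : 1 < g)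
  have := one_lt_rpow hg2 hp
  nlinarith

/-- The covolume of an admissible lattice is bounded below by the hexagons. -/
theorem exp_le_of_admissible {L : ℝ} (hp : 1 < p)
    (hL : ∀ r, 0 ≤ r → r ≤ curveTau p → L ≤ logDet p r (curveC p r)) (hD : planeDet e f ≠ 0)
    (h : ∀ m n : ℤ, (m ≠ 0 ∨ n ≠ 0) → 1 ≤ lpSum p ((m : ℝ) • e + (n : ℝ) • f)) :
    Real.exp L ≤ |planeDet e f| ^ p := by
  wlog hD0 : 0 < planeDet e f generalizing f
  · have e1 : planeDet e (-f) = -planeDet e f := by simp [planeDet]; ring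
    have := this (f := -f) (by rw [e1]; exact neg_ne_zero.2 hD) (fun m n hmn => by
      have := h m (-n) (by simpa using hmn)
      convert this using 2
      push_cast; module) (by
        rw [e1]; exact neg_pos.2 (lt_of_le_of_ne (not_lt.1 hD0) hD))
    rwa [e1, abs_neg] at this
  have hp0 : 0 < p := by linarith
  obtain ⟨m, n, hmn, hmin⟩ := exists_shortest hp0 hD
  obtain ⟨a, b, hab⟩ := isCoprime_of_shortest hp0 hmn h hmin
  have habR : (a : ℝ) * m + b * n = 1 := by exact_mod_cast hab
  have hμ := h m n hmn
  set u₀ : ℝ × ℝ := (m : ℝ) • e + (n : ℝ) • f with hu₀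
  set v₀ : ℝ × ℝ := ((-b : ℤ) : ℝ) • e + (a : ℝ) • f with hv₀
  have hdet : planeDet u₀ v₀ = planeDet e f := by
    have : planeDet u₀ v₀ = ((a : ℝ) * m + b * n) * planeDet e f := by
      simp [planeDet, hu₀, hv₀]; ring
    rw [this, habR, one_mul]
  have hline : ∀ k : ℤ, lpSum p u₀ ≤ lpSum p (v₀ + (k : ℝ) • u₀) := fun k => by
    have e1 : v₀ + (k : ℝ) • u₀ = ((-b + k * m : ℤ) : ℝ) • e + ((a + k * n : ℤ) : ℝ) • f := by
      rw [hu₀, hv₀]; push_cast; module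
    rw [e1]
    refine hmin _ _ ?_
    by_contra! h0
    have : a * m + b * n = 0 := by linear_combination m * h0.2 - n * h0.1
    omega
  set κ := lpSum p u₀ ^ (-1 / p) with hκ
  have hμ0 : 0 < lpSum p u₀ := by linarith
  have hκ0 : 0 < κ := rpow_pos_of_pos hμ0 _
  have hκ1 : κ ≤ 1 := rpow_le_one_of_one_le_of_nonpos hμ
    (div_nonpos_of_nonpos_of_nonneg (by norm_num) hp0.le)
  have hκp : κ ^ p * lpSum p u₀ = 1 := by
    rw [hκ, ← rpow_mul hμ0.le, div_mul_cancel₀ _ hp0.ne', rpow_neg_one, inv_mul_cancel₀ hμ0.ne']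
  have hu : lpSum p (κ • u₀) = 1 := by rw [lpSum_smul, abs_of_pos hκ0, hκp]
  obtain ⟨w, hw, hwu, hw0⟩ := exists_hexagon hp hu
  have hdet2 : planeDet (κ • u₀) (κ • v₀) = κ ^ 2 * planeDet e f := by
    rw [← hdet]; simp [planeDet]; ring
  have hle : planeDet (κ • u₀) w ≤ planeDet (κ • u₀) (κ • v₀) := by
    refine planeDet_le_of_line hp hu.le hw.le hwu.le (by rw [hdet2]; positivity) fun k => ?_
    have e1 : κ • v₀ + (k : ℝ) • κ • u₀ = κ • (v₀ + (k : ℝ) • u₀) := by module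
    rw [e1, lpSum_smul, abs_of_pos hκ0, ← hκp]
    exact mul_le_mul_of_nonneg_left (hline k) (by positivity)
  refine (exp_le_of_hexagon hp0 hL hu hw hwu).trans (rpow_le_rpow (abs_nonneg _) ?_ hp0.le)
  rw [abs_of_pos hw0, abs_of_pos hD0]
  rw [hdet2] at hle
  nlinarith [pow_le_one₀ hκ0.le hκ1 (n := 2)]

end

noncomputable section

open Real Set

theorem rpow_add_rpow_lt {p a b c d : ℝ} (hp : 1 < p) (ha : 0 ≤ a) (hac : a < c) (hcb : c < b)
    (h : a + b = c + d) : c ^ p + d ^ p < a ^ p + b ^ p := by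
  have hab : 0 < b - a := by linarith
  have key : ∀ α β : ℝ, 0 < α → 0 < β → α + β = 1 → (α * a + β * b) ^ p < α * a ^ p + β * b ^ p :=
    fun α β hα hβ h => (strictConvexOn_rpow hp).2 (mem_Ici.2 ha) (mem_Ici.2 (by linarith))
      (by linarith : a < b).ne hα hβ h
  have h1 := key ((b - c) / (b - a)) ((c - a) / (b - a)) (div_pos (by linarith) hab)
    (div_pos (by linarith) hab) (by field_simp; ring)
  have h2 := key ((c - a) / (b - a)) ((b - c) / (b - a)) (div_pos (by linarith) hab)
    (div_pos (by linarith) hab) (by field_simp; ring)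
  have e1 : (b - c) / (b - a) * a + (c - a) / (b - a) * b = c := by field_simp; ring
  have e2 : (c - a) / (b - a) * a + (b - c) / (b - a) * b = d := by
    have : d = a + b - c := by linarith
    rw [this]; field_simp; ring
  have e3 : (b - c) / (b - a) + (c - a) / (b - a) = 1 := by field_simp; ring
  rw [e1] at h1
  rw [e2] at h2
  have e4 : (b - c) / (b - a) * a ^ p + (c - a) / (b - a) * b ^ p
      + ((c - a) / (b - a) * a ^ p + (b - c) / (b - a) * b ^ p) = a ^ p + b ^ p := by
    linear_combination (a ^ p + b ^ p) * e3
  linarith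

theorem HexCoords.logDet_eq_logDiag {p x₁ y₁ s A B : ℝ} (h : HexCoords p x₁ y₁ s s A B)
    (hp : 1 < p) : logDet p (y₁ / B) (A / x₁) = logDiag p := by
  have hp0 : 0 < p := by linarith
  have hs := h.x₂_pos hp0
  have hsum : y₁ + x₁ = A + B := by linarith [h.x_eq, h.y_eq]
  have hA : A = y₁ := by
    rcases lt_trichotomy A y₁ with hlt | he | hlt
    · have := rpow_add_rpow_lt hp h.A_nonneg hlt (by linarith [h.y_eq]) hsum.symm
      linarith [h.unit₁, h.unit₃]
    · exact he
    · have := rpow_add_rpow_lt hp h.y₁_nonneg hlt (by linarith [h.x_eq]) hsum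
      linarith [h.unit₁, h.unit₃]
  have hB : B = x₁ := by linarith
  obtain ⟨h1, -, h3, -⟩ := h.curve hp0
  rw [hA, hB] at h3 ⊢
  rw [hB] at h1
  rw [curveH_eq hp0 h1.1 (by linarith [h1.2]) h1.1 (by linarith [h1.2])] at h3
  have hU := one_sub_rpow_pos hp0 h1.1 (by linarith [h1.2])
  have hφ : phiF p (y₁ / x₁) = 1 / 2 := by
    have := (mul_eq_zero.1 h3).resolve_left (mul_pos hU hU).ne'
    linarith
  have : curveTau p = y₁ / x₁ := by rw [curveTau, ← hφ, phiInv_phiF hp0 h1]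
  rw [logDiag, this]

variable {p σ τ : ℝ}

theorem unit_rpow (hp : 0 < p) (hσ : 0 ≤ σ) :
    ((1 + σ ^ p) ^ (-1 / p)) ^ p + (σ * (1 + σ ^ p) ^ (-1 / p)) ^ p = 1 := by
  have h : 0 < 1 + σ ^ p := by positivity
  rw [mul_rpow hσ (by positivity), ← rpow_mul h.le, div_mul_cancel₀ _ hp.ne', rpow_neg_one]
  field_simp

/-- The inscribed hexagon of the Minkowski–Cohn parametrization. -/
theorem hexCoords_of_coef (hp : 0 < p) (hτ : 0 ≤ τ) (hτσ : τ ≤ σ)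
    (h : Acoef p σ τ ^ p + Bcoef p σ τ ^ p = 1) :
    HexCoords p ((1 + τ ^ p) ^ (-1 / p)) (τ * (1 + τ ^ p) ^ (-1 / p)) ((1 + σ ^ p) ^ (-1 / p))
      (σ * (1 + σ ^ p) ^ (-1 / p)) (Acoef p σ τ) (Bcoef p σ τ) where
  x₁_nonneg := by positivity
  y₁_nonneg := by positivity
  x₂_nonneg := by have := hτ.trans hτσ; positivity
  y₂_nonneg := by have := hτ.trans hτσ; positivity
  A_nonneg := by
    have h1 : τ ^ p ≤ σ ^ p := rpow_le_rpow hτ hτσ hp.le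
    exact sub_nonneg.2 (rpow_le_rpow_of_nonpos (by positivity) (by linarith)
      (div_nonpos_of_nonpos_of_nonneg (by norm_num) hp.le))
  B_nonneg := by have := hτ.trans hτσ; unfold Bcoef; positivity
  x_eq := by unfold Acoef; ring
  y_eq := by unfold Bcoef; ring
  unit₁ := unit_rpow hp hτ
  unit₂ := unit_rpow hp (hτ.trans hτσ)
  unit₃ := h

theorem HexCoords.lpSum_eq {x₁ y₁ x₂ y₂ A B : ℝ} (h : HexCoords p x₁ y₁ x₂ y₂ A B) :
    lpSum p (x₁, y₁) = 1 ∧ lpSum p (-x₂, y₂) = 1 ∧ lpSum p ((x₁, y₁) + (-x₂, y₂)) = 1 := by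
  have e1 : x₁ + -x₂ = A := by linarith [h.x_eq]
  have e2 : y₁ + y₂ = B := h.y_eq.symm
  simp only [lpSum, Prod.mk_add_mk, e1, e2, abs_neg, abs_of_nonneg h.x₁_nonneg,
    abs_of_nonneg h.y₁_nonneg, abs_of_nonneg h.x₂_nonneg, abs_of_nonneg h.y₂_nonneg,
    abs_of_nonneg h.A_nonneg, abs_of_nonneg h.B_nonneg]
  exact ⟨h.unit₁, h.unit₂, h.unit₃⟩

/-- A lattice is admissible if its nonzero points have `lpSum` at least one. -/
theorem isAdmissible_iff {a b c d : ℝ} (hD : a * d - b * c ≠ 0) :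
    IsAdmissible a b c d (Dset p) ↔ ∀ m n : ℤ, (m ≠ 0 ∨ n ≠ 0) →
      1 ≤ lpSum p ((m : ℝ) • (a, b) + (n : ℝ) • (c, d)) := by
  have e1 : ∀ m n : ℤ, (m : ℝ) • (a, b) + (n : ℝ) • (c, d) = (m * a + n * c, m * b + n * d) :=
    fun m n => by simp
  constructor
  · intro h m n hmn
    by_contra! hlt
    rw [e1] at hlt
    have h0 := h _ ⟨m, n, rfl⟩ hlt
    have h1 : m * a + n * c = 0 := congrArg Prod.fst h0
    have h2 : m * b + n * d = 0 := congrArg Prod.snd h0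
    have hm : (m : ℝ) * (a * d - b * c) = 0 := by linear_combination d * h1 - c * h2
    have hn : (n : ℝ) * (a * d - b * c) = 0 := by linear_combination a * h2 - b * h1
    have hm' := (mul_eq_zero.1 hm).resolve_right hD
    have hn' := (mul_eq_zero.1 hn).resolve_right hD
    norm_cast at hm' hn'
    tauto
  · rintro h v ⟨m, n, rfl⟩ hv
    by_cases hmn : m ≠ 0 ∨ n ≠ 0
    · have := h m n hmn
      rw [e1] at this
      exact absurd hv (not_lt.2 this)
    · push Not at hmn
      simp [hmn.1, hmn.2]

/-- The critical determinant is the determinant of an inscribed hexagon, if that is minimal. -/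
theorem critDet_eq_of_hexCoords {x₁ y₁ x₂ y₂ A B L : ℝ} (hp : 1 < p)
    (h : HexCoords p x₁ y₁ x₂ y₂ A B) (hL : (x₁ * B - A * y₁) ^ p = Real.exp L)
    (hmin : ∀ r, 0 ≤ r → r ≤ curveTau p → L ≤ logDet p r (curveC p r)) :
    critDet (Dset p) = x₁ * B - A * y₁ := by
  have hp0 : 0 < p := by linarith
  have hpos := (h.curve hp0).2.2.2.1
  have hdet : x₁ * y₂ - y₁ * -x₂ = x₁ * B - A * y₁ := by
    rw [h.x_eq, h.y_eq]; ring
  refine IsLeast.csInf_eq ⟨⟨x₁, y₁, -x₂, y₂, ?_, ?_, ?_⟩, ?_⟩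
  · rw [hdet]; exact hpos.ne'
  · obtain ⟨h1, h2, h3⟩ := h.lpSum_eq
    rw [isAdmissible_iff (by rw [hdet]; exact hpos.ne')]
    exact fun m n hmn => one_le_lpSum_of_hexagon hp.le h1 h2 h3 hmn
  · rw [hdet, abs_of_pos hpos]
  · rintro δ ⟨a, b, c, d, hD, hadm, rfl⟩
    have := exp_le_of_admissible (e := (a, b)) (f := (c, d)) hp hmin hD
      ((isAdmissible_iff hD).1 hadm)
    rw [← hL] at this
    exact (rpow_le_rpow_iff hpos.le (abs_nonneg _) hp0).1 this

theorem deltaFun_eq (p σ : ℝ) (T : ℝ → ℝ) :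
    DeltaFun p T σ = (1 + T σ ^ p) ^ (-1 / p) * Bcoef p σ (T σ)
      - Acoef p σ (T σ) * (T σ * (1 + T σ ^ p) ^ (-1 / p)) := by
  unfold DeltaFun Acoef Bcoef; ring

theorem one_le_sigmaP (hp : 1 < p) : 1 ≤ sigmaP p := by
  have : (2 : ℝ) ^ (1 : ℝ) ≤ 2 ^ p := rpow_le_rpow_of_exponent_le one_le_two hp.le
  rw [rpow_one] at this
  exact one_le_rpow (by linarith) (by positivity)

theorem sigmaP_rpow (hp : 0 < p) : sigmaP p ^ p = 2 ^ p - 1 := by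
  have : (1 : ℝ) ≤ 2 ^ p := one_le_rpow one_le_two hp.le
  rw [sigmaP, ← rpow_mul (by linarith), one_div_mul_cancel hp.ne', rpow_one]

theorem deltaFun_one_rpow {T : ℝ → ℝ} (hp : 1 < p) (hT0 : 0 ≤ T 1) (hT1 : T 1 ≤ 1)
    (h : Acoef p 1 (T 1) ^ p + Bcoef p 1 (T 1) ^ p = 1) :
    DeltaFun p T 1 ^ p = Real.exp (logDiag p) := by
  have hh := hexCoords_of_coef (by linarith) hT0 hT1 h
  rw [deltaFun_eq, (hh.curve (by linarith)).2.2.2.2]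
  rw [one_mul] at hh
  rw [hh.logDet_eq_logDiag hp]

theorem deltaFun_sigmaP_rpow {T : ℝ → ℝ} (hp : 1 < p) (hT0 : 0 ≤ T (sigmaP p))
    (hT1 : T (sigmaP p) ≤ 1)
    (h : Acoef p (sigmaP p) (T (sigmaP p)) ^ p + Bcoef p (sigmaP p) (T (sigmaP p)) ^ p = 1) :
    DeltaFun p T (sigmaP p) ^ p = Real.exp (logEnd p) := by
  have hp0 : 0 < p := by linarith
  have hσ := one_le_sigmaP hp
  have hh := hexCoords_of_coef hp0 hT0 (hT1.trans hσ) h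
  have hpos := (hh.curve hp0).2.2.2.1
  rw [← deltaFun_eq] at hpos
  have hs : (1 + sigmaP p ^ p) ^ (-1 / p) = 1 / 2 := by
    rw [sigmaP_rpow hp0, add_sub_cancel, ← rpow_mul two_pos.le, mul_div_cancel₀ _ hp0.ne',
      rpow_neg_one, one_div]
  obtain ⟨h1, h2, h3⟩ := hh.lpSum_eq
  have hd := hh.unit₂
  have hΔ : planeDet (-(1 + sigmaP p ^ p) ^ (-1 / p), sigmaP p * (1 + sigmaP p ^ p) ^ (-1 / p))
      (-(((1 + T (sigmaP p) ^ p) ^ (-1 / p), T (sigmaP p) * (1 + T (sigmaP p) ^ p) ^ (-1 / p)) +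
      (-(1 + sigmaP p ^ p) ^ (-1 / p), sigmaP p * (1 + sigmaP p ^ p) ^ (-1 / p))))
      = DeltaFun p T (sigmaP p) := by
    simp only [planeDet, DeltaFun, Prod.mk_add_mk, Prod.neg_mk]; ring
  rw [hs] at h2 h3 hd hΔ
  set v : ℝ × ℝ := ((1 + T (sigmaP p) ^ p) ^ (-1 / p),
    T (sigmaP p) * (1 + T (sigmaP p) ^ p) ^ (-1 / p))
  set u : ℝ × ℝ := (-(1 / 2), sigmaP p * (1 / 2)) with hu
  have k1 : lpSum p (-1, 0) = 1 := by simp [lpSum, zero_rpow hp0.ne']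
  have k2 : planeDet u (-((1, 0) + u)) = sigmaP p * (1 / 2) := by
    simp only [planeDet, hu, Prod.mk_add_mk, Prod.neg_mk]; ring
  have k3 : lpSum p ((1, 0) + u) = 1 := by
    have e : (1, 0) + u = (1 / 2, sigmaP p * (1 / 2)) := by
      rw [hu, Prod.mk_add_mk]; norm_num
    rw [e, lpSum]
    simp only
    rw [abs_of_pos (by norm_num), abs_of_nonneg (by linarith), hd]
  have key := planeDet_eq_of_hexagon hp h2 (v := -(v + u)) (w := -((1, 0) + u))
    (by rwa [lpSum_neg]) (by simpa [lpSum_neg] using h1) (by rwa [lpSum_neg])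
    (by simpa using k1) (by rw [hΔ]; exact hpos) (by rw [k2]; linarith)
  rw [hΔ, k2] at key
  have hlt : (1 / 2 : ℝ) ^ p < 1 := rpow_lt_one (by norm_num) (by norm_num) hp0
  rw [key, logEnd_eq hp0, Real.exp_log (by linarith)]
  linarith

end

/-- **Main theorem; Minkowski's conjecture in Davis's amendment.**
Let `p₀` be the unique real with `2.57 ≤ p₀ ≤ 2.58` and `Δ(p₀,σ_{p₀}) = Δ(p₀,1)`.
Then `Δ(D_p) = Δ(p,1)` for `1 < p ≤ 2` or `p ≥ p₀`, and `Δ(D_p) = Δ(p,σ_p)` for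
`2 ≤ p ≤ p₀`. -/
theorem stmt_16 (TP : ℝ → ℝ)
    (hTP : ∀ p : ℝ, 1 < p →
      0 ≤ TP p ∧ TP p < 1 ∧ 2 * (1 - TP p) ^ p = 1 + TP p ^ p)
    (T : ℝ → ℝ → ℝ)
    (hT : ∀ p : ℝ, 1 < p → ∀ σ ∈ Set.Icc 1 (sigmaP p),
      0 ≤ T p σ ∧ T p σ ≤ TP p ∧
        Acoef p σ (T p σ) ^ p + Bcoef p σ (T p σ) ^ p = 1)
    (p0 : ℝ) (hp0 : 2.57 ≤ p0 ∧ p0 ≤ 2.58 ∧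
      DeltaFun p0 (T p0) (sigmaP p0) = DeltaFun p0 (T p0) 1)
    (p : ℝ) (hp : 1 < p) :
    (((1 < p ∧ p ≤ 2) ∨ p0 ≤ p) → critDet (Dset p) = DeltaFun p (T p) 1) ∧
    ((2 ≤ p ∧ p ≤ p0) → critDet (Dset p) = DeltaFun p (T p) (sigmaP p)) := by
  have htau : ∀ q : ℝ, 1 < q → ∀ σ ∈ Set.Icc 1 (sigmaP q), 0 ≤ T q σ ∧ T q σ ≤ 1 ∧
      Acoef q σ (T q σ) ^ q + Bcoef q σ (T q σ) ^ q = 1 := fun q hq σ hσ => by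
    obtain ⟨h1, h2, h3⟩ := hT q hq σ hσ
    exact ⟨h1, h2.trans (hTP q hq).2.1.le, h3⟩
  have hcross : logEnd p0 = logDiag p0 := by
    have hq : 1 < p0 := by linarith [hp0.1]
    have hσ := one_le_sigmaP hq
    obtain ⟨a1, a2, a3⟩ := htau p0 hq 1 ⟨le_rfl, hσ⟩
    obtain ⟨b1, b2, b3⟩ := htau p0 hq _ ⟨hσ, le_rfl⟩
    have h1 := deltaFun_one_rpow hq a1 a2 a3
    have h2 := deltaFun_sigmaP_rpow hq b1 b2 b3
    rw [hp0.2.2, h1] at h2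
    exact (Real.exp_injective h2).symm
  have hσ := one_le_sigmaP hp
  constructor
  · intro h
    obtain ⟨a1, a2, a3⟩ := htau p hp 1 ⟨le_rfl, hσ⟩
    rw [deltaFun_eq]
    refine critDet_eq_of_hexCoords hp (hexCoords_of_coef (by linarith) a1 a2 a3) ?_
      fun r => logDiag_le_logDet_curveC hp0.1 hcross hp (h.imp_left And.right)
    rw [← deltaFun_eq, deltaFun_one_rpow hp a1 a2 a3]
  · rintro ⟨h2, h3⟩
    obtain ⟨b1, b2, b3⟩ := htau p hp _ ⟨hσ, le_rfl⟩
    rw [deltaFun_eq]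
    refine critDet_eq_of_hexCoords hp (hexCoords_of_coef (by linarith) b1 (b2.trans hσ) b3) ?_
      fun r => logEnd_le_logDet_curveC hp0.2.1 hcross h2 h3
    rw [← deltaFun_eq, deltaFun_sigmaP_rpow hp b1 b2 b3]
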